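/- Let n ∈ ℕ. Let (C,u) be a ℤ-valued field of mixed characteristic whose uniformizer is p = char(Cu) (i.e. (C,u) is unramified), and let (K,v) and (L,w) be henselian valued field extensions of (C,u) in which p is still a uniformizer, such that the residue field extensions Kv/Cu and Lw/Cu are separable. If Th_{∃_n}(Kv,Cu) ⊆ Th_{∃_n}(Lw,Cu) (as L_ring(Cu)-theories), then Th_{∃_n}(K,v,C) ⊆ Th_{∃_n}(L,w,C) (as L_val(C)-theories). -/

import Mathlib

open FirstOrder FirstOrder.Language

universe u v w x

namespace Paper



/-! ### Syntactic fragments -/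

/-- `IsExistsN n φ`: `φ` is an `∃_n`-formula, i.e. of the form `∃ x₁ … x_m ψ`
with `m ≤ n` and `ψ` quantifier-free. -/
inductive IsExistsN {L : Language} {α : Type*} : ℕ → ∀ {k : ℕ}, L.BoundedFormula α k → Prop
  | qf {n k : ℕ} {φ : L.BoundedFormula α k} : φ.IsQF → IsExistsN n φ
  | ex {n k : ℕ} {φ : L.BoundedFormula α (k + 1)} : IsExistsN n φ → IsExistsN (n + 1) φ.ex

/-- `φ` is an existential formula. -/
def IsExists {L : Language} {α : Type*} {k : ℕ} (φ : L.BoundedFormula α k) : Prop :=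
  ∃ n : ℕ, IsExistsN n φ

/-- Positive boolean combinations of formulas satisfying `P`. -/
inductive IsPosBC {L : Language} {α : Type*} (P : ∀ {k : ℕ}, L.BoundedFormula α k → Prop) :
    ∀ {k : ℕ}, L.BoundedFormula α k → Prop
  | base {k : ℕ} {φ : L.BoundedFormula α k} : P φ → IsPosBC P φ
  | inf {k : ℕ} {φ ψ : L.BoundedFormula α k} :
      IsPosBC P φ → IsPosBC P ψ → IsPosBC P (φ ⊓ ψ)
  | sup {k : ℕ} {φ ψ : L.BoundedFormula α k} :
      IsPosBC P φ → IsPosBC P ψ → IsPosBC P (φ ⊔ ψ)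

/-- The `∃₁`-fragment: positive boolean combinations of formulas of the form `η` or `∃ y η`
with `η` quantifier-free. -/
def IsE1 {L : Language} {α : Type*} {k : ℕ} (φ : L.BoundedFormula α k) : Prop :=
  IsPosBC (fun {k} φ => φ.IsQF ∨ ∃ ψ : L.BoundedFormula α (k + 1), ψ.IsQF ∧ φ = ψ.ex) φ

/-- `∃_n∃₁`-formulas: `∃ x₁ … x_m ψ` with `m ≤ n` and `ψ` in the `∃₁`-fragment. -/
inductive IsExistsNE1 {L : Language} {α : Type*} : ℕ → ∀ {k : ℕ}, L.BoundedFormula α k → Prop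
  | e1 {n k : ℕ} {φ : L.BoundedFormula α k} : IsE1 φ → IsExistsNE1 n φ
  | ex {n k : ℕ} {φ : L.BoundedFormula α (k + 1)} : IsExistsNE1 n φ → IsExistsNE1 (n + 1) φ.ex

/-- The `∃^n`-fragments, defined inductively: `∃^0`-formulas are the quantifier-free ones,
and an `∃^{n+1}`-formula is of the form `ψ` or `∃ x ψ` with `ψ` a positive boolean
combination of `∃^n`-formulas. -/
def IsExpN {L : Language} {α : Type*} : ℕ → ∀ {k : ℕ}, L.BoundedFormula α k → Prop
  | 0, _, φ => φ.IsQF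
  | n + 1, k, φ => IsPosBC (IsExpN n) φ ∨
      ∃ ψ : L.BoundedFormula α (k + 1), IsPosBC (IsExpN n) ψ ∧ φ = ψ.ex



/-! ### The language of rings with constants, and realization -/

/-- The `Language.ring`-structure on a ring. -/
noncomputable def ringStructure (M : Type*) [CommRing M] : Language.ring.Structure M :=
  (FirstOrder.Ring.compatibleRingOfRing M).toStructure

/-- The `L_ring(α)`-structure on a ring `M` with constants interpreted via `f : α → M`. -/
noncomputable def ringConStructure {α M : Type*} [CommRing M] (f : α → M) :
    (Language.ring[[α]]).Structure M :=
  letI := ringStructure M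
  letI := constantsOn.structure f
  inferInstance

/-- `M ⊨ φ` for an `L_ring(α)`-sentence, with constants interpreted via `f`. -/
def RealizeRing (M : Type*) [CommRing M] {α : Type*} (f : α → M)
    (φ : (Language.ring[[α]]).Sentence) : Prop :=
  @Sentence.Realize _ M (ringConStructure f) φ

/-- The unary relation symbol `O` for the valuation ring. -/
inductive ValRel : ℕ → Type
  | isO : ValRel 1

/-- The language with a single unary predicate `O`. -/
def oLang : Language := ⟨fun _ => Empty, ValRel⟩

/-- The language of valued fields `L_val = L_ring ∪ {O}`. -/
abbrev Lval : Language := Language.ring.sum oLang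

/-- The `oLang`-structure on `M` in which `O` is interpreted as the set `O`. -/
def oStructure {M : Type*} (O : Set M) : oLang.Structure M where
  funMap := fun f _ => f.elim
  RelMap := fun {_} r => match r with
    | .isO => fun xs => xs 0 ∈ O

/-- The `L_val(α)`-structure on a ring `M`, with `O` interpreted as the set `O` and
constants interpreted via `f : α → M`. -/
noncomputable def valConStructure {α M : Type*} [CommRing M] (O : Set M) (f : α → M) :
    (Lval[[α]]).Structure M :=
  letI := ringStructure M
  letI := oStructure O
  letI : Lval.Structure M := inferInstance
  letI := constantsOn.structure f
  inferInstance

/-- `M ⊨ φ` for an `L_val(α)`-sentence. -/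
def RealizeVal (M : Type*) [CommRing M] (O : Set M) {α : Type*} (f : α → M)
    (φ : (Lval[[α]]).Sentence) : Prop :=
  @Sentence.Realize _ M (valConStructure O f) φ



abbrev Zm0 : Type := WithZero (Multiplicative ℤ)

variable {K : Type*} [Field K] {Γ : Type*} [LinearOrderedCommGroupWithZero Γ]

/-- `π` is a uniformizer of `(K, v)`: `v π` is minimal positive
(multiplicatively: `0 < v π < 1` and `v π` is the largest value `< 1`). -/
def IsUniformizer (v : Valuation K Γ) (π : K) : Prop :=
  0 < v π ∧ v π < 1 ∧ ∀ x : K, v x < 1 → v x ≤ v π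

/-- The valuation ring of `v`, as a set. -/
def Oset (v : Valuation K Γ) : Set K := {x | v x ≤ 1}

/-- The residue field `Kv` of the valued field `(K, v)`. -/
abbrev ResF (v : Valuation K Γ) : Type _ :=
  IsLocalRing.ResidueField v.valuationSubring

/-- The residue map `O_v → Kv`. -/
abbrev resMap (v : Valuation K Γ) : v.valuationSubring →+* ResF v :=
  IsLocalRing.residue _

/-- `(K, v)` is a henselian valued field. -/
abbrev IsHenselian (v : Valuation K Γ) : Prop :=
  HenselianLocalRing v.valuationSubring

/-- compatibility of a ring homomorphism between residue fields with the residue maps,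
for an extension `(K, v)` of `(C, u)`. -/
def ResCompat {C : Type*} [Field C] {Γ₀ : Type*} [LinearOrderedCommGroupWithZero Γ₀]
    (u : Valuation C Γ₀) [Algebra C K] (v : Valuation K Γ)
    (g : ResF u →+* ResF v) : Prop :=
  ∀ (x : u.valuationSubring) (hx : algebraMap C K ↑x ∈ v.valuationSubring),
    g (resMap u x) = resMap v ⟨algebraMap C K ↑x, hx⟩

/-- `(K, v)` is complete (with respect to the valuation uniformity). -/
def IsCompleteValued (v : Valuation K Γ) : Prop :=
  letI : Valued K Γ := Valued.mk' v
  CompleteSpace K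



/-- `E/F` admits a separating transcendence basis. -/
def HasSepTransBasis (F E : Type*) [Field F] [Field E] [Algebra F E] : Prop :=
  ∃ s : Set E, AlgebraicIndependent F ((↑) : s → E) ∧
    Algebra.IsSeparable (IntermediateField.adjoin F s) E

/-- The field extension `E/F` is separable: every finitely generated subextension
admits a separating transcendence basis. -/
def IsSepExt (F E : Type*) [Field F] [Field E] [Algebra F E] : Prop :=
  ∀ s : Finset E, HasSepTransBasis F (IntermediateField.adjoin F (s : Set E))

/-- The extension given by a ring homomorphism `f : F →+* E` of fields is separable. -/
def IsSepExtHom {F E : Type*} [Field F] [Field E] (f : F →+* E) : Prop :=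
  letI := f.toAlgebra
  IsSepExt F E

/-- `trdeg(E/F) ≤ d`: there is a finite transcendence basis with at most `d` elements. -/
def TrdegLE (F E : Type*) [CommRing F] [CommRing E] [Algebra F E] (d : ℕ) : Prop :=
  ∃ s : Finset E, s.card ≤ d ∧ IsTranscendenceBasis F (Subtype.val : ((s : Set E)) → E)

/-- `F` is a large field: `F` is existentially closed in `F((t))`. -/
def LargeField (F : Type u) [Field F] : Prop :=
  ∀ φ : (Language.ring[[F]]).Sentence, IsExists φ →
    RealizeRing (LaurentSeries F) (algebraMap F (LaurentSeries F)) φ →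
    RealizeRing F (id : F → F) φ

/-- `(R4_n)`: whenever a valuation `w` on a field `E` is trivial on a large subfield `F` of `E`
with residue field `Eu = F` (via the residue map), every `∃_n`-`L_ring(F)`-sentence true in `E`
is true in `F`. -/
def R4N (n : ℕ) : Prop :=
  ∀ (E : Type u) [Field E] (Γ : Type u) [LinearOrderedCommGroupWithZero Γ]
    (w : Valuation E Γ) (F : Subfield E),
    LargeField.{u} F →
    (∀ y : F, (y : E) ≠ 0 → w y = 1) →
    (∀ y : E, w y ≤ 1 → ∃ x : F, w (y - x) < 1) →
    ∀ φ : (Language.ring[[F]]).Sentence, IsExistsN n φ →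
      RealizeRing E ((↑) : F → E) φ → RealizeRing F (id : F → F) φ

/-- Excellence of the valuation ring of an (equicharacteristic, `ℤ`-valued) valued field
`(C, u)`, via the characterization: the fraction field of the completion (i.e. the completion
of `C`) is a separable extension of `C`. -/
def ExcellentCompletion (C : Type u) [Field C] (u : Valuation C Zm0) : Prop :=
  letI : Valued C Zm0 := Valued.mk' u
  letI : Field (UniformSpace.Completion C) := UniformSpace.Completion.instField
  IsSepExtHom (UniformSpace.Completion.coeRingHom : C →+* UniformSpace.Completion C)


/-- `Th_P(K, fK) ⊆ Th_P(L, fL)`: every positive boolean combination of `L_ring(α)`-sentences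
of the fragment `P` that is true in `K` is true in `L`. -/
def ThRingSub {α : Type*} (P : ∀ {k : ℕ}, (Language.ring[[α]]).BoundedFormula Empty k → Prop)
    (K : Type*) [CommRing K] (fK : α → K) (L : Type*) [CommRing L] (fL : α → L) : Prop :=
  ∀ φ : (Language.ring[[α]]).Sentence, IsPosBC P φ →
    RealizeRing K fK φ → RealizeRing L fL φ

/-- `Th_P(K, OK, fK) ⊆ Th_P(L, OL, fL)` for `L_val(α)`-sentences. -/
def ThValSub {α : Type*} (P : ∀ {k : ℕ}, (Lval[[α]]).BoundedFormula Empty k → Prop)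
    (K : Type*) [CommRing K] (OK : Set K) (fK : α → K)
    (L : Type*) [CommRing L] (OL : Set L) (fL : α → L) : Prop :=
  ∀ φ : (Lval[[α]]).Sentence, IsPosBC P φ →
    RealizeVal K OK fK φ → RealizeVal L OL fL φ

end Paper

namespace Paper
open Polynomial IsLocalRing

/-! ### Hensel's lemma for not necessarily monic polynomials -/

theorem exists_root_mem_maximalIdeal {R : Type*} [CommRing R] [HenselianLocalRing R]
    (g : R[X]) (h0 : g.coeff 0 ∈ maximalIdeal R) (h1 : g.coeff 1 = 1) :
    ∃ y ∈ maximalIdeal R, g.eval y = 0 := by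
  obtain ⟨k, hk⟩ : ∃ k, g.natDegree = k + 1 := by
    refine ⟨g.natDegree - 1, ?_⟩
    have : 1 ≤ g.natDegree := by
      apply Polynomial.le_natDegree_of_ne_zero
      rw [h1]; exact one_ne_zero
    omega
  set c := g.coeff 0 with hc
  set q : R[X] := ∑ i ∈ Finset.range (k + 1), C (g.coeff (i + 1) * c ^ i) * X ^ (k - i) with hq
  have hdeg : q.degree < ((k + 1 : ℕ) : WithBot ℕ) := by
    rw [Nat.cast_withBot]
    refine lt_of_le_of_lt (Polynomial.degree_sum_le _ _) ?_
    rw [Finset.sup_lt_iff (WithBot.bot_lt_coe _)]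
    intro i hi
    refine lt_of_le_of_lt (Polynomial.degree_C_mul_X_pow_le _ _) ?_
    exact WithBot.coe_lt_coe.2 (by omega : k - i < k + 1)
  have hmon : (X ^ (k + 1) + q).Monic := Polynomial.monic_X_pow_add hdeg
  have hres : ∀ x ∈ maximalIdeal R, residue R x = 0 := fun x hx => (residue_eq_zero_iff x).2 hx
  have hc0 : residue R c = 0 := hres c h0
  have hqmap : q.map (residue R) = X ^ k := by
    rw [hq, Polynomial.map_sum, Finset.sum_eq_single 0]
    · simp [h1]
    · intro i _ hi
      simp [hc0, hi]
    · simp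
  obtain ⟨V, hV, hV'⟩ := HenselianLocalRing.is_henselian (X ^ (k + 1) + q) hmon (-1) (by
      rw [← residue_eq_zero_iff, ← Polynomial.eval₂_at_apply, ← Polynomial.eval_map,
        Polynomial.map_add, hqmap]
      simp [pow_succ]) (by
      rw [← residue_ne_zero_iff_isUnit, Ne,
        ← Polynomial.eval₂_at_apply,
        ← Polynomial.eval_map, ← Polynomial.derivative_map, Polynomial.map_add, hqmap]
      cases k with
      | zero => simp
      | succ k =>
        have : ((-1 : ResidueField R)) ^ (k + 1) ≠ 0 := pow_ne_zero _ (by simp)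
        intro h
        apply this
        rw [← h]
        simp
        ring)
  have hVu : IsUnit V := by
    rw [← residue_ne_zero_iff_isUnit, Ne, residue_eq_zero_iff]
    intro h
    have := (maximalIdeal R).sub_mem h hV'
    simp at this
  obtain ⟨V, rfl⟩ := hVu
  refine ⟨c * ↑V⁻¹, Ideal.mul_mem_right _ _ h0, ?_⟩
  have key : (V : R) ^ (k + 1) * g.eval (c * ↑V⁻¹) = c * (X ^ (k + 1) + q).eval (V : R) := by
    rw [Polynomial.eval_eq_sum_range, hk, Finset.sum_range_succ', ← hc]
    simp only [hq, eval_add, eval_pow, eval_X, eval_finsetSum, eval_mul, eval_C, mul_add,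
      Finset.mul_sum, pow_zero, mul_one]
    rw [add_comm]
    congr 1
    · ring
    · refine Finset.sum_congr rfl fun i hi => ?_
      have hi' : i + 1 + (k - i) = k + 1 := by
        have := Finset.mem_range.1 hi
        omega
      have e : (V : R) ^ (i + 1) * (↑V⁻¹ : R) ^ (i + 1) = 1 := by
        rw [← mul_pow]; simp
      calc _ = (V : R) ^ (i + 1 + (k - i)) * (g.coeff (i + 1) * (c * ↑V⁻¹) ^ (i + 1)) := by rw [hi']
        _ = ((V : R) ^ (i + 1) * (↑V⁻¹ : R) ^ (i + 1)) *
          (c * (g.coeff (i + 1) * c ^ i * (V : R) ^ (k - i))) := by ring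
        _ = _ := by rw [e, one_mul]
  rw [hV.eq_zero, mul_zero] at key
  exact (((V ^ (k + 1)).isUnit).mul_right_eq_zero).1 (by simpa using key)

section

variable {K : Type*} [Field K] {Γ : Type*} [LinearOrderedCommGroupWithZero Γ]

/-- Hensel's lemma for a valuation, without a monicity assumption. -/
def HenselProp (v : Valuation K Γ) : Prop :=
  ∀ (f : K[X]) (a : K), (∀ i, v (f.coeff i) ≤ 1) → v a ≤ 1 → v (f.eval a) < 1 →
    v (f.derivative.eval a) = 1 → ∃ b, f.eval b = 0 ∧ v (b - a) < 1

/-- The essential form of Hensel's lemma: a small constant coefficient and linear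
coefficient `1`. -/
def HenselProp₀ (v : Valuation K Γ) : Prop :=
  ∀ f : K[X], (∀ i, v (f.coeff i) ≤ 1) → v (f.coeff 0) < 1 → f.coeff 1 = 1 →
    ∃ b, f.eval b = 0 ∧ v b < 1

theorem IsHenselian.henselProp₀ {v : Valuation K Γ} (h : IsHenselian v) : HenselProp₀ v := by
  intro f hf h0 h1
  have hl : f ∈ Polynomial.lifts (v.valuationSubring.subtype) := by
    rw [Polynomial.lifts_iff_coeff_lifts]
    intro i
    exact ⟨⟨f.coeff i, hf i⟩, rfl⟩
  obtain ⟨g, rfl⟩ := (Polynomial.mem_lifts _).1 hl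
  have hmem : ∀ x : v.valuationSubring, x ∈ maximalIdeal v.valuationSubring ↔ v (x : K) < 1 :=
    fun x => Valuation.mem_maximalIdeal_iff _ _
  obtain ⟨y, hy, hy0⟩ := exists_root_mem_maximalIdeal g
    (by rw [hmem]; simpa using h0) (by
      apply Subtype.ext
      simpa using h1)
  refine ⟨y, ?_, (hmem y).1 hy⟩
  have := congrArg v.valuationSubring.subtype hy0
  rw [Polynomial.eval_map]
  rw [← Polynomial.eval₂_hom] at this
  simpa using this

theorem valuation_eval_le {v : Valuation K Γ} (f : K[X]) {a : K} {c : Γ}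
    (h : ∀ i, v (f.coeff i) * v a ^ i ≤ c) : v (f.eval a) ≤ c := by
  rw [Polynomial.eval_eq_sum_range]
  refine Valuation.map_sum_le _ fun i _ => ?_
  rw [map_mul, map_pow]
  exact h i

theorem valuation_eval_le_one {v : Valuation K Γ} {f : K[X]} {a : K}
    (h : ∀ i, v (f.coeff i) ≤ 1) (ha : v a ≤ 1) : v (f.eval a) ≤ 1 :=
  valuation_eval_le f fun i => mul_le_one' (h i) (pow_le_one' ha i)

theorem valuation_natCast_le_one (v : Valuation K Γ) (n : ℕ) : v (n : K) ≤ 1 := by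
  induction n with
  | zero => simp
  | succ n ih =>
    push_cast
    exact Valuation.map_add_le _ ih (by simp)

theorem valuation_hasseDeriv_coeff_le_one {v : Valuation K Γ} {f : K[X]}
    (h : ∀ i, v (f.coeff i) ≤ 1) (j i : ℕ) : v ((hasseDeriv j f).coeff i) ≤ 1 := by
  rw [Polynomial.hasseDeriv_coeff, map_mul]
  exact mul_le_one' (valuation_natCast_le_one v _) (h _)

theorem valuation_taylor_coeff_le_one {v : Valuation K Γ} {f : K[X]} {a : K}
    (h : ∀ i, v (f.coeff i) ≤ 1) (ha : v a ≤ 1) (j : ℕ) : v ((taylor a f).coeff j) ≤ 1 := by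
  rw [Polynomial.taylor_coeff]
  exact valuation_eval_le_one (valuation_hasseDeriv_coeff_le_one h j) ha

/-- The Newton form of Hensel's lemma. -/
theorem HenselProp₀.newton {v : Valuation K Γ} (H : HenselProp₀ v) (f : K[X]) (a : K)
    (hf : ∀ i, v (f.coeff i) ≤ 1) (ha : v a ≤ 1)
    (hlt : v (f.eval a) < v (f.derivative.eval a) ^ 2) :
    ∃ b, f.eval b = 0 ∧ v (b - a) < v (f.derivative.eval a) := by
  set d := f.derivative.eval a with hd
  have hd0 : d ≠ 0 := by
    intro h
    rw [h] at hlt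
    simp at hlt
  have hvd : v d ≤ 1 := by
    rw [hd]
    exact valuation_eval_le_one (fun i => by
      rw [← Polynomial.hasseDeriv_one]; exact valuation_hasseDeriv_coeff_le_one hf 1 i) ha
  have hvd0 : 0 < v d := by simpa [zero_lt_iff] using hd0
  set g : K[X] := C (d ^ 2)⁻¹ * (taylor a f).comp (C d * X) with hg
  have hgc : ∀ i, g.coeff i = (d ^ 2)⁻¹ * ((taylor a f).coeff i * d ^ i) := by
    intro i
    rw [hg, Polynomial.coeff_C_mul, Polynomial.comp_C_mul_X_coeff]
  obtain ⟨b, hb, hb1⟩ := H g (by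
    intro i
    rw [hgc, map_mul, map_mul, map_inv₀, map_pow, map_pow,
      inv_mul_le_iff₀ (pow_pos hvd0 2), mul_one]
    rcases i with _ | _ | i
    · simpa using hlt.le
    · rw [Polynomial.taylor_coeff_one, ← hd, zero_add, pow_one, sq]
    · calc _ ≤ 1 * v d ^ (i + 1 + 1) :=
            mul_le_mul_left (valuation_taylor_coeff_le_one hf ha _) _
        _ = v d ^ 2 * v d ^ i := by rw [one_mul, ← pow_add]; congr 1; ring
        _ ≤ v d ^ 2 * 1 := mul_le_mul_right (pow_le_one' hvd i) _
        _ = _ := mul_one _) (by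
    rw [hgc, map_mul, map_inv₀, map_pow, inv_mul_lt_iff₀ (pow_pos hvd0 2), mul_one]
    simpa using hlt) (by
    rw [hgc, Polynomial.taylor_coeff_one, ← hd]
    field_simp)
  refine ⟨a + d * b, ?_, ?_⟩
  · have : g.eval b = (d ^ 2)⁻¹ * f.eval (a + d * b) := by
      simp [hg, Polynomial.taylor_apply, Polynomial.eval_comp, add_comm]
    rw [this] at hb
    simpa [hd0] using hb
  · rw [add_sub_cancel_left, map_mul]
    calc v d * v b < v d * 1 := mul_lt_mul_of_pos_left hb1 hvd0
      _ = _ := mul_one _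

theorem HenselProp₀.henselProp {v : Valuation K Γ} (H : HenselProp₀ v) : HenselProp v := by
  intro f a hf ha h0 h1
  have := H.newton f a hf ha (by rw [h1]; simpa using h0)
  rwa [h1] at this

end

end Paper

namespace Paper
open Polynomial

/-! ### Graphs of partial specialisations -/

section PartialSpec

variable {F K M : Type*} [Field F] [Field K] [Field M] [Algebra F K] [Algebra F M]

/-- A subalgebra of `K × M` which is the graph of a homomorphism from a subalgebra of `K`
to `M`. -/
def IsGraph (G : Subalgebra F (K × M)) : Prop := ∀ x ∈ G, x.1 = 0 → x.2 = 0

theorem IsGraph.eq {G : Subalgebra F (K × M)} (hG : IsGraph G) {x y : K × M} (hx : x ∈ G)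
    (hy : y ∈ G) (h : x.1 = y.1) : x.2 = y.2 := by
  have := hG _ (G.sub_mem hx hy) (by simp [h])
  simpa [sub_eq_zero] using this

/-- The first projection of a graph. -/
def gFst (G : Subalgebra F (K × M)) : G →ₐ[F] K := (AlgHom.fst F K M).comp G.val

/-- The second projection of a graph. -/
def gSnd (G : Subalgebra F (K × M)) : G →ₐ[F] M := (AlgHom.snd F K M).comp G.val

theorem IsGraph.injective {G : Subalgebra F (K × M)} (hG : IsGraph G) :
    Function.Injective (gFst G) := by
  intro x y h
  exact Subtype.ext (Prod.ext h (hG.eq x.2 y.2 h))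

theorem IsGraph.exists_localization {G : Subalgebra F (K × M)} (hG : IsGraph G) :
    ∃ G' : Subalgebra F (K × M), G ≤ G' ∧ IsGraph G' ∧
      (∀ x ∈ G', x.2 ≠ 0 → x⁻¹ ∈ G') ∧
      ∀ x ∈ G', ∃ a ∈ G, ∃ b ∈ G, b.1 ≠ 0 ∧ x.1 = a.1 / b.1 := by
  have hne : ∀ b ∈ G, b.2 ≠ 0 → b.1 ≠ 0 := fun b hb h h' => h (hG b hb h')
  refine ⟨{ carrier := {x | ∃ a ∈ G, ∃ b ∈ G, b.2 ≠ 0 ∧ x = (a.1 / b.1, a.2 / b.2)}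
            mul_mem' := ?_, add_mem' := ?_, algebraMap_mem' := ?_ }, ?_, ?_, ?_, ?_⟩
  · rintro _ _ ⟨a, ha, b, hb, h, rfl⟩ ⟨c, hc, d, hd, h', rfl⟩
    refine ⟨a * c, G.mul_mem ha hc, b * d, G.mul_mem hb hd, mul_ne_zero h h', ?_⟩
    simp [div_mul_div_comm]
  · rintro _ _ ⟨a, ha, b, hb, h, rfl⟩ ⟨c, hc, d, hd, h', rfl⟩
    refine ⟨a * d + b * c, G.add_mem (G.mul_mem ha hd) (G.mul_mem hb hc), b * d,
      G.mul_mem hb hd, mul_ne_zero h h', ?_⟩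
    simp [div_add_div _ _ h h', div_add_div _ _ (hne b hb h) (hne d hd h')]
  · intro r
    exact ⟨_, G.algebraMap_mem r, 1, G.one_mem, one_ne_zero, by ext <;> simp⟩
  · intro x hx
    exact ⟨x, hx, 1, G.one_mem, one_ne_zero, by ext <;> simp⟩
  · rintro _ ⟨a, ha, b, hb, h, rfl⟩ h0
    have : a.1 = 0 := by simpa [hne b hb h] using h0
    simp [hG a ha this]
  · rintro _ ⟨a, ha, b, hb, h, rfl⟩ h0
    refine ⟨b, hb, a, ha, ?_, ?_⟩
    · rintro h'
      simp [h'] at h0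
    · ext <;> simp
  · rintro _ ⟨a, ha, b, hb, h, rfl⟩
    exact ⟨a, ha, b, hb, hne b hb h, rfl⟩

theorem IsGraph.exists_adjoin {G : Subalgebra F (K × M)} (hG : IsGraph G) (z : K) (z' : M)
    (h : ∀ q : G[X], (q.map (gFst G : G →+* K)).eval z = 0 →
      (q.map (gSnd G : G →+* M)).eval z' = 0) :
    ∃ G' : Subalgebra F (K × M), IsGraph G' ∧
      (∀ q : G[X], ((q.map (gFst G : G →+* K)).eval z,
        (q.map (gSnd G : G →+* M)).eval z') ∈ G') ∧
      ∀ x ∈ G', ∃ q : G[X], x.1 = (q.map (gFst G : G →+* K)).eval z := by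
  let ev : G[X] →+* K × M := RingHom.prod
    ((Polynomial.evalRingHom z).comp (Polynomial.mapRingHom (gFst G : G →+* K)))
    ((Polynomial.evalRingHom z').comp (Polynomial.mapRingHom (gSnd G : G →+* M)))
  have hev : ∀ q, ev q = ((q.map (gFst G : G →+* K)).eval z,
      (q.map (gSnd G : G →+* M)).eval z') := fun q => rfl
  refine ⟨{ ev.rangeS with algebraMap_mem' := ?_ }, ?_, ?_, ?_⟩
  · intro r
    refine ⟨C (algebraMap F G r), ?_⟩
    rw [hev]
    simp [Prod.ext_iff]
  · rintro _ ⟨q, rfl⟩ h0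
    exact h q h0
  · intro q
    exact ⟨q, rfl⟩
  · rintro _ ⟨q, rfl⟩
    exact ⟨q, rfl⟩

end PartialSpec

section Stable

variable {K : Type*} [Field K] {Γ : Type*} [LinearOrderedCommGroupWithZero Γ]

/-- On the ball of radius `γ` around `z` the constant Taylor coefficient of `q` dominates. -/
def Stab (W : Valuation K Γ) (q : K[X]) (z : K) (γ : Γ) : Prop :=
  ∀ i, W ((taylor z q).coeff (i + 1)) * γ ^ (i + 1) < W (q.eval z)

theorem valuation_taylor_coeff_lt {W : Valuation K Γ} (Q : K[X]) {δ : K} {γ c : Γ} (i : ℕ)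
    (hγ : γ ≠ 0) (hδ : W δ ≤ γ) (hc : c ≠ 0) (h : ∀ j, i ≤ j → W (Q.coeff j) * γ ^ j < c) :
    W ((taylor δ Q).coeff i) * γ ^ i < c := by
  have hγ' : 0 < γ ^ i := pow_pos (zero_lt_iff.2 hγ) i
  rw [← lt_div_iff₀ hγ', taylor_coeff, Polynomial.eval_eq_sum_range]
  refine Valuation.map_sum_lt _ (div_ne_zero hc hγ'.ne') fun j _ => ?_
  rw [lt_div_iff₀ hγ', Polynomial.hasseDeriv_coeff, map_mul, map_mul, map_pow]
  refine lt_of_le_of_lt ?_ (h (j + i) (by omega))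
  rw [pow_add, ← mul_assoc]
  gcongr
  calc _ ≤ 1 * W (Q.coeff (j + i)) := by
        gcongr
        exact valuation_natCast_le_one W _
    _ = _ := one_mul _

theorem Stab.ne_zero {W : Valuation K Γ} {q : K[X]} {z : K} {γ : Γ} (h : Stab W q z γ) :
    W (q.eval z) ≠ 0 := (lt_of_le_of_lt zero_le (h 0)).ne'

theorem Stab.mono {W : Valuation K Γ} {q : K[X]} {z : K} {γ γ' : Γ} (h : Stab W q z γ)
    (h' : γ' ≤ γ) : Stab W q z γ' := fun i =>
  lt_of_le_of_lt (by gcongr) (h i)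

theorem Stab.sub_lt {W : Valuation K Γ} {q : K[X]} {z b : K} {γ : Γ} (h : Stab W q z γ)
    (hγ : γ ≠ 0) (hb : W (b - z) ≤ γ) : W (q.eval b - q.eval z) < W (q.eval z) := by
  have := valuation_taylor_coeff_lt (W := W) (taylor z q - C (q.eval z)) 0 hγ hb h.ne_zero (by
    rintro (_ | j) _
    · simpa [zero_lt_iff] using h.ne_zero
    · simpa [Polynomial.coeff_C] using h j)
  simpa [Polynomial.taylor_coeff_zero, Polynomial.taylor_eval] using this

theorem Stab.eval_eq {W : Valuation K Γ} {q : K[X]} {z b : K} {γ : Γ} (h : Stab W q z γ)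
    (hγ : γ ≠ 0) (hb : W (b - z) ≤ γ) : W (q.eval b) = W (q.eval z) :=
  Valuation.map_eq_of_sub_lt W (h.sub_lt hγ hb)

theorem Stab.move {W : Valuation K Γ} {q : K[X]} {z b : K} {γ : Γ} (h : Stab W q z γ)
    (hγ : γ ≠ 0) (hb : W (b - z) ≤ γ) : Stab W q b γ := by
  intro i
  rw [h.eval_eq hγ hb]
  have := valuation_taylor_coeff_lt (W := W) (taylor z q) (i + 1) hγ hb h.ne_zero (by
    rintro (_ | j) hj
    · omega
    · exact h j)
  rwa [Polynomial.taylor_taylor, sub_add_cancel] at this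

end Stable

section Specializes

variable {F K : Type*} [Field F] [Field K] [Algebra F K]
  {Γ : Type*} [LinearOrderedCommGroupWithZero Γ] {Γ₀ : Type*} [LinearOrderedCommGroupWithZero Γ₀]

/-- Every finite subset of `E` can be specialised to `F` over `F` in such a way that
`W`-infinitesimal elements become `v`-infinitesimal. -/
def Specializes (W : Valuation K Γ) (v : Valuation F Γ₀) (E : IntermediateField F K) : Prop :=
  ∀ S : Set K, S.Finite → S ⊆ E → ∃ G : Subalgebra F (K × F), IsGraph G ∧
    (∀ g : G, gFst G g ∈ E) ∧ (∀ s ∈ S, ∃ g : G, gFst G g = s) ∧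
    ∀ g : G, gFst G g ∈ S → W (gFst G g) < 1 → v (gSnd G g) < 1

theorem exists_common_stab {W : Valuation K Γ} {E : IntermediateField F K} {z : K}
    (T : Set K[X]) (hT : T.Finite) (h : ∀ q ∈ T, ∃ a ∈ E, Stab W q z (W (a - z))) :
    ∃ a ∈ E, ∀ q ∈ T, Stab W q z (W (a - z)) := by
  induction T, hT using Set.Finite.induction_on with
  | empty => exact ⟨0, E.zero_mem, by simp⟩
  | @insert q T _ _ ih =>
    obtain ⟨a, ha, h1⟩ := ih fun q hq => h q (Set.mem_insert_of_mem _ hq)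
    obtain ⟨b, hb, h2⟩ := h q (Set.mem_insert _ _)
    rcases le_total (W (a - z)) (W (b - z)) with hab | hab
    · refine ⟨a, ha, ?_⟩
      rintro q' (rfl | hq')
      · exact h2.mono hab
      · exact h1 q' hq'
    · refine ⟨b, hb, ?_⟩
      rintro q' (rfl | hq')
      · exact h2
      · exact (h1 q' hq').mono hab

theorem exists_map_eq {R A : Type*} [CommRing R] [CommRing A] (i : R →+* A) (q : A[X])
    (h : ∀ n, ∃ r, i r = q.coeff n) : ∃ r : R[X], r.map i = q := by
  have : q ∈ lifts i := by
    rw [lifts_iff_coeff_lifts]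
    exact h
  exact (mem_lifts _).1 this

theorem finite_coeffs (q : K[X]) : (Set.range q.coeff).Finite := by
  refine ((Set.finite_singleton (0 : K)).union ((q.support : Set ℕ).toFinite.image q.coeff)).subset ?_
  rintro _ ⟨n, rfl⟩
  by_cases h : q.coeff n = 0
  · exact Or.inl h
  · exact Or.inr ⟨n, mem_support_iff.2 h, rfl⟩

theorem eval_mem {E : IntermediateField F K} {q : K[X]} (hq : ∀ n, q.coeff n ∈ E) {a : K}
    (ha : a ∈ E) : q.eval a ∈ E := by
  rw [Polynomial.eval_eq_sum_range]
  exact E.sum_mem fun i _ => E.mul_mem (hq i) (pow_mem ha i)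

theorem gFst_eval {G : Subalgebra F (K × F)} (Q : G[X]) (A : G) :
    gFst G (Q.eval A) = (Q.map (gFst G : G →+* K)).eval (gFst G A) := by
  rw [Polynomial.eval_map]
  exact (Polynomial.eval₂_at_apply (gFst G : G →+* K) A).symm

theorem gSnd_eval {G : Subalgebra F (K × F)} (Q : G[X]) (A : G) :
    gSnd G (Q.eval A) = (Q.map (gSnd G : G →+* F)).eval (gSnd G A) := by
  rw [Polynomial.eval_map]
  exact (Polynomial.eval₂_at_apply (gSnd G : G →+* F) A).symm

theorem exists_graph_of_forall {W : Valuation K Γ} {v : Valuation F Γ₀}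
    {E : IntermediateField F K} {S : Set K} {G : Subalgebra F (K × F)} (hG : IsGraph G)
    (hE : ∀ x ∈ G, x.1 ∈ E) (key : ∀ s ∈ S, ∃ s', (s, s') ∈ G ∧ (W s < 1 → v s' < 1)) :
    ∃ G : Subalgebra F (K × F), IsGraph G ∧
      (∀ g : G, gFst G g ∈ E) ∧ (∀ s ∈ S, ∃ g : G, gFst G g = s) ∧
      ∀ g : G, gFst G g ∈ S → W (gFst G g) < 1 → v (gSnd G g) < 1 := by
  refine ⟨G, hG, fun g => hE g g.2, ?_, ?_⟩
  · intro s hs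
    obtain ⟨s', hs', _⟩ := key s hs
    exact ⟨⟨_, hs'⟩, rfl⟩
  · rintro ⟨g, hg⟩ hgS hg1
    obtain ⟨s', hs', h⟩ := key _ hgS
    have : g.2 = s' := hG.eq hg hs' rfl
    change v g.2 < 1
    rw [this]
    exact h hg1

theorem specializes_of_transcendental {W : Valuation K Γ} {v : Valuation F Γ₀}
    {E E' : IntermediateField F K} (hE : Specializes W v E) {z : K} (hzE : z ∉ E)
    (hle : E ≤ E') (hzE' : z ∈ E')
    (hmem : ∀ x ∈ E', ∃ r h : K[X], (∀ n, r.coeff n ∈ E) ∧ (∀ n, h.coeff n ∈ E) ∧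
      h.eval z ≠ 0 ∧ x = r.eval z / h.eval z)
    (hz : ∀ q : K[X], (∀ n, q.coeff n ∈ E) → q ≠ 0 → ∃ a ∈ E, Stab W q z (W (a - z))) :
    Specializes W v E' := by
  intro S hS hSE
  choose! r h hr hh hh0 hx using hmem
  obtain ⟨a, haE, ha⟩ := exists_common_stab (W := W) (E := E) (z := z)
    ((r '' S ∪ h '' S) \ {0}) ((hS.image r).union (hS.image h)).sdiff (by
      rintro q ⟨⟨s, hs, rfl⟩ | ⟨s, hs, rfl⟩, hq⟩
      · exact hz _ (hr s (hSE hs)) hq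
      · exact hz _ (hh s (hSE hs)) hq)
  have haz : W (a - z) ≠ 0 := by
    rw [Valuation.ne_zero_iff, sub_ne_zero]
    rintro rfl
    exact hzE haE
  have hhne : ∀ s ∈ S, h s ≠ 0 := by
    intro s hs h0
    exact hh0 s (hSE hs) (by simp [h0])
  have hWh : ∀ s ∈ S, W ((h s).eval a) = W ((h s).eval z) := fun s hs =>
    (ha _ ⟨Or.inr ⟨s, hs, rfl⟩, hhne s hs⟩).eval_eq haz le_rfl
  have hWr : ∀ s ∈ S, W ((r s).eval a) = W ((r s).eval z) := by
    intro s hs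
    by_cases h0 : r s = 0
    · simp [h0]
    · exact (ha _ ⟨Or.inl ⟨s, hs, rfl⟩, h0⟩).eval_eq haz le_rfl
  have hha : ∀ s ∈ S, (h s).eval a ≠ 0 := by
    intro s hs
    rw [← Valuation.ne_zero_iff W, hWh s hs, Valuation.ne_zero_iff]
    exact hh0 s (hSE hs)
  obtain ⟨G, hG, hGE, hGS, hGv⟩ := hE
    ((⋃ s ∈ S, Set.range (r s).coeff) ∪ (⋃ s ∈ S, Set.range (h s).coeff) ∪ {a} ∪
      ((fun s => (r s).eval a / (h s).eval a) '' S) ∪ ((fun s => ((h s).eval a)⁻¹) '' S))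
    ((((((hS.biUnion fun s _ => finite_coeffs _)).union (hS.biUnion fun s _ => finite_coeffs _)).union
      (Set.finite_singleton a)).union (hS.image _)).union (hS.image _)) (by
        rintro x ((((hx | hx) | rfl) | ⟨s, hs, rfl⟩) | ⟨s, hs, rfl⟩)
        · obtain ⟨s, hs, n, rfl⟩ := Set.mem_iUnion₂.1 hx
          exact hr s (hSE hs) n
        · obtain ⟨s, hs, n, rfl⟩ := Set.mem_iUnion₂.1 hx
          exact hh s (hSE hs) n
        · exact haE
        · exact E.div_mem (eval_mem (hr s (hSE hs)) haE) (eval_mem (hh s (hSE hs)) haE)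
        · exact E.inv_mem (eval_mem (hh s (hSE hs)) haE))
  obtain ⟨A, hA⟩ := hGS a (by simp)
  obtain ⟨G₁, hG₁, hG₁mem, hG₁E⟩ := hG.exists_adjoin z (gSnd G A) (by
    intro q hq
    have hq0 : q.map (gFst G : G →+* K) = 0 := by
      by_contra hne
      obtain ⟨a, ha, hs⟩ := hz _ (by intro n; rw [coeff_map]; exact hGE _) hne
      apply hs.ne_zero
      rw [hq, map_zero]
    rw [(Polynomial.map_eq_zero_iff hG.injective).1 hq0]
    simp)
  obtain ⟨G₂, hG₁₂, hG₂, hG₂inv, hG₂E⟩ := hG₁.exists_localization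
  have hG₁E' : ∀ x ∈ G₁, x.1 ∈ E' := by
    intro x hx
    obtain ⟨q, hq⟩ := hG₁E x hx
    rw [hq]
    exact eval_mem (fun n => hle (by rw [coeff_map]; exact hGE _)) hzE'
  have key : ∀ s ∈ S, ∃ s', (s, s') ∈ G₂ ∧ (W s < 1 → v s' < 1) := by
    intro s hs
    obtain ⟨R, hR⟩ := exists_map_eq (gFst G : G →+* K) (r s) fun n => hGS _ (by
      refine Or.inl (Or.inl (Or.inl (Or.inl (Set.mem_iUnion₂.2 ⟨s, hs, n, rfl⟩)))))
    obtain ⟨H, hH⟩ := exists_map_eq (gFst G : G →+* K) (h s) fun n => hGS _ (by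
      refine Or.inl (Or.inl (Or.inl (Or.inr (Set.mem_iUnion₂.2 ⟨s, hs, n, rfl⟩)))))
    obtain ⟨I, hI⟩ := hGS ((h s).eval a)⁻¹ (Or.inr ⟨s, hs, rfl⟩)
    obtain ⟨e, he⟩ := hGS ((r s).eval a / (h s).eval a) (Or.inl (Or.inr ⟨s, hs, rfl⟩))
    have hHI : H.eval A * I = 1 := by
      apply hG.injective
      rw [map_mul, gFst_eval, hA, hH, hI, map_one, mul_inv_cancel₀ (hha s hs)]
    have hHe : e * H.eval A = R.eval A := by
      apply hG.injective
      rw [map_mul, gFst_eval, gFst_eval, hA, hH, hR, he, div_mul_cancel₀ _ (hha s hs)]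
    have hH0 : (H.map (gSnd G : G →+* F)).eval (gSnd G A) ≠ 0 := by
      intro h0
      have := congrArg (gSnd G) hHI
      rw [map_mul, gSnd_eval, h0, zero_mul, map_one] at this
      exact zero_ne_one this
    have m1 := hG₁₂ (hG₁mem R)
    have m2 := hG₂inv _ (hG₁₂ (hG₁mem H)) hH0
    have m3 := G₂.mul_mem m1 m2
    rw [hR, hH] at m3
    refine ⟨(R.map (gSnd G : G →+* F)).eval (gSnd G A) *
      ((H.map (gSnd G : G →+* F)).eval (gSnd G A))⁻¹, ?_, ?_⟩
    · convert m3 using 1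
      ext
      · simp only [Prod.mk_mul_mk, Prod.inv_mk]
        rw [← div_eq_mul_inv]
        exact hx s (hSE hs)
      · rfl
    · intro hs1
      have : gSnd G e = (R.map (gSnd G : G →+* F)).eval (gSnd G A) *
          ((H.map (gSnd G : G →+* F)).eval (gSnd G A))⁻¹ := by
        rw [eq_mul_inv_iff_mul_eq₀ hH0, ← gSnd_eval, ← gSnd_eval, ← map_mul, hHe]
      rw [← this]
      apply hGv
      · rw [he]
        exact Or.inl (Or.inr ⟨s, hs, rfl⟩)
      · rw [he, map_div₀, hWr s hs, hWh s hs, ← map_div₀, ← hx s (hSE hs)]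
        exact hs1
  refine exists_graph_of_forall hG₂ (fun x hx => ?_) key
  obtain ⟨a, ha, b, hb, _, h⟩ := hG₂E x hx
  rw [h]
  exact E'.div_mem (hG₁E' a ha) (hG₁E' b hb)

end Specializes

section Specializes

variable {F K : Type*} [Field F] [Field K] [Algebra F K]
  {Γ : Type*} [LinearOrderedCommGroupWithZero Γ] {Γ₀ : Type*} [LinearOrderedCommGroupWithZero Γ₀]

theorem valuation_eval_lt_one {W : Valuation K Γ} {f : K[X]} {a : K}
    (h : ∀ i, W (f.coeff i) < 1) (ha : W a ≤ 1) : W (f.eval a) < 1 := by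
  rw [Polynomial.eval_eq_sum_range]
  refine Valuation.map_sum_lt W one_ne_zero fun i _ => ?_
  rw [map_mul, map_pow]
  exact mul_lt_one_of_lt_of_le (h i) (pow_le_one' ha i)

theorem IsGraph.snd_eval_affine {G : Subalgebra F (K × F)} (hG : IsGraph G) (q r : G[X])
    (A B U : G) (h : C (gFst G U) * r.map (gFst G : G →+* K) =
      (taylor (gFst G A) (q.map (gFst G : G →+* K))).comp (C (gFst G B) * X)) (x : F) :
    (q.map (gSnd G : G →+* F)).eval (gSnd G A + gSnd G B * x) =
      gSnd G U * (r.map (gSnd G : G →+* F)).eval x := by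
  have key : C U * r = (taylor A q).comp (C B * X) := by
    apply Polynomial.map_injective (gFst G : G →+* K) hG.injective
    rw [Polynomial.taylor_apply] at h ⊢
    simpa [Polynomial.map_comp] using h
  have := congrArg (fun p => (p.map (gSnd G : G →+* F)).eval x) key
  rw [Polynomial.taylor_apply] at this
  simp [Polynomial.map_comp] at this
  rw [this, add_comm]

theorem specializes_of_algebraic {W : Valuation K Γ} {v : Valuation F Γ₀} (hv : HenselProp v)
    (hW : ∀ n : ℕ, W ((n + 1 : ℕ) : K) = 1)
    {E E' : IntermediateField F K} (hE : Specializes W v E) {b : K} (hbE : b ∉ E)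
    (hle : E ≤ E') (hbE' : b ∈ E') {f : K[X]} (hfE : ∀ n, f.coeff n ∈ E) (hf : f.Monic)
    (hfb : f.eval b = 0)
    (hf' : f.derivative ≠ 0) (hf'' : f.derivative.natDegree < f.natDegree)
    (hmem : ∀ x ∈ E', ∃ q : K[X], (∀ n, q.coeff n ∈ E) ∧ q.natDegree < f.natDegree ∧
      x = q.eval b)
    (hnomin : ∀ a ∈ E, ∃ a₂ ∈ E, W (a₂ - b) < W (a - b))
    (hz : ∀ q : K[X], (∀ n, q.coeff n ∈ E) → q ≠ 0 → q.natDegree < f.natDegree →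
      ∃ a ∈ E, Stab W q b (W (a - b))) :
    Specializes W v E' := by
  intro S hS hSE
  choose! q hqE hqdeg hx using hmem
  have hf'E : ∀ n, f.derivative.coeff n ∈ E := by
    intro n
    rw [coeff_derivative]
    refine E.mul_mem (hfE _) ?_
    exact_mod_cast natCast_mem E (n + 1)
  obtain ⟨a, haE, ha⟩ := exists_common_stab (W := W) (E := E) (z := b)
    ({f.derivative} ∪ (q '' S) \ {0}) ((Set.finite_singleton _).union (hS.image q).sdiff) (by
      rintro q' (rfl | ⟨⟨s, hs, rfl⟩, hq⟩)
      · exact hz _ hf'E hf' hf''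
      · exact hz _ (hqE s (hSE hs)) hq (hqdeg s (hSE hs)))
  obtain ⟨a₂, ha₂E, ha₂⟩ := hnomin a haE
  set c := a₂ - a with hc
  have hcE : c ∈ E := E.sub_mem ha₂E haE
  have hab : W (a - b) ≠ 0 := by
    rw [Valuation.ne_zero_iff, sub_ne_zero]
    rintro rfl
    exact hbE haE
  have hWc : W c = W (a - b) := by
    have : c = (a₂ - b) - (a - b) := by rw [hc]; ring
    rw [this]
    exact Valuation.map_sub_eq_of_lt_right W ha₂
  have hc0 : c ≠ 0 := by
    rw [← Valuation.ne_zero_iff W, hWc]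
    exact hab
  -- a polynomial in the coordinate `(· - a) / c`
  have key : ∀ q' : K[X], ∀ u : K, u ≠ 0 → ∃ r : K[X],
      C u * r = (taylor a q').comp (C c * X) ∧
      ∀ i, r.coeff i = u⁻¹ * ((taylor a q').coeff i * c ^ i) := by
    intro q' u hu
    refine ⟨C u⁻¹ * (taylor a q').comp (C c * X), ?_, ?_⟩
    · rw [← mul_assoc, ← C_mul, mul_inv_cancel₀ hu, C_1, one_mul]
    · intro i
      rw [Polynomial.coeff_C_mul, Polynomial.comp_C_mul_X_coeff]
  have htE : ∀ q' : K[X], (∀ n, q'.coeff n ∈ E) → ∀ i, (taylor a q').coeff i ∈ E := by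
    intro q' hq' i
    rw [taylor_coeff]
    refine eval_mem (fun n => ?_) haE
    rw [hasseDeriv_coeff]
    exact E.mul_mem (natCast_mem E _) (hq' _)
  have hSf := (ha _ (Or.inl rfl)).move hab le_rfl
  have hfa : f.derivative.eval a ≠ 0 := (Valuation.ne_zero_iff W).1 hSf.ne_zero
  obtain ⟨g, hg, hgc⟩ := key f (f.derivative.eval a * c) (mul_ne_zero hfa hc0)
  have hg1 : g.coeff 1 = 1 := by
    rw [hgc, taylor_coeff_one, pow_one, inv_mul_cancel₀ (mul_ne_zero hfa hc0)]
  have hg2 : ∀ i, W (g.coeff (i + 2)) < 1 := by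
    intro i
    have h1 := hSf i
    have h2 : (taylor a f.derivative).coeff (i + 1) =
        (taylor a f).coeff (i + 2) * ((i + 1 + 1 : ℕ) : K) := by
      have : taylor a f.derivative = derivative (taylor a f) := by
        rw [taylor_apply, taylor_apply, derivative_comp]
        simp
      rw [this, coeff_derivative]
      push_cast
      ring
    rw [h2, map_mul, hW (i + 1), mul_one, ← hWc] at h1
    rw [hgc, map_mul, map_inv₀, map_mul, map_mul, map_pow, inv_mul_lt_iff₀, mul_one, pow_succ,
      ← mul_assoc]
    · gcongr
      rw [zero_lt_iff, Valuation.ne_zero_iff]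
      exact hc0
    · rw [zero_lt_iff, ← map_mul, Valuation.ne_zero_iff]
      exact mul_ne_zero hfa hc0
  have hg0 : W (g.coeff 0 + 1) < 1 := by
    set x := (b - a) / c with hxdef
    have hx1 : W (x - 1) < 1 := by
      have : x - 1 = (b - a₂) / c := by
        rw [hxdef]
        field_simp
        rw [hc]
        ring
      rw [this, map_div₀, div_lt_iff₀ (by rw [zero_lt_iff, Valuation.ne_zero_iff]; exact hc0),
        one_mul, hWc, Valuation.map_sub_swap]
      exact ha₂
    have hxW : W x = 1 := by
      have := Valuation.map_eq_of_sub_lt W (x := 1) (y := x) (by simpa using hx1)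
      simpa using this
    have hgx : g.eval x = 0 := by
      have := congrArg (Polynomial.eval x) hg
      rw [eval_comp, eval_mul, eval_C] at this
      rw [eval_mul, eval_C, eval_X, taylor_eval, hxdef, mul_div_cancel₀ _ hc0,
        sub_add_cancel, hfb] at this
      exact (mul_eq_zero.1 this).resolve_left (mul_ne_zero hfa hc0)
    have h1 : W ((g - X - C (g.coeff 0)).eval x) < 1 := by
      refine valuation_eval_lt_one ?_ hxW.le
      rintro (_ | _ | i)
      · simp
      · simp [hg1, coeff_C]
      · simpa [coeff_X, coeff_C] using hg2 i
    have : g.coeff 0 + 1 = -((g - X - C (g.coeff 0)).eval x + (x - 1)) := by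
      simp [hgx]
      ring
    rw [this, Valuation.map_neg]
    exact Valuation.map_add_lt _ h1 hx1
  have hqa : ∀ s ∈ S, q s ≠ 0 → (q s).eval a ≠ 0 ∧ W ((q s).eval a) = W s ∧
      ∃ r : K[X], C ((q s).eval a) * r = (taylor a (q s)).comp (C c * X) ∧
      (∀ i, r.coeff i ∈ E) ∧ r.coeff 0 = 1 ∧ ∀ i, W (r.coeff (i + 1)) < 1 := by
    intro s hs h0
    have hst := ha _ (Or.inr ⟨⟨s, hs, rfl⟩, h0⟩)
    have hst' := hst.move hab le_rfl
    have hne : (q s).eval a ≠ 0 := (Valuation.ne_zero_iff W).1 hst'.ne_zero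
    obtain ⟨r, hr, hrc⟩ := key (q s) ((q s).eval a) hne
    refine ⟨hne, ?_, r, hr, ?_, ?_, ?_⟩
    · rw [hst.eval_eq hab le_rfl, ← hx s (hSE hs)]
    · intro i
      rw [hrc]
      exact E.mul_mem (E.inv_mem (eval_mem (hqE s (hSE hs)) haE))
        (E.mul_mem (htE _ (hqE s (hSE hs)) i) (pow_mem hcE i))
    · rw [hrc, taylor_coeff_zero, pow_zero, mul_one, inv_mul_cancel₀ hne]
    · intro i
      rw [hrc, map_mul, map_inv₀, map_mul, map_pow, inv_mul_lt_iff₀, mul_one, hWc]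
      · exact hst' i
      · rw [zero_lt_iff]
        exact hst'.ne_zero
  choose! hqa0 hqaW r hr hrE hr0 hr1 using hqa
  have hgE : ∀ i, g.coeff i ∈ E := by
    intro i
    rw [hgc]
    exact E.mul_mem (E.inv_mem (E.mul_mem (eval_mem hf'E haE) hcE))
      (E.mul_mem (htE _ hfE i) (pow_mem hcE i))
  set S' : Set K := {s ∈ S | q s ≠ 0} with hS'
  have hS'fin : S'.Finite := hS.subset fun s hs => hs.1
  set T : Set K := (((((⋃ s ∈ S, Set.range (q s).coeff) ∪ (⋃ s ∈ S', Set.range (r s).coeff)) ∪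
      Set.range f.coeff) ∪ Set.range g.coeff) ∪ {a, c, g.coeff 0 + 1}) ∪
      ((fun s => (q s).eval a) '' S') with hT
  obtain ⟨G, hG, hGE, hGS, hGv⟩ := hE T
    ((((((hS.biUnion fun s _ => finite_coeffs _).union
      (hS'fin.biUnion fun s _ => finite_coeffs _)).union (finite_coeffs f)).union
      (finite_coeffs g)).union (Set.toFinite _)).union (hS'fin.image _)) (by
        rintro x (((((hx | hx) | ⟨n, rfl⟩) | ⟨n, rfl⟩) | (rfl | rfl | rfl)) | ⟨s, hs, rfl⟩)
        · obtain ⟨s, hs, n, rfl⟩ := Set.mem_iUnion₂.1 hx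
          exact hqE s (hSE hs) n
        · obtain ⟨s, hs, n, rfl⟩ := Set.mem_iUnion₂.1 hx
          exact hrE s hs.1 hs.2 n
        · exact hfE n
        · exact hgE n
        · exact haE
        · exact hcE
        · exact E.add_mem (hgE 0) E.one_mem
        · exact eval_mem (hqE s (hSE hs.1)) haE)
  have memq : ∀ s ∈ S, ∀ n, (q s).coeff n ∈ T := fun s hs n =>
    Or.inl (Or.inl (Or.inl (Or.inl (Or.inl (Set.mem_iUnion₂.2 ⟨s, hs, n, rfl⟩)))))
  have memr : ∀ s ∈ S', ∀ n, (r s).coeff n ∈ T := fun s hs n =>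
    Or.inl (Or.inl (Or.inl (Or.inl (Or.inr (Set.mem_iUnion₂.2 ⟨s, hs, n, rfl⟩)))))
  have memf : ∀ n, f.coeff n ∈ T := fun n => Or.inl (Or.inl (Or.inl (Or.inr ⟨n, rfl⟩)))
  have memg : ∀ n, g.coeff n ∈ T := fun n => Or.inl (Or.inl (Or.inr ⟨n, rfl⟩))
  obtain ⟨A, hA⟩ := hGS a (Or.inl (Or.inr (Or.inl rfl)))
  obtain ⟨B, hB⟩ := hGS c (Or.inl (Or.inr (Or.inr (Or.inl rfl))))
  obtain ⟨f₁, hf₁⟩ := exists_map_eq (gFst G : G →+* K) f fun n => hGS _ (memf n)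
  obtain ⟨g₁, hg₁⟩ := exists_map_eq (gFst G : G →+* K) g fun n => hGS _ (memg n)
  have hf₁m : f₁.Monic := by
    apply Polynomial.monic_of_injective (f := (gFst G : G →+* K)) hG.injective
    rwa [hf₁]
  set φ : G →+* F := (gSnd G : G →+* F) with hφ
  have hg₁c : ∀ i, gFst G (g₁.coeff i) = g.coeff i := by
    intro i
    rw [← hg₁, coeff_map]
    rfl
  have hg₁1 : g₁.coeff 1 = 1 := by
    apply hG.injective
    rw [hg₁c, hg1, map_one]
  have hv2 : ∀ i, v ((g₁.map φ).coeff (i + 2)) < 1 := by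
    intro i
    rw [coeff_map]
    apply hGv
    · rw [hg₁c]
      exact memg _
    · rw [hg₁c]
      exact hg2 i
  have hv0 : v ((g₁.map φ).coeff 0 + 1) < 1 := by
    have : (g₁.map φ).coeff 0 + 1 = gSnd G (g₁.coeff 0 + 1) := by
      rw [coeff_map, map_add, map_one]
      rfl
    rw [this]
    apply hGv
    · rw [map_add, hg₁c, map_one]
      exact Or.inl (Or.inr (Or.inr (Or.inr rfl)))
    · rw [map_add, hg₁c, map_one]
      exact hg0
  have hv1 : (g₁.map φ).coeff 1 = 1 := by
    rw [coeff_map, hg₁1, map_one]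
  obtain ⟨x', hx'0, hx'1⟩ := hv (g₁.map φ) 1 (by
      rintro (_ | _ | i)
      · have : (g₁.map φ).coeff 0 = ((g₁.map φ).coeff 0 + 1) - 1 := by ring
        rw [this]
        exact Valuation.map_sub_le v hv0.le (by simp)
      · rw [zero_add, hv1, map_one]
      · exact (hv2 i).le) (by simp) (by
      have : (g₁.map φ).eval 1 = (g₁.map φ - X + C 1).eval 1 := by simp
      rw [this]
      refine valuation_eval_lt_one ?_ (by simp)
      rintro (_ | _ | i)
      · simpa using hv0
      · simp [hg₁1, coeff_one]
      · have := hv2 i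
        simp only [coeff_map] at this
        simpa [coeff_X, coeff_one] using this) (by
      have h1 : v ((derivative (g₁.map φ) - C 1).eval 1) < 1 := by
        refine valuation_eval_lt_one ?_ (by simp)
        rintro (_ | i)
        · rw [coeff_sub, coeff_derivative]
          rw [hv1]
          simp
        · rw [coeff_sub, coeff_derivative, coeff_C_succ, sub_zero, map_mul]
          refine mul_lt_one_of_lt_of_le (hv2 i) ?_
          exact_mod_cast valuation_natCast_le_one v (i + 1 + 1)
      rw [eval_sub, eval_C] at h1
      have := Valuation.map_eq_of_sub_lt v (x := 1) (by simpa using h1)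
      simpa using this)
  have hx'le : v x' ≤ 1 := by
    have : x' = (x' - 1) + 1 := by ring
    rw [this]
    exact Valuation.map_add_le _ hx'1.le (by simp)
  obtain ⟨G₁, hG₁, hG₁mem, hG₁E⟩ := hG.exists_adjoin b (gSnd G A + gSnd G B * x') (by
    intro Q hQ
    have e := Polynomial.modByMonic_add_div Q f₁
    have hrem : Q %ₘ f₁ = 0 := by
      have hm : ((Q %ₘ f₁).map (gFst G : G →+* K)) = 0 := by
        by_contra hne
        obtain ⟨a', -, hs⟩ := hz ((Q %ₘ f₁).map (gFst G : G →+* K))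
          (by intro n; rw [coeff_map]; exact hGE _) hne (by
            have hinj : Function.Injective (gFst G : G →+* K) := hG.injective
            rw [Polynomial.natDegree_map_eq_of_injective hinj, ← hf₁,
              Polynomial.natDegree_map_eq_of_injective hinj]
            apply Polynomial.natDegree_modByMonic_lt _ hf₁m
            rintro rfl
            rw [Polynomial.map_one] at hf₁
            rw [← hf₁] at hf'
            simp at hf')
        apply hs.ne_zero
        have e' := congrArg (fun p => (p.map (gFst G : G →+* K)).eval b) e
        simp only [Polynomial.map_add, Polynomial.map_mul, hf₁, eval_add, eval_mul, hfb,
          zero_mul, add_zero, hQ] at e'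
        rw [e', map_zero]
      exact (Polynomial.map_eq_zero_iff hG.injective).1 hm
    rw [hrem, zero_add] at e
    have hroot := hG.snd_eval_affine f₁ g₁ A B (f₁.derivative.eval A * B) (by
      rw [hf₁, hg₁, hA, hB, map_mul, gFst_eval, ← derivative_map, hf₁, hA, hB, hg]) x'
    rw [hx'0, mul_zero] at hroot
    rw [← e, Polynomial.map_mul, eval_mul, hroot, zero_mul])
  refine exists_graph_of_forall hG₁ (fun x hx => ?_) fun s hs => ?_
  · obtain ⟨Q, hQ⟩ := hG₁E x hx
    rw [hQ]
    exact eval_mem (fun n => hle (by rw [coeff_map]; exact hGE _)) hbE'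
  obtain ⟨q₁, hq₁⟩ := exists_map_eq (gFst G : G →+* K) (q s) fun n => hGS _ (memq s hs n)
  refine ⟨(q₁.map φ).eval (gSnd G A + gSnd G B * x'), ?_, fun hs1 => ?_⟩
  · have := hG₁mem q₁
    rw [hq₁, ← hx s (hSE hs)] at this
    exact this
  by_cases hq0 : q s = 0
  · have : q₁ = 0 := (Polynomial.map_eq_zero_iff hG.injective).1 (hq₁.trans hq0)
    simp [this]
  obtain ⟨r₁, hr₁⟩ := exists_map_eq (gFst G : G →+* K) (r s) fun n =>
    hGS _ (memr s ⟨hs, hq0⟩ n)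
  have hr₁c : ∀ i, gFst G (r₁.coeff i) = (r s).coeff i := by
    intro i
    rw [← hr₁, coeff_map]
    rfl
  rw [hG.snd_eval_affine q₁ r₁ A B (q₁.eval A) (by
      rw [hq₁, hr₁, hA, hB, gFst_eval, hq₁, hA, hr s hs hq0]) x', map_mul]
  refine mul_lt_one_of_lt_of_le ?_ (valuation_eval_le_one ?_ hx'le)
  · apply hGv
    · rw [gFst_eval, hq₁, hA]
      exact Or.inr ⟨s, ⟨hs, hq0⟩, rfl⟩
    · rw [gFst_eval, hq₁, hA, hqaW s hs hq0]
      exact hs1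
  · rintro (_ | i)
    · have : r₁.coeff 0 = 1 := by
        apply hG.injective
        rw [hr₁c, hr0 s hs hq0, map_one]
      rw [coeff_map, this, map_one, map_one]
    · rw [coeff_map]
      refine (hGv _ ?_ ?_).le
      · rw [hr₁c]
        exact memr s ⟨hs, hq0⟩ _
      · rw [hr₁c]
        exact hr1 s hs hq0 i

end Specializes

section Gordan

/-- A finite set of elements of `ℤ^s` which is positive for some ordered-group-valued
homomorphism is positive for an integer-valued one. -/
theorem exists_int_functional {Λ : Type*} [AddCommGroup Λ] [LinearOrder Λ]
    [IsOrderedAddMonoid Λ] : ∀ (s : ℕ) (l : (Fin s → ℤ) →+ Λ) (P : Finset (Fin s → ℤ)),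
    (∀ γ ∈ P, 0 < l γ) → ∃ h : Fin s → ℤ, ∀ γ ∈ P, 0 < ∑ i, h i * γ i := by
  intro s
  induction s with
  | zero =>
    intro l P hP
    refine ⟨0, fun γ hγ => ?_⟩
    have h0 := hP γ hγ
    rw [Subsingleton.elim γ 0, map_zero] at h0
    exact absurd h0 (lt_irrefl _)
  | succ s ih =>
    intro l P hP
    classical
    let j : (Fin s → ℤ) →+ (Fin (s + 1) → ℤ) :=
      { toFun := fun γ => Fin.snoc γ 0
        map_zero' := by
          ext i; refine Fin.lastCases ?_ (fun i => ?_) i <;> simp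
        map_add' := fun a b => by
          ext i; refine Fin.lastCases ?_ (fun i => ?_) i <;> simp }
    let d : (Fin (s + 1) → ℤ) → (Fin (s + 1) → ℤ) → (Fin (s + 1) → ℤ) := fun a b =>
      (-(b (Fin.last s))) • a + (a (Fin.last s)) • b
    have hj : ∀ γ : Fin (s + 1) → ℤ, γ (Fin.last s) = 0 → j (γ ∘ Fin.castSucc) = γ := by
      intro γ h
      ext i
      refine Fin.lastCases ?_ (fun i => ?_) i
      · simp [j, h]
      · simp [j]
    let P' : Finset (Fin s → ℤ) := ((P.filter fun γ => γ (Fin.last s) = 0).image (· ∘ Fin.castSucc)) ∪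
      (((P.filter fun γ => 0 < γ (Fin.last s)) ×ˢ (P.filter fun γ => γ (Fin.last s) < 0)).image
        fun ab => d ab.1 ab.2 ∘ Fin.castSucc)
    obtain ⟨h, hh⟩ := ih (l.comp j) P' (by
      intro γ hγ
      rcases Finset.mem_union.1 hγ with hγ | hγ
      · obtain ⟨a, ha, rfl⟩ := Finset.mem_image.1 hγ
        rw [Finset.mem_filter] at ha
        rw [AddMonoidHom.comp_apply, hj _ ha.2]
        exact hP a ha.1
      · obtain ⟨⟨a, b⟩, hab, rfl⟩ := Finset.mem_image.1 hγ
        rw [Finset.mem_product, Finset.mem_filter, Finset.mem_filter] at hab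
        obtain ⟨⟨ha, ha'⟩, hb, hb'⟩ := hab
        rw [AddMonoidHom.comp_apply, hj _ (by simp [d]; ring), map_add, map_zsmul, map_zsmul]
        exact add_pos (zsmul_pos (hP a ha) (by simpa using hb')) (zsmul_pos (hP b hb) ha'))
    let e : (Fin (s + 1) → ℤ) → ℤ := fun γ => ∑ i : Fin s, h i * γ i.castSucc
    obtain ⟨r, hr1, hr2⟩ := Order.exists_between_finsets
      (lo := (P.filter fun γ => 0 < γ (Fin.last s)).image
        fun a => -(e a : ℚ) / (a (Fin.last s) : ℚ))
      (hi := (P.filter fun γ => γ (Fin.last s) < 0).image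
        fun b => -(e b : ℚ) / (b (Fin.last s) : ℚ)) (by
      intro x hx y hy
      obtain ⟨a, ha, rfl⟩ := Finset.mem_image.1 hx
      obtain ⟨b, hb, rfl⟩ := Finset.mem_image.1 hy
      have := hh (d a b ∘ Fin.castSucc) (Finset.mem_union_right _
        (Finset.mem_image.2 ⟨(a, b), Finset.mem_product.2 ⟨ha, hb⟩, rfl⟩))
      rw [Finset.mem_filter] at ha hb
      have e1 : ∑ i, h i * (d a b ∘ Fin.castSucc) i =
          (-(b (Fin.last s))) * e a + (a (Fin.last s)) * e b := by
        simp only [e, Finset.mul_sum, ← Finset.sum_add_distrib]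
        refine Finset.sum_congr rfl fun i _ => ?_
        simp [d]
        ring
      rw [e1] at this
      have h1 : (0 : ℚ) < a (Fin.last s) := by exact_mod_cast ha.2
      have h2 : (0 : ℚ) < -(b (Fin.last s) : ℚ) := by
        have := hb.2
        rw [← neg_pos] at this
        exact_mod_cast this
      have h3 : (0 : ℚ) < (-(b (Fin.last s))) * e a + (a (Fin.last s)) * e b := by
        exact_mod_cast this
      rw [← neg_div_neg_eq (-(e b : ℚ)), neg_neg, div_lt_div_iff₀ h1 h2]
      linarith)
    refine ⟨Fin.snoc (fun i => (r.den : ℤ) * h i) r.num, fun γ hγ => ?_⟩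
    rw [Fin.sum_univ_castSucc]
    simp only [Fin.snoc_castSucc, Fin.snoc_last]
    have e1 : ∑ i : Fin s, (r.den : ℤ) * h i * γ i.castSucc = r.den * e γ := by
      simp only [e, Finset.mul_sum]
      exact Finset.sum_congr rfl fun i _ => by ring
    rw [e1]
    have hden : (0 : ℚ) < r.den := by exact_mod_cast r.den_pos
    have hq : ((r.den * e γ + r.num * γ (Fin.last s) : ℤ) : ℚ) =
        r.den * (e γ + r * γ (Fin.last s)) := by
      push_cast
      have : (r.num : ℚ) = r.den * r := (Rat.den_mul_eq_num r).symm
      rw [this]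
      ring
    have : (0 : ℚ) < ((r.den * e γ + r.num * γ (Fin.last s) : ℤ) : ℚ) := by
      rw [hq]
      refine mul_pos hden ?_
      rcases lt_trichotomy (γ (Fin.last s)) 0 with h0 | h0 | h0
      · have := hr2 _ (Finset.mem_image.2 ⟨γ, Finset.mem_filter.2 ⟨hγ, h0⟩, rfl⟩)
        have h2 : (γ (Fin.last s) : ℚ) < 0 := by exact_mod_cast h0
        rw [lt_div_iff_of_neg h2] at this
        linarith
      · have := hh _ (Finset.mem_union_left _ (Finset.mem_image_of_mem (· ∘ Fin.castSucc)
          (Finset.mem_filter.2 ⟨hγ, h0⟩)))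
        have h3 : 0 < e γ := this
        rw [h0]
        simpa using h3
      · have := hr1 _ (Finset.mem_image.2 ⟨γ, Finset.mem_filter.2 ⟨hγ, h0⟩, rfl⟩)
        have h2 : (0 : ℚ) < γ (Fin.last s) := by exact_mod_cast h0
        rw [div_lt_iff₀ h2] at this
        linarith
    exact_mod_cast this

theorem exists_monomial_specialization {F : Type*} [Field F] {Γ Γ₀ : Type*}
    [LinearOrderedCommGroupWithZero Γ] [LinearOrderedCommGroupWithZero Γ₀] (v : Valuation F Γ₀)
    {π : F} (hπ0 : π ≠ 0) (hπ1 : v π < 1) (harch : ∀ c : F, ∃ M : ℕ, v c * v π ^ M < 1)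
    {s : ℕ} (l : Multiplicative (Fin s → ℤ) →* Γˣ) (P : Finset (F × (Fin s → ℤ))) :
    ∃ χ : Multiplicative (Fin s → ℤ) →* Fˣ, ∀ c ∈ P, l (.ofAdd c.2) < 1 →
      v c.1 * v (χ (.ofAdd c.2) : F) < 1 := by
  classical
  obtain ⟨h, hh⟩ := exists_int_functional (Λ := Additive (Γˣ)ᵒᵈ) s
    ({ toFun := fun γ => Additive.ofMul (OrderDual.toDual (l (.ofAdd γ)))
       map_zero' := by simp
       map_add' := fun a b => by simp [ofAdd_add] })
    ((P.image Prod.snd).filter fun γ => l (.ofAdd γ) < 1) (by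
      intro γ hγ
      exact (Finset.mem_filter.1 hγ).2)
  choose M hM using harch
  have hle : v π ≤ 1 := hπ1.le
  let N := P.sup fun c => M c.1
  let H : Multiplicative (Fin s → ℤ) →* Multiplicative ℤ := AddMonoidHom.toMultiplicative
    { toFun := fun γ => ∑ i, h i * γ i
      map_zero' := by simp
      map_add' := fun a b => by simp [mul_add, Finset.sum_add_distrib] }
  refine ⟨(zpowersHom Fˣ (Units.mk0 π hπ0 ^ N)).comp H, fun c hc hl => ?_⟩
  have hpos := hh c.2 (Finset.mem_filter.2 ⟨Finset.mem_image_of_mem _ hc, hl⟩)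
  have hN : M c.1 ≤ N := Finset.le_sup (f := fun c => M c.1) hc
  obtain ⟨k, hk⟩ : ∃ k : ℕ, ∑ i, h i * c.2 i = ((k + 1 : ℕ) : ℤ) :=
    ⟨(∑ i, h i * c.2 i).toNat - 1, by omega⟩
  have hval : (((zpowersHom Fˣ (Units.mk0 π hπ0 ^ N)).comp H (.ofAdd c.2) : Fˣ) : F) =
      (π ^ N) ^ (k + 1) := by
    have : H (.ofAdd c.2) = .ofAdd ((k + 1 : ℕ) : ℤ) := congrArg Multiplicative.ofAdd hk
    rw [MonoidHom.comp_apply, this, zpowersHom_apply, toAdd_ofAdd, zpow_natCast]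
    simp
  rw [hval, map_pow, map_pow, ← pow_mul]
  refine lt_of_le_of_lt ?_ (hM c.1)
  gcongr 1
  exact pow_le_pow_right_of_le_one' hle (by nlinarith)

end Gordan

section Monomial

variable {F K : Type*} [Field F] [Field K] [Algebra F K]
  {Γ : Type*} [LinearOrderedCommGroupWithZero Γ]

theorem HenselProp.exists_pow_eq {W : Valuation K Γ} (hW : HenselProp W) {n : ℕ}
    (hn : W (n : K) = 1) {x : K} (hx : W (x - 1) < 1) : ∃ y, y ^ n = x ∧ W (y - 1) < 1 := by
  have hn0 : n ≠ 0 := by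
    rintro rfl
    simp at hn
  have hx1 : W x ≤ 1 := by
    have := W.map_add_le (hx.le) (W.map_one.le)
    simpa using this
  obtain ⟨y, hy, hy'⟩ := hW (X ^ n - C x) 1 (by
    intro i
    rw [coeff_sub, coeff_X_pow, coeff_C]
    refine W.map_sub_le ?_ ?_ <;> split_ifs <;> simp [hx1]) (by simp) (by
      rw [W.map_sub_swap] at hx
      simpa using hx) (by
      rw [derivative_sub, derivative_C, sub_zero, derivative_X_pow]
      simpa using hn)
  exact ⟨y, by simpa [sub_eq_zero] using hy, hy'⟩

/-- A group of monomials: a complement of the principal units containing the coefficient field. -/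
theorem exists_monomial_group {W : Valuation K Γ} (hW : HenselProp W)
    (hn : ∀ n : ℕ, W ((n + 1 : ℕ) : K) = 1)
    (hres : ∀ x : K, W x ≤ 1 → ∃ a : F, W (x - algebraMap F K a) < 1)
    (hF : ∀ a : F, a ≠ 0 → W (algebraMap F K a) = 1) :
    ∃ T : Subgroup Kˣ, (∀ y : Kˣ, ∃ τ ∈ T, W ((y : K) - τ) < W (y : K)) ∧
      ∀ τ ∈ T, W (τ : K) = 1 → ∃ a : F, (τ : K) = algebraMap F K a := by
  have hval : ∀ x : K, W (x - 1) < 1 → W x = 1 := fun x hx => by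
    simpa using W.map_eq_of_sub_lt (x := 1) (y := x) (by simpa using hx)
  let U : Subgroup Kˣ :=
    { carrier := {y | W ((y : K) - 1) < 1}
      one_mem' := by simp
      mul_mem' := by
        intro a b ha hb
        have : ((a * b : Kˣ) : K) - 1 = (a - 1) * b + (b - 1) := by push_cast; ring
        show W _ < 1
        rw [this]
        refine W.map_add_lt ?_ hb
        rw [map_mul, hval b hb, mul_one]
        exact ha
      inv_mem' := by
        intro a ha
        have : ((a⁻¹ : Kˣ) : K) - 1 = -((a : K) - 1) / a := by
          have := a.ne_zero
          push_cast
          field_simp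
          ring
        show W _ < 1
        rw [this, map_div₀, hval a ha, div_one, W.map_neg]
        exact ha }
  have hUdiv : ∀ (n : ℤ), n ≠ 0 → ∀ y : U, ∃ z : U, z ^ n = y := by
    have hnat : ∀ (n : ℕ), n ≠ 0 → ∀ y : U, ∃ z : U, z ^ n = y := by
      rintro (_ | n) hn0 ⟨y, hy⟩
      · exact absurd rfl hn0
      obtain ⟨z, hz, hz'⟩ := hW.exists_pow_eq (hn n) (x := (y : K)) hy
      have hz0 : z ≠ 0 := by
        rintro rfl
        simp at hz'
      refine ⟨⟨Units.mk0 z hz0, hz'⟩, Subtype.ext (Units.ext ?_)⟩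
      simpa using hz
    intro n hn0 y
    obtain ⟨z, hz⟩ := hnat n.natAbs (by omega) y
    rcases Int.natAbs_eq n with h | h
    · exact ⟨z, by rw [h, zpow_natCast, hz]⟩
    · exact ⟨z⁻¹, by rw [h, zpow_neg, zpow_natCast, inv_pow, hz, inv_inv]⟩
  let N : Subgroup Kˣ := (Units.map (algebraMap F K : F →* K)).range
  have hinj : Function.Injective ((QuotientGroup.mk' N).comp U.subtype) := by
    rw [injective_iff_map_eq_one]
    rintro ⟨y, hy⟩ h
    have : y ∈ N := by simpa using h
    obtain ⟨a, rfl⟩ := this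
    have h1 : W (algebraMap F K (a - 1)) < 1 := by
      simpa using (show W _ < 1 from hy)
    have h2 : (a : F) - 1 = 0 := by
      by_contra h
      exact h1.ne (hF _ h)
    have h3 : a = 1 := Units.ext (by simpa [sub_eq_zero] using h2)
    exact Subtype.ext (by simp [h3])
  letI : DivisibleBy (Additive U) ℤ :=
    { div := fun a n => if h : n = 0 then 0 else
        Additive.ofMul (hUdiv n h a.toMul).choose
      div_zero := fun a => by simp
      div_cancel := fun {n} a h => by
        rw [dif_neg h]
        exact (hUdiv n h a.toMul).choose_spec }
  let f : Additive U →+ Additive (Kˣ ⧸ N) :=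
    MonoidHom.toAdditive ((QuotientGroup.mk' N).comp U.subtype)
  have hf : Function.Injective f := fun a b h => hinj h
  have hB : Module.Baer ℤ (Additive U) := Module.Baer.of_divisible (Additive U)
  obtain ⟨r, hr⟩ := hB.extension_property_addMonoidHom (M := Additive U) (N := Additive (Kˣ ⧸ N))
    f hf (AddMonoidHom.id (Additive U))
  let ρ : Kˣ →* U := (MonoidHom.toAdditive.symm r : (Kˣ ⧸ N) →* U).comp (QuotientGroup.mk' N)
  have hρ : ∀ y : U, ρ y = y := fun y => by
    have := DFunLike.congr_fun hr (Additive.ofMul y)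
    exact this
  refine ⟨ρ.ker, ?_, ?_⟩
  · intro y
    refine ⟨y * ((ρ y)⁻¹ : U), ?_, ?_⟩
    · rw [MonoidHom.mem_ker, map_mul, hρ, mul_inv_cancel]
    · have h := ((ρ y)⁻¹).2
      have : (y : K) - ((y * ((ρ y)⁻¹ : U) : Kˣ) : K) = -(y * ((((ρ y)⁻¹ : U) : Kˣ) - 1 : K)) := by
        rw [Units.val_mul]; ring
      rw [this, W.map_neg, map_mul]
      have hy : 0 < W (y : K) := by simp [zero_lt_iff]
      calc _ < W (y : K) * 1 := by
            gcongr
            exact h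
        _ = _ := mul_one _
  · intro τ hτ h1
    obtain ⟨a, ha⟩ := hres τ h1.le
    have ha0 : a ≠ 0 := by
      rintro rfl
      simp [h1] at ha
    let α : Kˣ := Units.map (algebraMap F K : F →* K) (Units.mk0 a ha0)
    have hα : (α : K) = algebraMap F K a := rfl
    have hWa : W (α : K) = 1 := hF a ha0
    have hU : τ * α⁻¹ ∈ U := by
      have h0 := α.ne_zero
      have : ((τ * α⁻¹ : Kˣ) : K) - 1 = (τ - α) / α := by
        rw [Units.val_mul, Units.val_inv_eq_inv_val]
        field_simp
      show W _ < 1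
      rw [this, map_div₀, hWa, div_one, hα]
      exact ha
    have hρα : ρ α = 1 := by
      have : QuotientGroup.mk' N α = 1 := by
        rw [QuotientGroup.mk'_apply, QuotientGroup.eq_one_iff]
        exact ⟨_, rfl⟩
      show (MonoidHom.toAdditive.symm r : (Kˣ ⧸ N) →* U) (QuotientGroup.mk' N α) = 1
      rw [this, map_one]
    have h2 := hρ ⟨_, hU⟩
    rw [map_mul, (MonoidHom.mem_ker).1 hτ, map_inv, hρα] at h2
    have h3 : τ * α⁻¹ = 1 := by
      have := congrArg Subtype.val h2
      simpa using this.symm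
    exact ⟨a, by rw [mul_inv_eq_one.1 h3, hα]⟩

end Monomial

section Lattice

variable {F K : Type*} [Field F] [Field K] [Algebra F K]
  {Γ : Type*} [LinearOrderedCommGroupWithZero Γ] {Γ₀ : Type*} [LinearOrderedCommGroupWithZero Γ₀]

/-- The values of a valuation on units, as a homomorphism. -/
def unitsVal (W : Valuation K Γ) : Kˣ →* Γˣ := Units.map (W : K →* Γ)

theorem coe_unitsVal (W : Valuation K Γ) (y : Kˣ) : (unitsVal W y : Γ) = W y := rfl

theorem exists_lattice (W : Valuation K Γ) (T : Subgroup Kˣ) (S : Set Kˣ) (hS : S.Finite)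
    (hST : S ⊆ T) : ∃ (s : ℕ) (t : Multiplicative (Fin s → ℤ) →* Kˣ), (∀ α, t α ∈ T) ∧
      (Function.Injective fun α => unitsVal W (t α)) ∧
      ∀ τ ∈ S, ∃ α, unitsVal W (t α) = unitsVal W τ := by
  let V : Subgroup Γˣ := Subgroup.closure (unitsVal W '' S)
  have hfin := (hS.image (unitsVal W)).to_subtype
  have : Module.Finite ℤ (Additive V) := by
    rw [Module.Finite.iff_addGroup_fg]
    infer_instance
  obtain ⟨s, b⟩ := Module.basisOfFiniteTypeTorsionFree' (R := ℤ) (M := Additive V)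
  have hV : V ≤ T.map (unitsVal W) := by
    rw [Subgroup.closure_le]
    rintro _ ⟨x, hx, rfl⟩
    exact ⟨x, hST hx, rfl⟩
  have hb : ∀ i, ∃ τ ∈ T, unitsVal W τ = ((b i).toMul : V) := fun i => hV (b i).toMul.2
  choose τ hτT hτ using hb
  let t : Multiplicative (Fin s → ℤ) →* Kˣ :=
    { toFun := fun α => ∏ i, τ i ^ (α.toAdd i)
      map_one' := by simp
      map_mul' := fun α β => by simp [zpow_add, Finset.prod_mul_distrib] }
  have ht : ∀ α, unitsVal W (t α) = ((b.equivFun.symm α.toAdd).toMul : V) := by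
    intro α
    rw [Module.Basis.equivFun_symm_apply, toMul_sum, Subgroup.val_finsetProd]
    show unitsVal W (∏ i, τ i ^ (α.toAdd i)) = _
    rw [map_prod]
    refine Finset.prod_congr rfl fun i _ => ?_
    rw [map_zpow, hτ, toMul_zsmul, Subgroup.coe_zpow]
  refine ⟨s, t, fun α => T.prod_mem (t := Finset.univ) (f := fun i => τ i ^ (α.toAdd i))
    fun i _ => T.zpow_mem (hτT i) _, ?_, ?_⟩
  · intro α β h
    simp only [ht] at h
    exact b.equivFun.symm.injective (Subtype.ext h)
  · intro τ hτ
    refine ⟨.ofAdd (b.equivFun (.ofMul ⟨_, Subgroup.subset_closure ⟨τ, hτ, rfl⟩⟩)), ?_⟩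
    rw [ht, toAdd_ofAdd, LinearEquiv.symm_apply_apply]
    rfl

theorem specializes_monomial {W : Valuation K Γ} {v : Valuation F Γ₀} {π : F} (hπ0 : π ≠ 0)
    (hπ1 : v π < 1) (harch : ∀ c : F, ∃ M : ℕ, v c * v π ^ M < 1)
    (hF : ∀ a : F, a ≠ 0 → W (algebraMap F K a) = 1) {T : Subgroup Kˣ}
    (hT : ∀ τ ∈ T, W (τ : K) = 1 → ∃ a : F, (τ : K) = algebraMap F K a) :
    Specializes W v (IntermediateField.adjoin F ((fun τ : Kˣ => (τ : K)) '' (T : Set Kˣ))) := by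
  classical
  set T' : Set K := (fun τ : Kˣ => (τ : K)) '' (T : Set Kˣ) with hT'
  set E := IntermediateField.adjoin F T'
  intro S hS hSE
  have hspan : ∀ x ∈ Algebra.adjoin F T', x ∈ Submodule.span F T' := by
    intro x hx
    rw [← Subalgebra.mem_toSubmodule, Algebra.adjoin_eq_span] at hx
    let M : Submonoid K :=
      { carrier := T'
        one_mem' := ⟨1, T.one_mem, rfl⟩
        mul_mem' := by
          rintro _ _ ⟨a, ha, rfl⟩ ⟨b, hb, rfl⟩
          exact ⟨a * b, T.mul_mem ha hb, rfl⟩ }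
    have hM : ((Submonoid.closure T' : Submonoid K) : Set K) = T' :=
      congrArg SetLike.coe (Submonoid.closure_eq M)
    rwa [hM] at hx
  have hfrac : ∀ x ∈ S, ∃ a b : K, a ∈ Submodule.span F T' ∧ b ∈ Submodule.span F T' ∧
      b ≠ 0 ∧ x = a / b := by
    intro x hx
    obtain ⟨a, ha, b, hb, rfl⟩ := IntermediateField.mem_adjoin_iff_div.1 (hSE hx)
    by_cases h : b = 0
    · exact ⟨0, 1, zero_mem _, Submodule.subset_span ⟨1, T.one_mem, rfl⟩, one_ne_zero, by simp [h]⟩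
    · exact ⟨a, b, hspan a ha, hspan b hb, h, rfl⟩
  choose! a b ha hb hb0 hab using hfrac
  have hset : ∀ x : K, ∃ U : Set K, U.Finite ∧ U ⊆ T' ∧ (x ∈ Submodule.span F T' →
      x ∈ Submodule.span F U) := by
    intro x
    by_cases hx : x ∈ Submodule.span F T'
    · obtain ⟨U, h1, h2⟩ := Submodule.mem_span_finite_of_mem_span hx
      exact ⟨U, U.finite_toSet, h1, fun _ => h2⟩
    · exact ⟨∅, Set.finite_empty, Set.empty_subset _, fun h => absurd h hx⟩
  choose U hUfin hUT hU using hset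
  set Q : Set K := a '' S ∪ b '' S with hQ
  have hQfin : Q.Finite := (hS.image _).union (hS.image _)
  have hQspan : ∀ x ∈ Q, x ∈ Submodule.span F T' := by
    rintro _ (⟨s, hs, rfl⟩ | ⟨s, hs, rfl⟩)
    · exact ha s hs
    · exact hb s hs
  obtain ⟨s, t, htT, htinj, hlat⟩ := exists_lattice W T
    {τ | τ ∈ T ∧ (τ : K) ∈ ⋃ x ∈ Q, U x} (by
      have : (⋃ x ∈ Q, U x).Finite := hQfin.biUnion fun x _ => hUfin x
      exact (this.preimage (Units.val_injective.injOn)).subset fun τ h => h.2) fun τ h => h.1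
  let Φ : AddMonoidAlgebra F (Fin s → ℤ) →ₐ[F] K :=
    AddMonoidAlgebra.lift F K _ ((Units.coeHom K).comp t)
  have hΦ : ∀ q, Φ q = ∑ i ∈ q.coeff.support, q.coeff i • (t (.ofAdd i) : K) := fun q => by
    rw [AddMonoidAlgebra.lift_apply]
    rfl
  have hQΦ : ∀ x ∈ Q, ∃ q, Φ q = x := by
    intro x hx
    have h1 : Submodule.span F (U x) ≤ Subalgebra.toSubmodule Φ.range := by
      rw [Submodule.span_le]
      intro y hy
      obtain ⟨τ, hτ, rfl⟩ := hUT x hy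
      obtain ⟨α, hα⟩ := hlat τ ⟨hτ, Set.mem_biUnion hx hy⟩
      have h2 : W ((τ / t α : Kˣ) : K) = 1 := by
        rw [← coe_unitsVal, _root_.map_div, hα, div_self']
        rfl
      obtain ⟨c, hc⟩ := hT _ (T.div_mem hτ (htT α)) h2
      refine ⟨AddMonoidAlgebra.single α.toAdd c, ?_⟩
      have h3 : (τ : K) = algebraMap F K c * t α := by
        rw [← hc, ← Units.val_mul, div_mul_cancel]
      simp only [Φ, RingHom.coe_coe]
      show _ = (τ : K)
      rw [h3]
      simp [Algebra.smul_def]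
    exact h1 (hU x (hQspan x hx))
  choose! q hq using hQΦ
  -- leading terms
  have hlead : ∀ q : AddMonoidAlgebra F (Fin s → ℤ), q ≠ 0 → ∃ i ∈ q.coeff.support,
      W (Φ q) = W (t (.ofAdd i)) ∧ ∀ j ∈ q.coeff.support, j ≠ i →
        W (t (.ofAdd j) : K) < W (t (.ofAdd i) : K) := by
    intro q hq0
    have hne : q.coeff.support.Nonempty := by
      rw [Finsupp.support_nonempty_iff]
      intro h
      exact hq0 (AddMonoidAlgebra.ext h)
    obtain ⟨i, hi, hmax⟩ := q.coeff.support.exists_max_image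
      (fun i => W (t (.ofAdd i) : K)) hne
    have hlt : ∀ j ∈ q.coeff.support, j ≠ i →
        W (t (.ofAdd j) : K) < W (t (.ofAdd i) : K) := by
      intro j hj hji
      refine lt_of_le_of_ne (hmax j hj) fun h => hji ?_
      exact Multiplicative.ofAdd.injective (htinj (Units.ext h))
    have hval : ∀ j ∈ q.coeff.support, W (q.coeff j • (t (.ofAdd j) : K)) = W (t (.ofAdd j) : K) := by
      intro j hj
      rw [Algebra.smul_def, map_mul, hF _ (Finsupp.mem_support_iff.1 hj), one_mul]
    refine ⟨i, hi, ?_, hlt⟩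
    rw [hΦ, Valuation.map_sum_eq_of_lt W hi, hval i hi]
    intro j hj
    rw [Finset.mem_sdiff, Finset.mem_singleton] at hj
    rw [hval i hi, hval j hj.1]
    exact hlt j hj.1 hj.2
  have hinj : ∀ q, Φ q = 0 → q = 0 := by
    intro q h
    by_contra hq0
    obtain ⟨i, _, hi, _⟩ := hlead q hq0
    rw [h, map_zero] at hi
    exact (t (.ofAdd i)).ne_zero ((Valuation.zero_iff W).1 hi.symm)
  let R : Finset (F × (Fin s → ℤ)) := hQfin.toFinset.biUnion fun x =>
    (q x).coeff.support.image fun i => ((q x).coeff i, i)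
  obtain ⟨χ, hχ⟩ := exists_monomial_specialization v hπ0 hπ1 harch ((unitsVal W).comp t)
    ((R ×ˢ R).image fun cd => (cd.1.1 / cd.2.1, cd.1.2 - cd.2.2))
  let Ψ : AddMonoidAlgebra F (Fin s → ℤ) →ₐ[F] F :=
    AddMonoidAlgebra.lift F F _ ((Units.coeHom F).comp χ)
  have hΨ : ∀ q, Ψ q = ∑ i ∈ q.coeff.support, q.coeff i • (χ (.ofAdd i) : F) := fun q => by
    rw [AddMonoidAlgebra.lift_apply]
    rfl
  have hχ' : ∀ c ∈ R, ∀ d ∈ R, d.1 ≠ 0 → W (t (.ofAdd c.2) : K) < W (t (.ofAdd d.2) : K) →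
      v (c.1 * χ (.ofAdd c.2)) < v (d.1 * χ (.ofAdd d.2)) := by
    intro c hc d hd hd0 hlt
    have h := hχ (c.1 / d.1, c.2 - d.2)
      (Finset.mem_image.2 ⟨(c, d), Finset.mem_product.2 ⟨hc, hd⟩, rfl⟩) (by
        rw [ofAdd_sub, _root_.map_div, div_lt_one', ← Units.val_lt_val]
        exact hlt)
    rw [← map_mul, ofAdd_sub, _root_.map_div, Units.val_div_eq_div_val, div_mul_div_comm, map_div₀,
      div_lt_one₀] at h
    · exact h
    · rw [zero_lt_iff, Valuation.ne_zero_iff]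
      exact mul_ne_zero hd0 (Units.ne_zero _)
  have hboth : ∀ x ∈ Q, x ≠ 0 → ∃ c ∈ R, c.1 ≠ 0 ∧ W x = W (t (.ofAdd c.2) : K) ∧
      v (Ψ (q x)) = v (c.1 * χ (.ofAdd c.2)) := by
    intro x hx hx0
    have hR : ∀ i ∈ (q x).coeff.support, ((q x).coeff i, i) ∈ R := fun i hi =>
      Finset.mem_biUnion.2 ⟨x, hQfin.mem_toFinset.2 hx, Finset.mem_image.2 ⟨i, hi, rfl⟩⟩
    obtain ⟨i, hi, h1, h2⟩ := hlead (q x) (by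
      intro h
      apply hx0
      rw [← hq x hx, h, map_zero])
    refine ⟨_, hR i hi, Finsupp.mem_support_iff.1 hi, by rw [← hq x hx, h1], ?_⟩
    rw [hΨ, Valuation.map_sum_eq_of_lt v hi]
    · rfl
    intro j hj
    rw [Finset.mem_sdiff, Finset.mem_singleton] at hj
    exact hχ' _ (hR j hj.1) _ (hR i hi) (Finsupp.mem_support_iff.1 hi) (h2 j hj.1 hj.2)
  have hΨ0 : ∀ x ∈ Q, x ≠ 0 → Ψ (q x) ≠ 0 := by
    intro x hx hx0 h
    obtain ⟨c, _, hc0, _, h2⟩ := hboth x hx hx0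
    rw [h, map_zero, eq_comm, Valuation.zero_iff] at h2
    exact mul_ne_zero hc0 (Units.ne_zero _) h2
  have hG : IsGraph (Φ.prod Ψ).range := by
    rintro _ ⟨r, rfl⟩ h
    have h' : Φ r = 0 := h
    rw [hinj r h', map_zero]
    rfl
  obtain ⟨G, hle, hG', hinv, hfr⟩ := hG.exists_localization
  have hmemE : ∀ x ∈ (Φ.prod Ψ).range, x.1 ∈ E := by
    rintro _ ⟨r, rfl⟩
    show Φ r ∈ E
    rw [hΦ]
    exact E.sum_mem fun i _ => E.smul_mem (IntermediateField.subset_adjoin F T' ⟨_, htT _, rfl⟩)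
  refine exists_graph_of_forall hG' ?_ ?_
  · intro x hx
    obtain ⟨a, ha, b, hb, _, h⟩ := hfr x hx
    rw [h]
    exact E.div_mem (hmemE a ha) (hmemE b hb)
  · intro x hx
    have haQ : a x ∈ Q := Or.inl ⟨x, hx, rfl⟩
    have hbQ : b x ∈ Q := Or.inr ⟨x, hx, rfl⟩
    have hmem : ∀ y ∈ Q, (y, Ψ (q y)) ∈ G := fun y hy =>
      hle ⟨q y, Prod.ext (hq y hy) rfl⟩
    refine ⟨Ψ (q (a x)) / Ψ (q (b x)), ?_, ?_⟩
    · have := G.mul_mem (hmem _ haQ) (hinv _ (hmem _ hbQ) (hΨ0 _ hbQ (hb0 x hx)))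
      convert this using 1
      ext
      · exact (hab x hx).trans (div_eq_mul_inv _ _)
      · exact div_eq_mul_inv _ _
    · intro hlt
      by_cases hax : a x = 0
      · have : q (a x) = 0 := hinj _ (by rw [hq _ haQ, hax])
        rw [this, map_zero, zero_div, map_zero]
        exact zero_lt_one
      obtain ⟨c, hc, hc0, hc1, hc2⟩ := hboth _ haQ hax
      obtain ⟨d, hd, hd0, hd1, hd2⟩ := hboth _ hbQ (hb0 x hx)
      rw [hab x hx, map_div₀, div_lt_one₀ (by rw [zero_lt_iff, Valuation.ne_zero_iff]; exact hb0 x hx),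
        hc1, hd1] at hlt
      rw [map_div₀, div_lt_one₀ (by
        rw [zero_lt_iff, Valuation.ne_zero_iff]; exact hΨ0 _ hbQ (hb0 x hx)), hc2, hd2]
      exact hχ' c hc d hd hd0 hlt

end Lattice

section Extend

variable {F K : Type*} [Field F] [Field K] [Algebra F K]
  {Γ : Type*} [LinearOrderedCommGroupWithZero Γ] {Γ₀ : Type*} [LinearOrderedCommGroupWithZero Γ₀]

theorem Stab.C_mul {W : Valuation K Γ} {q : K[X]} {z : K} {γ : Γ} (h : Stab W q z γ) {c : K}
    (hc : c ≠ 0) : Stab W (C c * q) z γ := by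
  intro i
  have hc' : 0 < W c := by rwa [zero_lt_iff, Valuation.ne_zero_iff]
  have h2 : (taylor z (C c * q)).coeff (i + 1) = c * (taylor z q).coeff (i + 1) := by
    rw [taylor_mul, taylor_C, coeff_C_mul]
  rw [h2, eval_C_mul, map_mul, map_mul, mul_assoc]
  exact mul_lt_mul_of_pos_left (h i) hc'

theorem valuation_root_eq {W : Valuation K Γ} {g : K[X]} (hg : ∀ n, W (g.coeff n) ≤ 1)
    (h1 : g.coeff 1 = 1) {c : K} (hc : W c < 1) (h : g.eval c = 0) : W c = W (g.coeff 0) := by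
  have e1 : g.eval c = g.divX.eval c * c + g.coeff 0 := by
    conv_lhs => rw [← divX_mul_X_add g]
    simp
  have e2 : g.divX.eval c = g.divX.divX.eval c * c + 1 := by
    conv_lhs => rw [← divX_mul_X_add g.divX]
    simp [coeff_divX, h1]
  have h3 : W (g.divX.divX.eval c * c) < 1 := by
    rw [map_mul]
    have : W (g.divX.divX.eval c) ≤ 1 := valuation_eval_le_one (fun n => by
      rw [coeff_divX, coeff_divX]
      exact hg _) hc.le
    calc _ ≤ 1 * W c := by gcongr
      _ < 1 := by rwa [one_mul]
  have h4 : W (g.divX.eval c) = 1 := by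
    rw [e2, Valuation.map_add_eq_of_lt_right _ (by rwa [map_one]), map_one]
  rw [h, eq_comm, add_eq_zero_iff_eq_neg] at e1
  have := congrArg W e1
  rwa [map_mul, h4, one_mul, Valuation.map_neg] at this

theorem eval_map_of_aeval {E : IntermediateField F K} (r : E[X]) (z : K) :
    aeval z r = (r.map (algebraMap E K)).eval z := by
  rw [aeval_def, eval_map]

theorem exists_specializes_extension {W : Valuation K Γ} {v : Valuation F Γ₀}
    (hv : HenselProp v) (hWH : HenselProp₀ W) (hW : ∀ n : ℕ, W ((n + 1 : ℕ) : K) = 1)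
    {E : IntermediateField F K} (hE : Specializes W v E)
    (hlead : ∀ y : K, y ≠ 0 → ∃ τ ∈ E, W (y - τ) < W y) {z : K} (hz : z ∉ E) :
    ∃ E' : IntermediateField F K, E < E' ∧ Specializes W v E' := by
  have hnomin : ∀ b : K, b ∉ E → ∀ a ∈ E, ∃ a₂ ∈ E, W (a₂ - b) < W (a - b) := by
    intro b hb a ha
    obtain ⟨τ, hτ, h⟩ := hlead (b - a) (sub_ne_zero.2 fun h => hb (h ▸ ha))
    refine ⟨a + τ, E.add_mem ha hτ, ?_⟩
    rw [W.map_sub_swap a b, W.map_sub_swap]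
    convert h using 2
    ring
  have hpos : ∀ b : K, b ∉ E → ∀ a ∈ E, W (a - b) ≠ 0 := by
    intro b hb a ha
    rw [Valuation.ne_zero_iff, sub_ne_zero]
    rintro rfl
    exact hb ha
  have hlt : ∀ b : K, b ∉ E → E < (IntermediateField.adjoin E {b}).restrictScalars F := by
    intro b hb
    refine lt_of_le_of_ne ?_ ?_
    · intro x hx
      rw [IntermediateField.mem_restrictScalars]
      exact (IntermediateField.adjoin E {b}).algebraMap_mem ⟨x, hx⟩
    · intro h
      apply hb
      rw [h, IntermediateField.mem_restrictScalars]
      exact IntermediateField.mem_adjoin_simple_self E b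
  have hbmem : ∀ b : K, b ∈ (IntermediateField.adjoin E {b}).restrictScalars F := by
    intro b
    rw [IntermediateField.mem_restrictScalars]
    exact IntermediateField.mem_adjoin_simple_self E b
  have hcoeff : ∀ (r : E[X]) (n : ℕ), (r.map (algebraMap E K)).coeff n ∈ E := by
    intro r n
    rw [coeff_map]
    exact (r.coeff n).2
  by_cases hst : ∀ q : K[X], (∀ n, q.coeff n ∈ E) → q ≠ 0 → ∃ a ∈ E, Stab W q z (W (a - z))
  · refine ⟨_, hlt z hz, specializes_of_transcendental hE hz (hlt z hz).le (hbmem z) ?_ hst⟩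
    intro x hx
    rw [IntermediateField.mem_restrictScalars, IntermediateField.mem_adjoin_simple_iff] at hx
    obtain ⟨r, s, rfl⟩ := hx
    by_cases h : aeval z s = 0
    · refine ⟨0, 1, by simp, fun n => ?_, by simp, by simp [h]⟩
      rw [coeff_one]
      split_ifs
      exacts [E.one_mem, E.zero_mem]
    · refine ⟨_, _, hcoeff r, hcoeff s, ?_, ?_⟩
      · rwa [← eval_map_of_aeval]
      · rw [← eval_map_of_aeval, ← eval_map_of_aeval]
  push Not at hst
  obtain ⟨q, hqE, hq0, hq⟩ := hst
  have hex : ∃ d : ℕ, ∃ f : K[X], f.natDegree = d ∧ (∀ n, f.coeff n ∈ E) ∧ f.Monic ∧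
      ∀ a ∈ E, ¬ Stab W f z (W (a - z)) := by
    have hl : q.leadingCoeff ≠ 0 := leadingCoeff_ne_zero.2 hq0
    refine ⟨_, C q.leadingCoeff⁻¹ * q, rfl, fun n => ?_, ?_, fun a ha h => hq a ha ?_⟩
    · rw [coeff_C_mul]
      exact E.mul_mem (E.inv_mem (hqE _)) (hqE n)
    · rw [Monic, leadingCoeff_mul, leadingCoeff_C, inv_mul_cancel₀ hl]
    · have := h.C_mul hl
      rwa [← mul_assoc, ← C_mul, mul_inv_cancel₀ hl, C_1, one_mul] at this
  classical
  obtain ⟨f, hfd, hfE, hf, hfun⟩ := Nat.find_spec hex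
  have hmin : ∀ q : K[X], (∀ n, q.coeff n ∈ E) → q ≠ 0 → q.natDegree < f.natDegree →
      ∃ a ∈ E, Stab W q z (W (a - z)) := by
    intro q hqE hq0 hqd
    have hl : q.leadingCoeff ≠ 0 := leadingCoeff_ne_zero.2 hq0
    have := Nat.find_min hex (m := q.natDegree) (hfd ▸ hqd)
    by_contra! hcon
    refine this ⟨C q.leadingCoeff⁻¹ * q, ?_, fun n => ?_, ?_, fun a ha h => hcon a ha ?_⟩
    · exact natDegree_C_mul (inv_ne_zero hl)
    · rw [coeff_C_mul]
      exact E.mul_mem (E.inv_mem (hqE _)) (hqE n)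
    · rw [Monic, leadingCoeff_mul, leadingCoeff_C, inv_mul_cancel₀ hl]
    · have := h.C_mul hl
      rwa [← mul_assoc, ← C_mul, mul_inv_cancel₀ hl, C_1, one_mul] at this
  have hchar : CharZero K := charZero_of_inj_zero fun n hn => by
    by_contra hne
    have := hW (n - 1)
    rw [Nat.sub_add_cancel (by omega), hn, map_zero] at this
    exact zero_ne_one this
  have hfdeg : f.natDegree ≠ 0 := by
    intro h
    rw [hf.natDegree_eq_zero] at h
    refine hfun 0 E.zero_mem fun i => ?_
    rw [h, taylor_one, coeff_C]
    simp
  have hf'' : f.derivative.natDegree < f.natDegree := natDegree_derivative_lt hfdeg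
  have hf'0 : f.derivative ≠ 0 := by
    intro h
    exact hfdeg (natDegree_eq_zero_of_derivative_eq_zero h)
  have hf'E : ∀ n, f.derivative.coeff n ∈ E := by
    intro n
    rw [coeff_derivative]
    refine E.mul_mem (hfE _) ?_
    exact_mod_cast natCast_mem E (n + 1)
  obtain ⟨a₀, ha₀, hst⟩ := hmin _ hf'E hf'0 hf''
  set γ₀ := W (a₀ - z) with hγ₀
  set t : ℕ → K := fun n => (taylor z f).coeff n with ht
  have ht' : ∀ n, W ((taylor z f.derivative).coeff n) = W (t (n + 1)) := by
    intro n
    have : taylor z f.derivative = (taylor z f).derivative := by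
      simp [taylor_apply, derivative_comp]
    rw [this, coeff_derivative, map_mul, ← Nat.cast_succ, hW, mul_one]
  have ht1 : W (f.derivative.eval z) = W (t 1) := by
    rw [← ht' 0, taylor_coeff_zero]
  have hst' : ∀ γ ≤ γ₀, ∀ i, W (t (i + 2)) * γ ^ (i + 1) < W (t 1) := by
    intro γ hγ i
    have := hst.mono hγ i
    rwa [ht', ht1] at this
  have ht10 : W (t 1) ≠ 0 := by rw [← ht1]; exact hst.ne_zero
  have hle₀ : ∀ a ∈ E, W (t 0) ≤ W (t 1) * W (a - z) := by
    have key : ∀ a ∈ E, W (a - z) ≤ γ₀ → W (t 0) ≤ W (t 1) * W (a - z) := by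
      intro a ha hle
      have := hfun a ha
      simp only [Stab, not_forall, not_lt] at this
      obtain ⟨i, hi⟩ := this
      have e0 : t 0 = f.eval z := by simp [t, taylor_coeff_zero]
      rw [e0]
      refine hi.trans ?_
      rcases i with _ | i
      · simp [t]
      · rw [pow_succ, ← mul_assoc]
        gcongr
        exact (hst' _ hle i).le
    intro a ha
    rcases le_total (W (a - z)) γ₀ with h | h
    · exact key a ha h
    · exact (key a₀ ha₀ le_rfl).trans (by gcongr)
  have hlt₀ : ∀ a ∈ E, W (t 0) < W (t 1) * W (a - z) := by
    intro a ha
    obtain ⟨a₂, ha₂, h⟩ := hnomin z hz a ha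
    refine (hle₀ a₂ ha₂).trans_lt ?_
    exact mul_lt_mul_of_pos_left h (zero_lt_iff.2 ht10)
  set d := a₀ - z with hd
  have hd0 : d ≠ 0 := by
    rw [← Valuation.ne_zero_iff W]
    exact hpos z hz a₀ ha₀
  have ht1' : t 1 ≠ 0 := (Valuation.ne_zero_iff W).1 ht10
  set g : K[X] := C (t 1 * d)⁻¹ * (taylor z f).comp (C d * X) with hg
  have hgc : ∀ n, g.coeff n = t n * d ^ n / (t 1 * d) := by
    intro n
    rw [hg, coeff_C_mul, comp_C_mul_X_coeff]
    show (t 1 * d)⁻¹ * (t n * d ^ n) = _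
    rw [div_eq_inv_mul]
  have hWd : 0 < W (t 1) * W d := by
    rw [← map_mul, zero_lt_iff, Valuation.ne_zero_iff]
    exact mul_ne_zero ht1' hd0
  have hg1 : g.coeff 1 = 1 := by
    rw [hgc, pow_one, div_self (mul_ne_zero ht1' hd0)]
  have hg0 : W (g.coeff 0) < 1 := by
    rw [hgc, pow_zero, mul_one, map_div₀, map_mul, div_lt_one₀ hWd]
    exact hlt₀ a₀ ha₀
  have hgle : ∀ n, W (g.coeff n) ≤ 1 := by
    rintro (_ | _ | n)
    · exact hg0.le
    · rw [hg1, map_one]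
    · rw [hgc, map_div₀, map_mul, map_mul, map_pow, div_le_one₀ hWd, pow_succ, ← mul_assoc]
      gcongr
      exact (hst' _ le_rfl n).le
  obtain ⟨c, hc, hc1⟩ := hWH g hgle hg0 hg1
  have hWc := valuation_root_eq hgle hg1 hc1 hc
  set b := z + d * c with hb
  have hfb : f.eval b = 0 := by
    rw [hg, eval_mul, eval_C, eval_comp] at hc
    have h0 := (mul_eq_zero.1 hc).resolve_left (inv_ne_zero (mul_ne_zero ht1' hd0))
    rw [taylor_eval] at h0
    rw [hb, add_comm]
    simpa using h0
  have hbz : ∀ a ∈ E, W (b - z) < W (a - z) := by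
    intro a ha
    have e1 : b - z = d * c := by rw [hb]; ring
    rw [e1, map_mul, hWc, hgc, pow_zero, mul_one, map_div₀, map_mul]
    have h1 := hlt₀ a ha
    have h2 : W d ≠ 0 := (Valuation.ne_zero_iff W).2 hd0
    have h3 : W d * (W (t 0) / (W (t 1) * W d)) = W (t 0) / W (t 1) := by
      field_simp
    rw [h3, div_lt_iff₀ (zero_lt_iff.2 ht10), mul_comm]
    exact h1
  have hbE : b ∉ E := fun h => lt_irrefl _ (hbz b h)
  have hab : ∀ a ∈ E, W (a - b) = W (a - z) := by
    intro a ha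
    have : a - b = (a - z) - (b - z) := by ring
    rw [this, Valuation.map_sub_eq_of_lt_left _ (hbz a ha)]
  refine ⟨_, hlt b hbE, specializes_of_algebraic hv hW hE hbE (hlt b hbE).le (hbmem b) hfE hf hfb
    hf'0 hf'' ?_ (hnomin b hbE) ?_⟩
  · intro x hx
    obtain ⟨f₀, hf₀⟩ := exists_map_eq (algebraMap E K) f fun n => ⟨⟨_, hfE n⟩, rfl⟩
    have hf₀m : f₀.Monic := by
      rw [← hf₀] at hf
      exact monic_of_injective (algebraMap E K).injective hf
    have hb0 : aeval b f₀ = 0 := by rw [eval_map_of_aeval, hf₀, hfb]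
    have hbint : IsIntegral E b := ⟨f₀, hf₀m, hb0⟩
    rw [IntermediateField.mem_restrictScalars, ← IntermediateField.mem_toSubalgebra,
      IntermediateField.adjoin_simple_toSubalgebra_of_isAlgebraic hbint.isAlgebraic,
      Algebra.adjoin_singleton_eq_range_aeval] at hx
    obtain ⟨r, rfl⟩ := hx
    refine ⟨(r %ₘ f₀).map (algebraMap E K), hcoeff _, ?_, ?_⟩
    · rw [natDegree_map, ← hf₀, natDegree_map]
      refine natDegree_modByMonic_lt _ hf₀m ?_
      rintro rfl
      rw [Polynomial.map_one] at hf₀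
      rw [← hf₀] at hfdeg
      simp at hfdeg
    · rw [← eval_map_of_aeval]
      show aeval b r = _
      conv_lhs => rw [← modByMonic_add_div r f₀]
      simp [hb0]
  · intro q hqE hq0 hqd
    obtain ⟨a, ha, h⟩ := hmin q hqE hq0 hqd
    refine ⟨a, ha, ?_⟩
    rw [hab a ha]
    exact h.move (hpos z hz a ha) (hbz a ha).le

theorem specializes_top {W : Valuation K Γ} {v : Valuation F Γ₀}
    (hv : HenselProp v) (hWH : HenselProp₀ W) (hW : ∀ n : ℕ, W ((n + 1 : ℕ) : K) = 1)
    {π : F} (hπ0 : π ≠ 0) (hπ1 : v π < 1) (harch : ∀ c : F, ∃ M : ℕ, v c * v π ^ M < 1)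
    (hres : ∀ x : K, W x ≤ 1 → ∃ a : F, W (x - algebraMap F K a) < 1)
    (hF : ∀ a : F, a ≠ 0 → W (algebraMap F K a) = 1) : Specializes W v ⊤ := by
  obtain ⟨T, hT1, hT2⟩ := exists_monomial_group hWH.henselProp hW hres hF
  have h0 := specializes_monomial hπ0 hπ1 harch hF hT2
  set E₀ := IntermediateField.adjoin F ((fun τ : Kˣ => (τ : K)) '' (T : Set Kˣ))
  obtain ⟨E, hle, hE⟩ := zorn_le_nonempty₀ {E : IntermediateField F K | Specializes W v E} (by
    intro c hc hchain E₁ hE₁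
    refine ⟨sSup c, ?_, fun E hE => le_sSup hE⟩
    have hdir : DirectedOn (· ≤ ·) c := hchain.directedOn
    have hne : c.Nonempty := ⟨E₁, hE₁⟩
    have := hne.to_subtype
    have hmem : ∀ x, x ∈ sSup c → ∃ E ∈ c, x ∈ E := by
      intro x hx
      rw [sSup_eq_iSup'] at hx
      have h2 : x ∈ ((⨆ a : c, (a : IntermediateField F K) : IntermediateField F K) : Set K) := hx
      rw [IntermediateField.coe_iSup_of_directed (directedOn_iff_directed.1 hdir),
        Set.mem_iUnion] at h2
      obtain ⟨⟨E, hE⟩, h2⟩ := h2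
      exact ⟨E, hE, h2⟩
    intro S hS hSE
    have : ∃ E ∈ c, S ⊆ (E : Set K) := by
      have h3 : S ⊆ ⋃ E : c, ((E : IntermediateField F K) : Set K) := by
        intro x hx
        obtain ⟨E, hE, h⟩ := hmem x (hSE hx)
        exact Set.mem_iUnion.2 ⟨⟨E, hE⟩, h⟩
      obtain ⟨⟨E, hE⟩, h⟩ := (directedOn_iff_directed.1 hdir).exists_mem_subset_of_finset_subset_biUnion
        (s := hS.toFinset) (by simpa using h3)
      exact ⟨E, hE, by simpa using h⟩
    obtain ⟨E, hE, hS'⟩ := this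
    obtain ⟨G, hG, h1, h2⟩ := hc hE S hS hS'
    exact ⟨G, hG, fun g => (le_sSup hE : E ≤ sSup c) (h1 g), h2⟩) E₀ h0
  suffices h : E = ⊤ from h ▸ hE.prop
  by_contra hne
  obtain ⟨z, hz⟩ : ∃ z, z ∉ E := by
    by_contra! h
    exact hne (eq_top_iff.2 fun x _ => h x)
  obtain ⟨E', hE', hs⟩ := exists_specializes_extension hv hWH hW hE.prop (fun y hy => by
    obtain ⟨τ, hτ, h⟩ := hT1 (Units.mk0 y hy)
    exact ⟨τ, hle (IntermediateField.subset_adjoin F _ ⟨τ, hτ, rfl⟩), h⟩) hz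
  exact hE'.not_ge (hE.le_of_ge hs hE'.le)

end Extend

section Coarsening

variable {K : Type*} [Field K] {Γ : Type*} [LinearOrderedCommGroupWithZero Γ]

theorem IsUniformizer.ne_zero {v : Valuation K Γ} {π : K} (h : IsUniformizer v π) : π ≠ 0 :=
  (Valuation.ne_zero_iff v).1 h.1.ne'

/-- The valuation ring of the finest proper coarsening of `v` trivialising `π`. -/
def coarseRing (v : Valuation K Γ) {π : K} (hπ0 : π ≠ 0) (hπ1 : v π < 1) : ValuationSubring K where
  carrier := {x | ∃ n : ℕ, v x * v π ^ n ≤ 1}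
  zero_mem' := ⟨0, by simp⟩
  one_mem' := ⟨0, by simp⟩
  neg_mem' := by
    rintro x ⟨n, hn⟩
    exact ⟨n, by rwa [v.map_neg]⟩
  add_mem' := by
    rintro x y ⟨n, hn⟩ ⟨m, hm⟩
    refine ⟨n + m, ?_⟩
    have h1 : v π ^ n ≤ 1 := pow_le_one' hπ1.le n
    have h2 : v π ^ m ≤ 1 := pow_le_one' hπ1.le m
    rw [← map_pow, ← map_mul, add_mul]
    refine v.map_add_le ?_ ?_
    · rw [map_mul, map_pow, pow_add, ← mul_assoc]
      exact mul_le_one' hn h2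
    · rw [map_mul, map_pow, add_comm, pow_add, ← mul_assoc]
      exact mul_le_one' hm h1
  mul_mem' := by
    rintro x y ⟨n, hn⟩ ⟨m, hm⟩
    refine ⟨n + m, ?_⟩
    rw [map_mul, pow_add, mul_mul_mul_comm]
    exact mul_le_one' hn hm
  mem_or_inv_mem' := by
    intro x
    rcases le_total (v x) 1 with h | h
    · exact Or.inl ⟨0, by simpa using h⟩
    · refine Or.inr ⟨0, ?_⟩
      rw [pow_zero, mul_one, map_inv₀]
      exact inv_le_one_of_one_le₀ h

theorem mem_coarseRing {v : Valuation K Γ} {π : K} {hπ0 : π ≠ 0} {hπ1 : v π < 1} {x : K} :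
    x ∈ coarseRing v hπ0 hπ1 ↔ ∃ n : ℕ, v x * v π ^ n ≤ 1 := Iff.rfl

theorem coarseRing_lt_one_iff {v : Valuation K Γ} {π : K} {hπ0 : π ≠ 0} {hπ1 : v π < 1} {x : K} :
    (coarseRing v hπ0 hπ1).valuation x < 1 ↔ ∀ n : ℕ, v x < v π ^ n := by
  have hpos : ∀ n : ℕ, 0 < v π ^ n := fun n => by
    rw [← map_pow, zero_lt_iff, Valuation.ne_zero_iff]
    exact pow_ne_zero n hπ0
  rcases eq_or_ne x 0 with rfl | hx
  · simp only [map_zero, zero_lt_one, true_iff]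
    exact hpos
  have hx' : 0 < v x := by rwa [zero_lt_iff, Valuation.ne_zero_iff]
  rw [← not_le, ← inv_le_one₀ (by rwa [zero_lt_iff, Valuation.ne_zero_iff]), ← map_inv₀,
    ValuationSubring.valuation_le_one_iff, mem_coarseRing]
  push Not
  refine forall_congr' fun n => ?_
  rw [map_inv₀, mul_comm, ← div_eq_mul_inv, one_lt_div₀ hx']

theorem HenselProp₀.coarse {v : Valuation K Γ} (H : HenselProp₀ v) {π : K} (hπ0 : π ≠ 0)
    (hπ1 : v π < 1) : HenselProp₀ (coarseRing v hπ0 hπ1).valuation := by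
  intro f hf h0 h1
  have hpos : ∀ n : ℕ, 0 < v π ^ n := fun n => by
    rw [← map_pow, zero_lt_iff, Valuation.ne_zero_iff]
    exact pow_ne_zero n hπ0
  rw [coarseRing_lt_one_iff] at h0
  simp only [ValuationSubring.valuation_le_one_iff, mem_coarseRing] at hf
  choose j hj using hf
  set N := f.support.sup j with hN
  have hN' : ∀ n, v (f.coeff n) * v π ^ N ≤ 1 := by
    intro n
    by_cases hn : n ∈ f.support
    · refine le_trans ?_ (hj n)
      gcongr 1
      exact pow_le_pow_right_of_le_one' hπ1.le (Finset.le_sup hn)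
    · rw [notMem_support_iff.1 hn]
      simp
  have hπN : π ^ N ≠ 0 := pow_ne_zero _ hπ0
  set g : K[X] := C (π ^ N)⁻¹ * f.comp (C (π ^ N) * X) with hg
  have hgc : ∀ n, g.coeff n = (π ^ N)⁻¹ * (f.coeff n * (π ^ N) ^ n) := by
    intro n
    rw [hg, coeff_C_mul, comp_C_mul_X_coeff]
  have hg0 : g.coeff 0 = (π ^ N)⁻¹ * f.coeff 0 := by rw [hgc, pow_zero, mul_one]
  have hg1 : g.coeff 1 = 1 := by
    rw [hgc, pow_one, h1, one_mul, inv_mul_cancel₀ hπN]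
  have hg0' : v (g.coeff 0) < 1 := by
    rw [hg0, map_mul, map_inv₀, map_pow, inv_mul_eq_div, div_lt_one₀ (hpos N)]
    exact h0 N
  have hgle : ∀ n, v (g.coeff n) ≤ 1 := by
    rintro (_ | _ | n)
    · exact hg0'.le
    · rw [hg1, map_one]
    · have : g.coeff (n + 2) = f.coeff (n + 2) * π ^ N * (π ^ N) ^ n := by
        rw [hgc]
        field_simp
        ring
      rw [this, map_mul, map_mul, map_pow, map_pow, map_pow]
      exact mul_le_one' (hN' _) (pow_le_one' (pow_le_one' hπ1.le _) _)
  obtain ⟨y, hy, hy1⟩ := H g hgle hg0' hg1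
  have hvy := valuation_root_eq hgle hg1 hy1 hy
  refine ⟨π ^ N * y, ?_, ?_⟩
  · rw [hg, eval_mul, eval_C, eval_comp] at hy
    simpa using (mul_eq_zero.1 hy).resolve_left (inv_ne_zero hπN)
  · rw [coarseRing_lt_one_iff]
    rw [map_mul, hvy, hg0, ← map_mul, mul_inv_cancel_left₀ hπN]
    exact h0

theorem IsUniformizer.exists_zpow {v : Valuation K Γ} {π : K} (h : IsUniformizer v π) :
    ∀ (n : ℕ) (x : K), v π ^ n ≤ v x → v x ≤ 1 → ∃ m : ℕ, v x = v π ^ m := by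
  intro n
  induction n with
  | zero =>
    intro x h1 h2
    exact ⟨0, le_antisymm (by simpa using h2) (by simpa using h1)⟩
  | succ n ih =>
    intro x h1 h2
    rcases h2.eq_or_lt with h2 | h2
    · exact ⟨0, by simpa using h2⟩
    have h3 := h.2.2 x h2
    obtain ⟨m, hm⟩ := ih (x / π) (by rwa [map_div₀, le_div_iff₀ h.1, ← pow_succ])
      (by rwa [map_div₀, div_le_one₀ h.1])
    refine ⟨m + 1, ?_⟩
    rw [pow_succ, ← hm, map_div₀, div_mul_cancel₀ _ h.1.ne']

end Coarsening

section CoefficientField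

variable {C' K : Type*} [Field C'] [Field K] [Algebra C' K]

/-- A subfield maximal among those contained in a henselian valuation ring of residue
characteristic zero represents all residues and is relatively algebraically closed. -/
theorem exists_coefficient_field (A : ValuationSubring K) (hA : ∀ c : C', algebraMap C' K c ∈ A)
    (hH : HenselProp A.valuation) [CharZero K] :
    ∃ F : IntermediateField C' K, (∀ x ∈ F, x ∈ A) ∧
      (∀ x ∈ A, ∃ a ∈ F, A.valuation (x - a) < 1) ∧
      ∀ b ∈ A, IsIntegral F b → b ∈ F := by
  obtain ⟨F, -, hF⟩ := zorn_le_nonempty₀ {F : IntermediateField C' K | ∀ x ∈ F, x ∈ A} (by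
    intro c hc hchain E₁ hE₁
    refine ⟨sSup c, ?_, fun E hE => le_sSup hE⟩
    have hne : c.Nonempty := ⟨E₁, hE₁⟩
    have := hne.to_subtype
    intro x hx
    rw [sSup_eq_iSup'] at hx
    have h2 : x ∈ ((⨆ a : c, (a : IntermediateField C' K) : IntermediateField C' K) : Set K) := hx
    rw [IntermediateField.coe_iSup_of_directed (directedOn_iff_directed.1 hchain.directedOn),
      Set.mem_iUnion] at h2
    obtain ⟨⟨E, hE⟩, h2⟩ := h2
    exact hc hE x h2) ⊥ (by
    intro x hx
    obtain ⟨c, rfl⟩ := IntermediateField.mem_bot.1 hx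
    exact hA c)
  have hmax : ∀ b : K, (∀ x ∈ IntermediateField.adjoin F {b}, x ∈ A) → b ∈ F := by
    intro b hb
    have hle : F ≤ (IntermediateField.adjoin F {b}).restrictScalars C' := by
      intro x hx
      rw [IntermediateField.mem_restrictScalars]
      exact (IntermediateField.adjoin F {b}).algebraMap_mem ⟨x, hx⟩
    refine hF.le_of_ge (y := (IntermediateField.adjoin F {b}).restrictScalars C') hb hle ?_
    rw [IntermediateField.mem_restrictScalars]
    exact IntermediateField.mem_adjoin_simple_self F b
  have hFA : ∀ x ∈ F, x ∈ A := hF.prop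
  have hF1 : ∀ x ∈ F, x ≠ 0 → A.valuation x = 1 := by
    intro x hx hx0
    refine le_antisymm ((A.valuation_le_one_iff x).2 (hFA x hx)) ?_
    have := (A.valuation_le_one_iff _).2 (hFA _ (F.inv_mem hx))
    rwa [map_inv₀, inv_le_one₀ (by rwa [zero_lt_iff, Valuation.ne_zero_iff])] at this
  have haeval : ∀ b ∈ A, ∀ r : F[X], aeval b r ∈ A := by
    intro b hb r
    rw [aeval_eq_sum_range]
    refine sum_mem fun i _ => ?_
    rw [Algebra.smul_def]
    exact mul_mem (hFA _ (r.coeff i).2) (pow_mem hb i)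
  have halg : ∀ b ∈ A, IsIntegral F b → b ∈ F := by
    intro b hb hbint
    refine hmax b fun x hx => ?_
    rw [← IntermediateField.mem_toSubalgebra,
      IntermediateField.adjoin_simple_toSubalgebra_of_isAlgebraic hbint.isAlgebraic,
      Algebra.adjoin_singleton_eq_range_aeval] at hx
    obtain ⟨r, rfl⟩ := hx
    exact haeval b hb r
  refine ⟨F, hFA, ?_, halg⟩
  intro x hx
  by_cases hq : ∃ d : ℕ, ∃ q : F[X], q.natDegree = d ∧ q ≠ 0 ∧ A.valuation (aeval x q) < 1
  · classical
    obtain ⟨q, hqd, hq0, hq1⟩ := Nat.find_spec hq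
    have hqdeg : q.natDegree ≠ 0 := by
      intro h
      obtain ⟨c, rfl⟩ := natDegree_eq_zero.1 h
      rw [aeval_C] at hq1
      have hc : c ≠ 0 := by
        rintro rfl
        simp at hq0
      refine hq1.ne (hF1 _ c.2 ?_)
      simpa using hc
    have hq'0 : q.derivative ≠ 0 := fun h => hqdeg (natDegree_eq_zero_of_derivative_eq_zero h)
    have hq'1 : A.valuation (aeval x q.derivative) = 1 := by
      refine le_antisymm ((A.valuation_le_one_iff _).2 (haeval x hx _)) ?_
      have := Nat.find_min hq (m := q.derivative.natDegree) (hqd ▸ natDegree_derivative_lt hqdeg)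
      by_contra! hlt
      exact this ⟨_, rfl, hq'0, hlt⟩
    obtain ⟨b, hb, hbx⟩ := hH (q.map (algebraMap F K)) x (fun i => by
      rw [coeff_map]
      exact (A.valuation_le_one_iff _).2 (hFA _ (q.coeff i).2)) ((A.valuation_le_one_iff x).2 hx)
      (by rwa [← eval_map_of_aeval]) (by
        rw [derivative_map, ← eval_map_of_aeval, hq'1])
    rw [← eval_map_of_aeval] at hb
    refine ⟨b, halg b ?_ (IsAlgebraic.isIntegral ⟨q, hq0, hb⟩), ?_⟩
    · have : b = (b - x) + x := by ring
      rw [this]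
      exact add_mem ((A.valuation_le_one_iff _).1 hbx.le) hx
    · rwa [Valuation.map_sub_swap]
  · push Not at hq
    refine ⟨x, hmax x fun y hy => ?_, by simp⟩
    obtain ⟨r, s, rfl⟩ := (IntermediateField.mem_adjoin_simple_iff F y).1 hy
    rcases eq_or_ne s 0 with rfl | hs
    · simp
    · rw [← A.valuation_le_one_iff, map_div₀]
      refine div_le_one_of_le₀ ?_ zero_le
      exact ((A.valuation_le_one_iff _).2 (haeval x hx r)).trans (hq _ s rfl hs)

end CoefficientField

section SignSpec

/-- `S ⊆ K` can be specialised over `C` to `M` compatibly with vanishing and with integrality. -/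
def SignSpec (C : Type*) {K M : Type*} [Field C] [Field K] [Field M] [Algebra C K] [Algebra C M]
    {Γ Γ' : Type*} [LinearOrderedCommGroupWithZero Γ] [LinearOrderedCommGroupWithZero Γ']
    (v : Valuation K Γ) (w : Valuation M Γ') (S : Set K) : Prop :=
  ∃ G : Subalgebra C (K × M), IsGraph G ∧ ∀ s ∈ S, ∃ s' : M, (s, s') ∈ G ∧
    (s' = 0 → s = 0) ∧ (v s ≤ 1 ↔ w s' ≤ 1)

variable {C K : Type*} [Field C] [Field K] [Algebra C K] {Γ : Type*}
  [LinearOrderedCommGroupWithZero Γ]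

theorem signSpec_of_specializes {F : IntermediateField C K} {W : Valuation K Γ}
    {Γ' : Type*} [LinearOrderedCommGroupWithZero Γ'] {v : Valuation K Γ'}
    (hWv : ∀ x, W x < 1 → v x < 1) (h : Specializes W (v.comap (algebraMap F K)) ⊤)
    (hres : ∀ x : K, W x ≤ 1 → ∃ a : F, W (x - algebraMap F K a) < 1) (S : Set K)
    (hS : S.Finite) : SignSpec C v (v.comap (algebraMap F K)) S := by
  choose! a ha using hres
  obtain ⟨G, hG, -, hGS, hlt⟩ := h (S ∪ (fun s => s⁻¹) '' S ∪
    (fun s => (s - algebraMap F K (a s)) / algebraMap F K (a s)) '' S)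
    ((hS.union (hS.image _)).union (hS.image _)) (fun _ _ => IntermediateField.mem_top)
  refine ⟨G.restrictScalars C, hG, fun s hs => ?_⟩
  obtain ⟨g, hg⟩ := hGS s (Or.inl (Or.inl hs))
  obtain ⟨g₁, hg₁⟩ := hGS s⁻¹ (Or.inl (Or.inr ⟨s, hs, rfl⟩))
  have hinv : s ≠ 0 → gSnd G g₁ * gSnd G g = 1 := by
    intro hs0
    rw [← map_mul, ← map_one (gSnd G)]
    congr 1
    apply hG.injective
    rw [map_mul, map_one, hg, hg₁, inv_mul_cancel₀ hs0]
  refine ⟨gSnd G g, ?_, ?_, ?_⟩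
  · have : (s, gSnd G g) = (g : K × F) := by rw [← hg]; rfl
    rw [this]
    exact g.2
  · intro h0
    by_contra hs0
    have := hinv hs0
    rw [h0] at this
    simp at this
  · rcases lt_trichotomy (W s) 1 with h1 | h1 | h1
    · have h2 := hlt g (by rw [hg]; exact Or.inl (Or.inl hs)) (by rwa [hg])
      exact iff_of_true (hWv s h1).le h2.le
    · obtain ⟨g₂, hg₂⟩ := hGS _ (Or.inr ⟨s, hs, rfl⟩)
      have h3 := ha s h1.le
      have h4 : W (algebraMap F K (a s)) = 1 := by
        rw [← h1]
        exact (Valuation.map_eq_of_sub_lt W (by rw [Valuation.map_sub_swap, h1]; exact h3))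
      have ha0 : algebraMap F K (a s) ≠ 0 := by
        rw [← Valuation.ne_zero_iff W, h4]
        exact one_ne_zero
      have h5 : W ((s - algebraMap F K (a s)) / algebraMap F K (a s)) < 1 := by
        rwa [map_div₀, h4, div_one]
      have h6 := hlt g₂ (by rw [hg₂]; exact Or.inr ⟨s, hs, rfl⟩) (by rwa [hg₂])
      have h7 : gSnd G g = a s * (1 + gSnd G g₂) := by
        have : gSnd G (algebraMap F G (a s)) = a s := (gSnd G).commutes (a s)
        rw [← this, ← map_one (gSnd G), ← map_add, ← map_mul]
        congr 1
        apply hG.injective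
        rw [map_mul, map_add, map_one, AlgHom.commutes, hg, hg₂]
        field_simp
        ring
      have h8 : s = algebraMap F K (a s) *
          (1 + (s - algebraMap F K (a s)) / algebraMap F K (a s)) := by
        field_simp
        ring
      rw [h7, map_mul, Valuation.map_one_add_of_lt _ h6, mul_one, h8, map_mul,
        Valuation.map_one_add_of_lt _ (hWv _ h5), mul_one, ← h8]
      rfl
    · have hs0 : s ≠ 0 := by
        rintro rfl
        simp at h1
      have h2 : W s⁻¹ < 1 := by
        rw [map_inv₀]
        exact inv_lt_one_of_one_lt₀ h1
      have h3 := hlt g₁ (by rw [hg₁]; exact Or.inl (Or.inr ⟨s, hs, rfl⟩)) (by rwa [hg₁])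
      have h4 := hWv _ h2
      refine iff_of_false ?_ ?_
      · intro h5
        rw [map_inv₀] at h4
        exact absurd h4 (not_lt.2 ((one_le_inv₀ (by
          rwa [zero_lt_iff, Valuation.ne_zero_iff])).2 h5))
      · intro h5
        have := congrArg (v.comap (algebraMap F K)) (hinv hs0)
        rw [map_mul, map_one] at this
        refine this.not_lt ?_
        calc _ ≤ (v.comap (algebraMap F K)) (gSnd G g₁) * 1 := by gcongr
          _ < 1 := by rwa [mul_one]

/-- Transfer from a henselian valued field with uniformizer `π` to a `ℤ`-valued subfield. -/
theorem exists_discrete_subfield [CharZero K] (v : Valuation K Γ) (hH : HenselProp₀ v) (π : C)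
    (hπ : IsUniformizer v (algebraMap C K π))
    (harch : ∀ c : C, ∃ n : ℕ, v (algebraMap C K c) * v (algebraMap C K π) ^ n ≤ 1) :
    ∃ F : IntermediateField C K,
      (∀ x ∈ F, x ≠ 0 → ∃ m : ℤ, v x = v (algebraMap C K π) ^ m) ∧
      ∀ S : Set K, S.Finite → SignSpec C v (v.comap (algebraMap F K)) S := by
  set A := coarseRing v hπ.ne_zero hπ.2.1 with hA
  have hWH : HenselProp₀ A.valuation := hH.coarse hπ.ne_zero hπ.2.1
  obtain ⟨F, hFA, hFres, hFalg⟩ := exists_coefficient_field A harch hWH.henselProp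
  have hF1 : ∀ x ∈ F, x ≠ 0 → A.valuation x = 1 := by
    intro x hx hx0
    refine le_antisymm ((A.valuation_le_one_iff x).2 (hFA x hx)) ?_
    have := (A.valuation_le_one_iff _).2 (hFA _ (F.inv_mem hx))
    rwa [map_inv₀, inv_le_one₀ (by rwa [zero_lt_iff, Valuation.ne_zero_iff])] at this
  have hFge : ∀ x ∈ F, x ≠ 0 → ∃ n : ℕ, v (algebraMap C K π) ^ n ≤ v x := by
    intro x hx hx0
    by_contra! hcon
    exact (coarseRing_lt_one_iff.2 hcon).ne (hF1 x hx hx0)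
  have hWv : ∀ x, A.valuation x < 1 → v x < 1 := by
    intro x hx
    simpa using coarseRing_lt_one_iff.1 hx 0
  have hFZ : ∀ x ∈ F, x ≠ 0 → v x ≤ 1 → ∃ m : ℕ, v x = v (algebraMap C K π) ^ m := by
    intro x hx hx0 hx1
    obtain ⟨n, hn⟩ := hFge x hx hx0
    exact hπ.exists_zpow n x hn hx1
  refine ⟨F, ?_, fun S hS => ?_⟩
  · intro x hx hx0
    rcases le_total (v x) 1 with h | h
    · obtain ⟨m, hm⟩ := hFZ x hx hx0 h
      exact ⟨m, by simpa using hm⟩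
    · obtain ⟨m, hm⟩ := hFZ x⁻¹ (F.inv_mem hx) (inv_ne_zero hx0) (by
        rw [map_inv₀]
        exact inv_le_one_of_one_le₀ h)
      refine ⟨-m, ?_⟩
      rw [zpow_neg, zpow_natCast, ← hm, map_inv₀, inv_inv]
  have hres : ∀ x : K, A.valuation x ≤ 1 →
      ∃ a : F, A.valuation (x - algebraMap F K a) < 1 := by
    intro x hx
    obtain ⟨a, ha, h⟩ := hFres x ((A.valuation_le_one_iff x).1 hx)
    exact ⟨⟨a, ha⟩, h⟩
  refine signSpec_of_specializes hWv ?_ hres S hS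
  have hvF : HenselProp₀ (v.comap (algebraMap F K)) := by
    intro f hf h0 h1
    obtain ⟨b, hb, hb1⟩ := hH (f.map (algebraMap F K)) (fun i => by
      rw [coeff_map]; exact hf i) (by rw [coeff_map]; exact h0) (by rw [coeff_map, h1, map_one])
    have hf0 : f ≠ 0 := by
      rintro rfl
      simp at h1
    have hbint : IsIntegral F b := IsAlgebraic.isIntegral ⟨f, hf0, by
      rwa [aeval_def, ← eval_map]⟩
    have hbF := hFalg b ⟨0, by simpa using hb1.le⟩ hbint
    refine ⟨⟨b, hbF⟩, ?_, hb1⟩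
    apply (algebraMap F K).injective
    rw [map_zero, ← hb, eval_map, ← eval₂_id, hom_eval₂]
    rfl
  refine specializes_top hvF.henselProp hWH ?_ (π := algebraMap C F π) ?_ ?_ ?_ hres ?_
  · intro n
    refine hF1 _ (natCast_mem F (n + 1)) ?_
    exact_mod_cast n.succ_ne_zero
  · intro h
    apply hπ.ne_zero
    rw [IsScalarTower.algebraMap_apply C F K, h, map_zero]
  · exact hπ.2.1
  · intro c
    obtain ⟨n, hn⟩ := hFA c c.2
    refine ⟨n + 1, ?_⟩
    have : v (algebraMap C K π) < 1 := hπ.2.1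
    change v c * v (algebraMap C K π) ^ (n + 1) < 1
    rw [pow_succ, ← mul_assoc]
    calc _ ≤ 1 * v (algebraMap C K π) := by gcongr
      _ < 1 := by rwa [one_mul]
  · intro a ha
    exact hF1 a a.2 (by simpa using ha)

end SignSpec

/-- The vanishing of `H₁` of the cotangent complex, spelled out for the tautological
presentation. -/
theorem subsingleton_h1Cotangent_iff {k A : Type*} [CommRing k] [CommRing A] [Algebra k A] :
    Subsingleton (Algebra.H1Cotangent k A) ↔
      ∀ y : MvPolynomial A k, MvPolynomial.aeval (id : A → A) y = 0 →
        (∀ i, MvPolynomial.aeval (id : A → A) (MvPolynomial.pderiv i y) = 0) →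
        y ∈ (RingHom.ker (MvPolynomial.aeval (id : A → A) : MvPolynomial A k →ₐ[k] A)) ^ 2 := by
  have : Algebra.FormallySmooth k (Algebra.Generators.self k A).toExtension.Ring :=
    Algebra.instFormallySmoothMvPolynomial A
  let G := Algebra.Generators.self k A
  rw [← Algebra.Extension.cotangentComplex_injective_iff G.toExtension,
    injective_iff_map_eq_zero]
  have hker : G.toExtension.ker =
    RingHom.ker (MvPolynomial.aeval (id : A → A) : MvPolynomial A k →ₐ[k] A) :=
    G.ker_eq_ker_aeval_val
  have hker2 : G.toExtension.ker ^ 2 =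
    (RingHom.ker (MvPolynomial.aeval (id : A → A) : MvPolynomial A k →ₐ[k] A)) ^ 2 :=
    congrArg (· ^ 2) hker
  have key : ∀ x : G.toExtension.ker, G.toExtension.cotangentComplex (.mk x) = 0 ↔
      ∀ i, MvPolynomial.aeval (id : A → A) (MvPolynomial.pderiv i (x.1 : MvPolynomial A k)) = 0 := by
    intro x
    rw [← G.cotangentSpaceBasis.repr.map_eq_zero_iff, Algebra.Extension.cotangentComplex_mk,
      Finsupp.ext_iff]
    refine forall_congr' fun i ↦ ?_
    exact (G.cotangentSpaceBasis_repr_one_tmul x.1 i).congr_left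
  constructor
  · intro h y hy hd
    have hy' : y ∈ G.toExtension.ker := hker.ge hy
    have := h (.mk ⟨y, hy'⟩) ((key _).2 hd)
    rw [Algebra.Extension.Cotangent.mk_eq_zero_iff] at this
    exact hker2.le this
  · intro h a ha
    obtain ⟨x, rfl⟩ := Algebra.Extension.Cotangent.mk_surjective a
    rw [Algebra.Extension.Cotangent.mk_eq_zero_iff]
    exact hker2.ge (h _ (hker.le x.2) ((key x).1 ha))

/-- A field extension is formally smooth if its finitely generated subextensions are. -/
theorem formallySmooth_of_forall_finite {k E : Type*} [Field k] [Field E] [Algebra k E]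
    (h : ∀ s : Finset E, Algebra.FormallySmooth k (IntermediateField.adjoin k (s : Set E))) :
    Algebra.FormallySmooth k E := by
  have : Subsingleton (Algebra.H1Cotangent k E) := by
    rw [subsingleton_h1Cotangent_iff]
    intro y hy hd
    let F := IntermediateField.adjoin k ((y.vars : Finset E) : Set E)
    have hF := (h y.vars).subsingleton_h1Cotangent
    rw [subsingleton_h1Cotangent_iff] at hF
    have hinj : Function.Injective (algebraMap F E) := (algebraMap F E).injective
    obtain ⟨y₀, hy₀⟩ := MvPolynomial.exists_rename_eq_of_vars_subset_range y (algebraMap F E)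
      hinj (fun e he ↦ ⟨⟨e, IntermediateField.subset_adjoin _ _ he⟩, rfl⟩)
    rw [← hy₀] at hy hd ⊢
    have hev : ∀ q : MvPolynomial F k, MvPolynomial.aeval (id : E → E)
        (MvPolynomial.rename (algebraMap F E) q) =
        algebraMap F E (MvPolynomial.aeval (id : F → F) q) := by
      intro q
      rw [MvPolynomial.aeval_rename]
      exact (MvPolynomial.aeval_algebraMap_apply E (id : F → F) q)
    have h2 := hF y₀ (hinj (by rw [← hev, hy, map_zero])) (fun i ↦ hinj (by
      rw [← hev, map_zero, ← hd (algebraMap F E i), MvPolynomial.pderiv_rename hinj]))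
    have h3 := Ideal.mem_map_of_mem (MvPolynomial.rename (algebraMap F E) :
      MvPolynomial F k →ₐ[k] MvPolynomial E k).toRingHom h2
    rw [Ideal.map_pow] at h3
    refine Ideal.pow_right_mono (Ideal.map_le_iff_le_comap.2 ?_) 2 h3
    intro q hq
    change MvPolynomial.aeval (id : E → E) (MvPolynomial.rename (algebraMap F E) q) = 0
    rw [hev, RingHom.mem_ker.1 hq, map_zero]
  exact { projective_kaehlerDifferential := inferInstance, subsingleton_h1Cotangent := this }

theorem HasSepTransBasis.formallySmooth {k E : Type*} [Field k] [Field E] [Algebra k E]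
    (h : HasSepTransBasis k E) : Algebra.FormallySmooth k E := by
  obtain ⟨s, hs, hsep⟩ := h
  have : Algebra.IsSeparable (IntermediateField.adjoin k (Set.range ((↑) : s → E))) E := by
    rw [Subtype.range_coe]; exact hsep
  exact .of_algebraicIndependent_of_isSeparable hs

theorem IsSepExt.formallySmooth {k E : Type*} [Field k] [Field E] [Algebra k E]
    (h : IsSepExt k E) : Algebra.FormallySmooth k E :=
  formallySmooth_of_forall_finite fun s ↦ (h s).formallySmooth

/-- Formal smoothness of a flat algebra lifts from the reduction modulo `I` to the reduction
modulo powers of `I`. -/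
theorem formallySmooth_quotient_pow {A B : Type*} [CommRing A] [CommRing B] [Algebra A B]
    [Module.Flat A B] (I : Ideal A)
    (h : Algebra.FormallySmooth (A ⧸ I) (B ⧸ I.map (algebraMap A B))) (N : ℕ) :
    Algebra.FormallySmooth (A ⧸ I ^ (N + 1)) (B ⧸ (I ^ (N + 1)).map (algebraMap A B)) := by
  induction N with
  | zero =>
    have e : I ^ (0 + 1) = I := by simp
    generalize I ^ (0 + 1) = J at e ⊢
    subst e
    exact h
  | succ N ih =>
    have hflat : Module.Flat (A ⧸ I ^ (N + 2)) (B ⧸ (I ^ (N + 2)).map (algebraMap A B)) :=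
      .of_linearEquiv
        (Algebra.TensorProduct.quotIdealMapEquivQuotTensor B (I ^ (N + 2))).toLinearEquiv
    have hle : I ^ (N + 2) ≤ I ^ (N + 1) := Ideal.pow_le_pow_right (by lia)
    have kerA : RingHom.ker (Ideal.Quotient.factor hle) =
        (I ^ (N + 1)).map (Ideal.Quotient.mk (I ^ (N + 2))) := Ideal.Quotient.factor_ker hle
    refine RingHom.formallySmooth_algebraMap.1
      (RingHom.FormallySmooth.of_flat_of_ker_eq_map_of_square_zero _
        (RingHom.flat_algebraMap_iff.2 hflat) (Ideal.Quotient.factor hle)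
        (Ideal.Quotient.factor (Ideal.map_mono hle)) _ (Ideal.Quotient.factor_surjective hle)
        (Ideal.Quotient.factor_surjective _) ?_ ?_ ?_ (RingHom.formallySmooth_algebraMap.2 ih))
    · ext a
      rfl
    · rw [kerA, ← Ideal.map_pow, ← pow_mul, eq_bot_iff, Ideal.map_le_iff_le_comap]
      intro a ha
      rw [Ideal.mem_comap, Ideal.mem_bot, Ideal.Quotient.eq_zero_iff_mem]
      exact Ideal.pow_le_pow_right (by lia) ha
    · rw [kerA, Ideal.map_map, Ideal.Quotient.factor_ker (Ideal.map_mono hle), Ideal.map_map]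
      rfl

theorem exists_lift_quotient_pow {A B P : Type*} [CommRing A] [CommRing B] [CommRing P]
    [Algebra A B] [Algebra A P] (I : Ideal A) (N : ℕ)
    (h : Algebra.FormallySmooth (A ⧸ I ^ (N + 1)) (B ⧸ (I ^ (N + 1)).map (algebraMap A B)))
    (f : B →ₐ[A] P ⧸ I.map (algebraMap A P)) :
    Nonempty (B →ₐ[A] P ⧸ (I ^ (N + 1)).map (algebraMap A P)) := by
  have hle : (I ^ (N + 1)).map (algebraMap A P) ≤ I.map (algebraMap A P) :=
    Ideal.map_mono (Ideal.pow_le_self (by lia))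
  let q : P ⧸ (I ^ (N + 1)).map (algebraMap A P) →+* P ⧸ I.map (algebraMap A P) :=
    Ideal.Quotient.factor hle
  have hf : ∀ b ∈ (I ^ (N + 1)).map (algebraMap A B), f b = 0 := by
    intro b hb
    suffices h : (I ^ (N + 1)).map (algebraMap A B) ≤ RingHom.ker (f : B →+* P ⧸ I.map (algebraMap A P)) from h hb
    rw [Ideal.map_le_iff_le_comap]
    intro a ha
    change f (algebraMap A B a) = 0
    rw [f.commutes]
    exact Ideal.Quotient.eq_zero_iff_mem.2
      (Ideal.mem_map_of_mem _ (Ideal.pow_le_self (by lia) ha))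
  letI : Algebra (A ⧸ I ^ (N + 1)) (P ⧸ I.map (algebraMap A P)) :=
    (q.comp (algebraMap (A ⧸ I ^ (N + 1)) (P ⧸ (I ^ (N + 1)).map (algebraMap A P)))).toAlgebra
  let q' : P ⧸ (I ^ (N + 1)).map (algebraMap A P) →ₐ[A ⧸ I ^ (N + 1)]
      P ⧸ I.map (algebraMap A P) := { q with commutes' := fun _ ↦ rfl }
  let f' : B ⧸ (I ^ (N + 1)).map (algebraMap A B) →ₐ[A ⧸ I ^ (N + 1)]
      P ⧸ I.map (algebraMap A P) :=
    { Ideal.Quotient.lift _ (f : B →+* P ⧸ I.map (algebraMap A P)) hf with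
      commutes' := by
        intro r
        obtain ⟨a, rfl⟩ := Ideal.Quotient.mk_surjective r
        exact f.commutes a }
  have hnil : IsNilpotent (RingHom.ker (q' : (P ⧸ (I ^ (N + 1)).map (algebraMap A P)) →+*
      P ⧸ I.map (algebraMap A P))) := by
    refine ⟨N + 1, ?_⟩
    change (RingHom.ker q) ^ (N + 1) = 0
    rw [Ideal.Quotient.factor_ker hle, ← Ideal.map_pow, ← Ideal.map_pow, Ideal.zero_eq_bot,
      eq_bot_iff, Ideal.map_le_iff_le_comap]
    intro a ha
    exact Ideal.Quotient.eq_zero_iff_mem.2 ha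
  let g := Algebra.FormallySmooth.liftOfSurjective f' q' (Ideal.Quotient.factor_surjective hle) hnil
  exact ⟨(g.restrictScalars A).comp (IsScalarTower.toAlgHom A B _)⟩

/-- If `B` can be mapped to `O` modulo `π` on arbitrary finite sets, then by formal smoothness
it can be mapped to `O` modulo any power of `π` on arbitrary finite sets. -/
theorem exists_approx_hom {A B O : Type*} [CommRing A] [CommRing B] [CommRing O]
    [Algebra A B] [Algebra A O] [Module.Flat A B] (π : A)
    (h : Algebra.FormallySmooth (A ⧸ Ideal.span {π})
      (B ⧸ (Ideal.span {π}).map (algebraMap A B)))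
    (hfin : ∀ T : Finset B, ∃ c : B → O,
      (∀ x ∈ T, ∀ y ∈ T, algebraMap A O π ∣ c (x + y) - (c x + c y) ∧
        algebraMap A O π ∣ c (x * y) - c x * c y) ∧
      ∀ a : A, algebraMap A B a ∈ T → algebraMap A O π ∣ c (algebraMap A B a) - algebraMap A O a)
    (N : ℕ) (Q : Finset (MvPolynomial B A))
    (hQ : ∀ q ∈ Q, MvPolynomial.aeval (id : B → B) q = 0) :
    ∃ ρ : B → O, ∀ q ∈ Q, algebraMap A O π ^ N ∣ MvPolynomial.aeval ρ q := by
  classical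
  choose c hc hcA using hfin
  let l : Filter (Finset B) := Filter.atTop
  let P := Filter.Germ l O
  let coe : (Finset B → O) →+* P := Filter.Germ.coeRingHom l
  letI : Algebra A P := (coe.comp (algebraMap A (Finset B → O))).toAlgebra
  let coeA : (Finset B → O) →ₐ[A] P := { coe with commutes' := fun _ ↦ rfl }
  have hcoe : ∀ f g : Finset B → O, coe f = coe g ↔ ∀ᶠ T in l, f T = g T := fun f g ↦
    Filter.Germ.coe_eq
  have hsurj : Function.Surjective coe := fun x ↦ by
    induction x using Filter.Germ.inductionOn with
    | _ f => exact ⟨f, rfl⟩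
  have hmem : ∀ (k : ℕ) (f : Finset B → O),
      coe f ∈ (Ideal.span {π} ^ k).map (algebraMap A P) ↔
        ∀ᶠ T in l, algebraMap A O π ^ k ∣ f T := by
    intro k f
    rw [Ideal.span_singleton_pow, Ideal.map_span, Set.image_singleton,
      Ideal.mem_span_singleton']
    constructor
    · rintro ⟨a, ha⟩
      obtain ⟨g, rfl⟩ := hsurj a
      have : coe (g * algebraMap A (Finset B → O) (π ^ k)) = coe f := by
        rw [map_mul]; exact ha
      filter_upwards [(hcoe _ _).1 this] with T hT
      rw [← hT]
      exact ⟨g T, by simp [mul_comm]⟩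
    · intro hf
      refine ⟨coe fun T ↦ if hT : algebraMap A O π ^ k ∣ f T then hT.choose else 0, ?_⟩
      change coe _ * coe (algebraMap A (Finset B → O) (π ^ k)) = _
      rw [← map_mul, hcoe]
      filter_upwards [hf] with T hT
      have := hT.choose_spec
      simp only [Pi.mul_apply, dif_pos hT, Pi.algebraMap_apply, map_pow]
      rw [mul_comm]
      exact this.symm
  have hmem1 : ∀ f g : Finset B → O, (∀ᶠ T in l, algebraMap A O π ∣ f T - g T) →
      Ideal.Quotient.mk ((Ideal.span {π}).map (algebraMap A P)) (coe f) =
        Ideal.Quotient.mk _ (coe g) := by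
    intro f g hfg
    rw [Ideal.Quotient.eq, ← map_sub]
    have := (hmem 1 (f - g)).2 (by simpa using hfg)
    rwa [pow_one] at this
  have hev : ∀ x : B, ∀ᶠ T in l, x ∈ T := fun x ↦ by
    filter_upwards [Filter.eventually_ge_atTop ({x} : Finset B)] with T hT
    exact hT (by simp)
  let φ : B → P ⧸ (Ideal.span {π}).map (algebraMap A P) := fun b ↦
    Ideal.Quotient.mk _ (coe fun T ↦ c T b)
  have hφA : ∀ a : A, φ (algebraMap A B a) =
      algebraMap A (P ⧸ (Ideal.span {π}).map (algebraMap A P)) a := by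
    intro a
    refine hmem1 _ (algebraMap A (Finset B → O) a) ?_
    filter_upwards [hev (algebraMap A B a)] with T hT
    exact hcA T a hT
  let f : B →ₐ[A] P ⧸ (Ideal.span {π}).map (algebraMap A P) :=
    { toFun := φ
      map_one' := by simpa using hφA 1
      map_zero' := by simpa using hφA 0
      map_add' := fun x y ↦ by
        rw [← map_add, ← map_add]
        refine hmem1 _ _ ?_
        filter_upwards [hev x, hev y] with T hx hy
        exact (hc T x hx y hy).1
      map_mul' := fun x y ↦ by
        rw [← map_mul, ← map_mul]
        refine hmem1 _ _ ?_
        filter_upwards [hev x, hev y] with T hx hy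
        exact (hc T x hx y hy).2
      commutes' := hφA }
  obtain ⟨g⟩ := exists_lift_quotient_pow _ N (formallySmooth_quotient_pow _ h N) f
  have hr : ∀ b, ∃ r : Finset B → O, Ideal.Quotient.mk _ (coe r) = g b := fun b ↦ by
    obtain ⟨y, hy⟩ := Ideal.Quotient.mk_surjective (g b)
    obtain ⟨r, rfl⟩ := hsurj y
    exact ⟨r, hy⟩
  choose r hr using hr
  have hq : ∀ q ∈ Q, ∀ᶠ T in l, algebraMap A O π ^ (N + 1) ∣
      MvPolynomial.aeval (fun b ↦ r b T) q := by
    intro q hq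
    have h1 : ∀ T, MvPolynomial.aeval (fun b ↦ r b T) q = MvPolynomial.aeval r q T := by
      intro T
      exact (MvPolynomial.comp_aeval_apply r (Pi.evalAlgHom A (fun _ : Finset B ↦ O) T) q).symm
    simp only [h1]
    rw [← hmem]
    refine Ideal.Quotient.eq_zero_iff_mem.1 ?_
    have h2 : g (MvPolynomial.aeval (id : B → B) q) = Ideal.Quotient.mkₐ A _
        (coeA (MvPolynomial.aeval r q)) := by
      rw [MvPolynomial.comp_aeval_apply, MvPolynomial.comp_aeval_apply,
        MvPolynomial.comp_aeval_apply]
      congr 2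
      funext b
      exact (hr b).symm
    rw [hQ q hq, map_zero] at h2
    exact h2.symm
  obtain ⟨T, hT⟩ := ((Finset.eventually_all Q).2 hq).exists
  exact ⟨fun b ↦ r b T, fun q hq ↦ (pow_dvd_pow _ (by lia)).trans (hT q hq)⟩

/-- Every finite set of polynomial relations over `C` in `D` can be approximately solved in `M`,
respecting the valuation of finitely many elements. -/
def HasApprox (C : Type*) {D M : Type*} [Field C] [Field D] [Field M] [Algebra C D] [Algebra C M]
    {Γ Γ' : Type*} [LinearOrderedCommGroupWithZero Γ] [LinearOrderedCommGroupWithZero Γ']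
    (v : Valuation D Γ) (w : Valuation M Γ') (π : C) : Prop :=
  ∀ (N : ℕ) (E : Finset D) (Q : Finset (MvPolynomial D C)),
    (∀ q ∈ Q, MvPolynomial.aeval (id : D → D) q = 0) → ∃ ρ : D → M,
      (∀ d, v d ≤ 1 → w (ρ d) ≤ 1) ∧
      (∀ q ∈ Q, w (MvPolynomial.aeval ρ q) ≤ w (algebraMap C M π) ^ N) ∧
      ∀ d ∈ E, d ≠ 0 → ∃ m : ℤ, v d = v (algebraMap C D π) ^ m ∧
        w (ρ d) = w (algebraMap C M π) ^ m

/-- Any polynomial over `C` in variables indexed by `D` becomes integral after scaling the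
variables and the coefficients. -/
theorem exists_integral_mvPolynomial {C D B : Type*} [Field C] (A : Subring C) (π : C)
    (hπ0 : π ≠ 0) (hπ : π ∈ A) (harch : ∀ c : C, ∃ k : ℕ, π ^ k * c ∈ A) (m : D → ℤ) (ε : D → B)
    (q : MvPolynomial D C) : ∃ (k : ℕ) (q₁ : MvPolynomial B A),
      MvPolynomial.C (π ^ k) * MvPolynomial.aeval
        (fun d ↦ MvPolynomial.C (π ^ m d) * MvPolynomial.X (ε d) : D → MvPolynomial B C) q =
      MvPolynomial.map A.subtype q₁ := by
  induction q using MvPolynomial.induction_on with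
  | C c =>
    obtain ⟨k, hk⟩ := harch c
    refine ⟨k, MvPolynomial.C ⟨_, hk⟩, ?_⟩
    simp [MvPolynomial.algebraMap_eq]
  | add p q hp hq =>
    obtain ⟨k, p₁, hp⟩ := hp
    obtain ⟨l, q₁, hq⟩ := hq
    refine ⟨k + l, MvPolynomial.C (⟨π, hπ⟩ ^ l) * p₁ + MvPolynomial.C (⟨π, hπ⟩ ^ k) * q₁, ?_⟩
    simp only [map_add, map_mul, ← hp, ← hq, MvPolynomial.map_C, map_pow, Subring.subtype_apply]
    ring
  | mul_X p d hp =>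
    obtain ⟨k, p₁, hp⟩ := hp
    obtain ⟨l, hl⟩ := harch (π ^ m d)
    refine ⟨k + l, p₁ * (MvPolynomial.C ⟨_, hl⟩ * MvPolynomial.X (ε d)), ?_⟩
    simp only [map_mul, ← hp, MvPolynomial.map_C, MvPolynomial.map_X, MvPolynomial.aeval_X,
      Subring.subtype_apply, pow_add]
    ring

section

variable {C D M : Type*} [Field C] [Field D] [Field M] [Algebra C D] [Algebra C M]
    {Γ₀ Γ Γ' : Type*} [LinearOrderedCommGroupWithZero Γ₀] [LinearOrderedCommGroupWithZero Γ]
    [LinearOrderedCommGroupWithZero Γ']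
    (u : Valuation C Γ₀) (v : Valuation D Γ) (w : Valuation M Γ')

/-- The map of valuation rings induced by an extension of valued fields. -/
def integerMap (hv : (v.comap (algebraMap C D)).IsEquiv u) :
    u.valuationSubring →+* v.valuationSubring :=
  (algebraMap C D).restrict u.valuationSubring.toSubring v.valuationSubring.toSubring
    fun c hc ↦ (hv.le_one_iff_le_one (x := c)).2 hc

theorem IsUniformizer.maximalIdeal_eq {v : Valuation D Γ} {π : D} (h : IsUniformizer v π) :
    IsLocalRing.maximalIdeal v.valuationSubring =
      Ideal.span {(⟨π, h.2.1.le⟩ : v.valuationSubring)} := by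
  ext x
  rw [Valuation.mem_maximalIdeal_iff, Ideal.mem_span_singleton']
  constructor
  · intro hx
    have h0 : π ≠ 0 := fun h0 ↦ by simpa [h0] using h.1
    refine ⟨⟨x / π, ?_⟩, ?_⟩
    · change v (x / π) ≤ 1
      rw [_root_.map_div₀]
      exact div_le_one_of_le₀ (h.2.2 _ hx) zero_le
    · ext
      simp [h0]
  · rintro ⟨a, rfl⟩
    change v (a * π) < 1
    rw [_root_.map_mul]
    exact (mul_le_of_le_one_left' a.2).trans_lt h.2.1

end

section

variable {C D M : Type*} [Field C] [Field D] [Field M] [Algebra C D] [Algebra C M]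
    {Γ₀ Γ Γ' : Type*} [LinearOrderedCommGroupWithZero Γ₀] [LinearOrderedCommGroupWithZero Γ]
    [LinearOrderedCommGroupWithZero Γ']
    (u : Valuation C Γ₀) (v : Valuation D Γ) (w : Valuation M Γ')

theorem formallySmooth_quotient_of_residue (hv : (v.comap (algebraMap C D)).IsEquiv u)
    {π : C} (hu : IsUniformizer u π) (hπv : IsUniformizer v (algebraMap C D π))
    [Algebra (ResF u) (ResF v)] (hg : ResCompat u v (algebraMap (ResF u) (ResF v)))
    (hsm : Algebra.FormallySmooth (ResF u) (ResF v)) :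
    letI := (integerMap u v hv).toAlgebra
    Algebra.FormallySmooth
      (u.valuationSubring ⧸ Ideal.span {(⟨π, hu.2.1.le⟩ : u.valuationSubring)})
      (v.valuationSubring ⧸ (Ideal.span {(⟨π, hu.2.1.le⟩ : u.valuationSubring)}).map
        (algebraMap u.valuationSubring v.valuationSubring)) := by
  letI := (integerMap u v hv).toAlgebra
  have e1 := hu.maximalIdeal_eq
  have e2 : IsLocalRing.maximalIdeal v.valuationSubring =
      (Ideal.span {(⟨π, hu.2.1.le⟩ : u.valuationSubring)}).map
        (algebraMap u.valuationSubring v.valuationSubring) := by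
    rw [hπv.maximalIdeal_eq, Ideal.map_span, Set.image_singleton]
    rfl
  let i₁ : (u.valuationSubring ⧸ Ideal.span {(⟨π, hu.2.1.le⟩ : u.valuationSubring)}) ≃+* ResF u :=
    Ideal.quotEquivOfEq e1.symm
  let i₂ : ResF v ≃+* (v.valuationSubring ⧸
      (Ideal.span {(⟨π, hu.2.1.le⟩ : u.valuationSubring)}).map
        (algebraMap u.valuationSubring v.valuationSubring)) := Ideal.quotEquivOfEq e2
  have h : i₂.toRingHom.comp ((algebraMap (ResF u) (ResF v)).comp i₁.toRingHom) =
      algebraMap _ _ := by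
    ext a
    change i₂ (algebraMap (ResF u) (ResF v) (resMap u a)) = _
    rw [hg a (integerMap u v hv a).2]
    rfl
  rw [← RingHom.formallySmooth_algebraMap, ← h]
  exact ((RingHom.FormallySmooth.of_bijective i₁.bijective).comp
    (RingHom.formallySmooth_algebraMap.2 hsm)).comp
    (RingHom.FormallySmooth.of_bijective i₂.bijective)

theorem flat_integerMap (hv : (v.comap (algebraMap C D)).IsEquiv u) :
    letI := (integerMap u v hv).toAlgebra
    Module.Flat u.valuationSubring v.valuationSubring := by
  letI := (integerMap u v hv).toAlgebra
  rw [Module.Flat.flat_iff_torsion_eq_bot_of_isBezout, eq_bot_iff]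
  rintro x ⟨⟨a, ha⟩, hx⟩
  have h2 : algebraMap C D a * (x : D) = 0 := congrArg Subtype.val hx
  have ha0 : (a : C) ≠ 0 := fun h ↦ nonZeroDivisors.ne_zero ha (Subtype.ext h)
  rw [mul_eq_zero, map_eq_zero] at h2
  exact Subtype.ext (h2.resolve_left ha0)

theorem exists_partial_residue_lift (hv : (v.comap (algebraMap C D)).IsEquiv u)
    (hw : (w.comap (algebraMap C M)).IsEquiv u) {π : M} (hπ : IsUniformizer w π)
    [Algebra (ResF u) (ResF v)] [Algebra (ResF u) (ResF w)]
    (hgv : ResCompat u v (algebraMap (ResF u) (ResF v)))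
    (hgw : ResCompat u w (algebraMap (ResF u) (ResF w)))
    (hfin : ∀ T : Finset (ResF v), ∃ G : Subalgebra (ResF u) (ResF v × ResF w), IsGraph G ∧
      ∀ t ∈ T, ∃ t', (t, t') ∈ G) (T : Finset v.valuationSubring) :
    ∃ c : v.valuationSubring → w.valuationSubring,
      (∀ x ∈ T, ∀ y ∈ T, ⟨π, hπ.2.1.le⟩ ∣ c (x + y) - (c x + c y) ∧
        ⟨π, hπ.2.1.le⟩ ∣ c (x * y) - c x * c y) ∧
      ∀ a : u.valuationSubring, integerMap u v hv a ∈ T →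
        ⟨π, hπ.2.1.le⟩ ∣ c (integerMap u v hv a) - integerMap u w hw a := by
  classical
  obtain ⟨G, hG, hT⟩ := hfin (T.image (resMap v))
  have hdvd : ∀ a b : w.valuationSubring, resMap w a = resMap w b → ⟨π, hπ.2.1.le⟩ ∣ a - b := by
    intro a b hab
    rw [← sub_eq_zero, ← map_sub, IsLocalRing.residue_eq_zero_iff, hπ.maximalIdeal_eq,
      Ideal.mem_span_singleton] at hab
    exact hab
  have hex : ∀ x : v.valuationSubring, ∃ y : w.valuationSubring,
      ∀ t', (resMap v x, t') ∈ G → resMap w y = t' := by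
    intro x
    by_cases h : ∃ t', (resMap v x, t') ∈ G
    · obtain ⟨t', ht'⟩ := h
      obtain ⟨y, hy⟩ := IsLocalRing.residue_surjective t'
      refine ⟨y, fun t'' ht'' ↦ ?_⟩
      have := hG _ (G.sub_mem ht' ht'') (by simp)
      rw [hy]
      exact sub_eq_zero.1 this
    · exact ⟨0, fun t' ht' ↦ (h ⟨t', ht'⟩).elim⟩
  choose c hc using hex
  have hcT : ∀ x ∈ T, (resMap v x, resMap w (c x)) ∈ G := by
    intro x hx
    obtain ⟨t', ht'⟩ := hT _ (Finset.mem_image_of_mem _ hx)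
    rwa [hc x t' ht']
  refine ⟨c, fun x hx y hy ↦ ⟨hdvd _ _ ?_, hdvd _ _ ?_⟩, fun a _ ↦ hdvd _ _ ?_⟩
  · rw [hc (x + y) (resMap w (c x) + resMap w (c y)), map_add]
    rw [map_add]
    exact G.add_mem (hcT x hx) (hcT y hy)
  · rw [hc (x * y) (resMap w (c x) * resMap w (c y)), map_mul]
    rw [map_mul]
    exact G.mul_mem (hcT x hx) (hcT y hy)
  · refine hc _ _ ?_
    have := G.algebraMap_mem (resMap u a)
    rw [Prod.algebraMap_apply, hgv a (integerMap u v hv a).2,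
      hgw a (integerMap u w hw a).2] at this
    exact this

end

section

variable {C D M : Type*} [Field C] [Field D] [Field M] [Algebra C D] [Algebra C M]
    {Γ₀ Γ Γ' : Type*} [LinearOrderedCommGroupWithZero Γ₀] [LinearOrderedCommGroupWithZero Γ]
    [LinearOrderedCommGroupWithZero Γ']
    (u : Valuation C Γ₀) (v : Valuation D Γ) (w : Valuation M Γ')

theorem coe_eval₂_integerMap (hw : (w.comap (algebraMap C M)).IsEquiv u) {σ : Type*}
    (ρ : σ → w.valuationSubring) (q : MvPolynomial σ u.valuationSubring) :
    ((MvPolynomial.eval₂ (integerMap u w hw) ρ q : w.valuationSubring) : M) =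
      MvPolynomial.aeval (fun b ↦ (ρ b : M))
        (MvPolynomial.map u.valuationSubring.toSubring.subtype q) := by
  induction q using MvPolynomial.induction_on with
  | C c =>
    simp only [MvPolynomial.eval₂_C, MvPolynomial.map_C, MvPolynomial.aeval_C]
    rfl
  | add p q hp hq =>
    rw [MvPolynomial.eval₂_add, map_add, map_add, ← hp, ← hq]
    rfl
  | mul_X p d hp =>
    rw [MvPolynomial.eval₂_mul, _root_.map_mul, _root_.map_mul, ← hp, MvPolynomial.eval₂_X,
      MvPolynomial.map_X, MvPolynomial.aeval_X]
    rfl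

variable {u v w} in
theorem hasApprox_of_formallySmooth (hv : (v.comap (algebraMap C D)).IsEquiv u)
    (hw : (w.comap (algebraMap C M)).IsEquiv u)
    {π : C} (hu : IsUniformizer u π) (hπv : IsUniformizer v (algebraMap C D π))
    (hπw : IsUniformizer w (algebraMap C M π))
    (harch : ∀ c : C, ∃ k : ℕ, u (π ^ k * c) ≤ 1)
    (hdisc : ∀ d : D, d ≠ 0 → ∃ m : ℤ, v d = v (algebraMap C D π) ^ m)
    [Algebra (ResF u) (ResF v)] [Algebra (ResF u) (ResF w)]
    (hgv : ResCompat u v (algebraMap (ResF u) (ResF v)))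
    (hgw : ResCompat u w (algebraMap (ResF u) (ResF w)))
    (hsm : Algebra.FormallySmooth (ResF u) (ResF v))
    (hfin : ∀ T : Finset (ResF v), ∃ G : Subalgebra (ResF u) (ResF v × ResF w), IsGraph G ∧
      ∀ t ∈ T, ∃ t', (t, t') ∈ G) : HasApprox C v w π := by
  classical
  intro N E Q hQ
  have hπ0 : π ≠ 0 := fun h0 ↦ by simpa [h0] using hu.1
  have hπD : algebraMap C D π ≠ 0 := by simpa using hπ0
  have hπM : algebraMap C M π ≠ 0 := by simpa using hπ0
  have h1 : ∀ d : D, ∃ (m : ℤ) (e e' : v.valuationSubring), d = algebraMap C D π ^ m * e ∧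
      (d ≠ 0 → v d = v (algebraMap C D π) ^ m ∧ e * e' = 1) ∧ (v d ≤ 1 → 0 ≤ m) := by
    intro d
    by_cases hd : d = 0
    · exact ⟨0, 0, 0, by simp [hd], fun h ↦ (h hd).elim, fun _ ↦ le_rfl⟩
    obtain ⟨m, hm⟩ := hdisc d hd
    have hv1 : v (d / algebraMap C D π ^ m) = 1 := by
      rw [_root_.map_div₀, map_zpow₀, hm, div_self]
      exact zpow_ne_zero _ hπv.1.ne'
    refine ⟨m, ⟨_, hv1.le⟩, ⟨(d / algebraMap C D π ^ m)⁻¹, ?_⟩, ?_, fun _ ↦ ⟨hm, ?_⟩, ?_⟩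
    · change v (_)⁻¹ ≤ 1
      rw [map_inv₀, hv1, inv_one]
    · field_simp
    · ext
      change d / algebraMap C D π ^ m * (d / algebraMap C D π ^ m)⁻¹ = 1
      have : algebraMap C D π ^ m ≠ 0 := zpow_ne_zero _ hπD
      field_simp
    · intro h
      by_contra! h0
      rw [hm] at h
      exact absurd h (not_le.2 ((one_lt_zpow_iff_right_of_lt_one₀ hπv.1 hπv.2.1).2 h0))
  choose m ε ε' hε hεm hm0 using h1
  choose k q₁ hq₁ using exists_integral_mvPolynomial u.valuationSubring.toSubring π hπ0
    hu.2.1.le harch m ε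
  let N' := N + (Q.sup k + 1)
  letI := (integerMap u v hv).toAlgebra
  letI := (integerMap u w hw).toAlgebra
  have := flat_integerMap u v hv
  have key := exists_approx_hom (A := u.valuationSubring) (B := v.valuationSubring)
    (O := w.valuationSubring) ⟨π, hu.2.1.le⟩
    (formallySmooth_quotient_of_residue u v hv hu hπv hgv hsm)
    (exists_partial_residue_lift u v w hv hw hπw hgv hgw hfin) N'
    (Q.image q₁ ∪ (E.filter (· ≠ 0)).image
      fun d ↦ MvPolynomial.X (ε d) * MvPolynomial.X (ε' d) - 1) ?_
  swap
  · intro q hq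
    rw [Finset.mem_union, Finset.mem_image, Finset.mem_image] at hq
    obtain ⟨q, hq, rfl⟩ | ⟨d, hd, rfl⟩ := hq
    · have h2 := coe_eval₂_integerMap u v hv (fun b ↦ b) (q₁ q)
      rw [← hq₁, _root_.map_mul, MvPolynomial.comp_aeval_apply] at h2
      have h3 : (fun i ↦ MvPolynomial.aeval (R := C) (fun b : v.valuationSubring ↦ (b : D))
          (MvPolynomial.C (π ^ m i) * MvPolynomial.X (ε i))) = (id : D → D) := by
        funext i
        rw [_root_.map_mul, MvPolynomial.aeval_C, MvPolynomial.aeval_X, map_zpow₀, ← hε]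
        rfl
      rw [h3, hQ q hq, mul_zero] at h2
      exact Subtype.ext h2
    · rw [map_sub, map_mul, MvPolynomial.aeval_X, MvPolynomial.aeval_X, map_one]
      exact sub_eq_zero.2 (hεm d (Finset.mem_filter.1 hd).2).2
  obtain ⟨ρ, hρ⟩ := key
  have hρd : ∀ a : w.valuationSubring,
      algebraMap u.valuationSubring w.valuationSubring ⟨π, hu.2.1.le⟩ ^ N' ∣ a →
      w a ≤ w (algebraMap C M π) ^ N' := by
    rintro _ ⟨a, rfl⟩
    change w (algebraMap C M π ^ N' * a) ≤ _
    rw [_root_.map_mul, map_pow]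
    exact mul_le_of_le_one_right' a.2
  refine ⟨fun d ↦ algebraMap C M π ^ m d * ρ (ε d), fun d hd ↦ ?_, fun q hq ↦ ?_, fun d hd h0 ↦ ?_⟩
  · rw [_root_.map_mul, map_zpow₀]
    refine mul_le_one' ?_ (ρ (ε d)).2
    obtain ⟨j, hj⟩ := Int.eq_ofNat_of_zero_le (hm0 d hd)
    rw [hj, zpow_natCast]
    exact pow_le_one' hπw.2.1.le _
  · have h2 := hρd _ (hρ (q₁ q) (Finset.mem_union_left _ (Finset.mem_image_of_mem _ hq)))
    have h3 := coe_eval₂_integerMap u w hw ρ (q₁ q)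
    rw [← hq₁, _root_.map_mul, MvPolynomial.comp_aeval_apply] at h3
    have h4 : (fun i ↦ MvPolynomial.aeval (R := C) (fun b : v.valuationSubring ↦ (ρ b : M))
        (MvPolynomial.C (π ^ m i) * MvPolynomial.X (ε i))) =
        fun d ↦ algebraMap C M π ^ m d * (ρ (ε d) : M) := by
      funext i
      rw [_root_.map_mul, MvPolynomial.aeval_C, MvPolynomial.aeval_X, map_zpow₀]
    rw [h4] at h3
    change w ((MvPolynomial.eval₂ (integerMap u w hw) ρ (q₁ q) : w.valuationSubring) : M) ≤ _ at h2
    rw [h3, MvPolynomial.aeval_C, _root_.map_mul, map_pow, map_pow] at h2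
    have h5 : w (algebraMap C M π) ^ N' ≤
        w (algebraMap C M π) ^ k q * w (algebraMap C M π) ^ N := by
      rw [← pow_add]
      have := Finset.le_sup (f := k) hq
      exact pow_le_pow_right_of_le_one' hπw.2.1.le (by lia)
    exact le_of_mul_le_mul_left (h2.trans h5) (pow_pos hπw.1 _)
  · refine ⟨m d, (hεm d h0).1, ?_⟩
    have h2 := hρd _ (hρ _ (Finset.mem_union_right _ (Finset.mem_image_of_mem _
      (Finset.mem_filter.2 ⟨hd, h0⟩))))
    rw [map_sub, map_mul, MvPolynomial.aeval_X, MvPolynomial.aeval_X, map_one] at h2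
    have h3 : w ((ρ (ε d) : M) * ρ (ε' d) - 1) < 1 :=
      h2.trans_lt (pow_lt_one₀ zero_le hπw.2.1 (by lia))
    have h4 : w ((ρ (ε d) : M) * ρ (ε' d)) = 1 := by
      have := Valuation.map_one_add_of_lt w h3
      rwa [add_sub_cancel] at this
    rw [_root_.map_mul] at h4
    have h5 : w (ρ (ε d) : M) = 1 := by
      refine le_antisymm (ρ (ε d)).2 ?_
      rw [← h4]
      exact mul_le_of_le_one_right' (ρ (ε' d)).2
    rw [_root_.map_mul, map_zpow₀, h5, mul_one]

end

/-- A finitely generated algebraic extension of the fraction field of an integrally closed domain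
is generated by an integral element satisfying a separable equation. -/
theorem exists_integral_primitive {A D : Type*} [CommRing A] [IsDomain A] [IsIntegrallyClosed A]
    [Field D] [CharZero D] [Algebra A D] [FaithfulSMul A D] [Algebra.IsAlgebraic A D]
    (S : Finset D) (hS : ∀ F : Subfield D, (∀ a, algebraMap A D a ∈ F) → (S : Set D) ⊆ F → F = ⊤)
    (P : D → Prop) (hP : ∀ d, ∃ a : A, a ≠ 0 ∧ P (a • d)) :
    ∃ (y : D) (f : A[X]), P y ∧ aeval y f = 0 ∧ aeval y (derivative f) ≠ 0 ∧
      (∀ q : A[X], aeval y q = 0 → f ∣ q) ∧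
      ∀ d : D, ∃ q r : A[X], aeval y r ≠ 0 ∧ d = aeval y q / aeval y r := by
  let F := FractionRing A
  letI : Algebra F D := FractionRing.liftAlgebra A D
  haveI : IsScalarTower A F D := FractionRing.isScalarTower_liftAlgebra A D
  have : CharZero F := (algebraMap F D).charZero
  have halg : Algebra.IsAlgebraic F D :=
    ⟨fun d ↦ (Algebra.IsAlgebraic.isAlgebraic (R := A) d).extendScalars (IsFractionRing.injective A F)⟩
  have hadj : IntermediateField.adjoin F (S : Set D) = ⊤ := by
    have h := hS (IntermediateField.adjoin F (S : Set D)).toSubfield (fun a ↦ ?_)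
      (IntermediateField.subset_adjoin F _)
    · exact IntermediateField.toSubfield_injective h
    · rw [IsScalarTower.algebraMap_apply A F D]
      exact (IntermediateField.adjoin F (S : Set D)).algebraMap_mem _
  have : FiniteDimensional F D := by
    have := IntermediateField.finiteDimensional_adjoin (K := F) (S := (S : Set D))
      fun x _ ↦ (Algebra.IsAlgebraic.isAlgebraic (R := F) x).isIntegral
    rw [hadj] at this
    exact IntermediateField.topEquiv.toLinearEquiv.finiteDimensional
  obtain ⟨y₀, hy₀⟩ := Field.exists_primitive_element F D
  obtain ⟨a, ha, hbint⟩ := (Algebra.IsAlgebraic.isAlgebraic (R := A) y₀).exists_integral_multiple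
  obtain ⟨b, hb, hPb⟩ := hP (a • y₀)
  have hab : algebraMap A F (b * a) ≠ 0 := by
    rw [Ne, FaithfulSMul.algebraMap_eq_zero_iff]
    exact mul_ne_zero hb ha
  set y := b • a • y₀ with hy
  have hyint : IsIntegral A y := hbint.smul b
  have hy₁ : IntermediateField.adjoin F {y} = ⊤ := by
    rw [eq_top_iff, ← hy₀, IntermediateField.adjoin_simple_le_iff]
    have h1 : y = algebraMap F D (algebraMap A F (b * a)) * y₀ := by
      rw [hy, smul_smul, Algebra.smul_def, ← IsScalarTower.algebraMap_apply A F D]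
    have h2 : y₀ = algebraMap F D (algebraMap A F (b * a))⁻¹ * y := by
      rw [h1, map_inv₀, inv_mul_cancel_left₀]
      simpa using hab
    rw [h2]
    exact mul_mem ((IntermediateField.adjoin F {y}).algebraMap_mem _)
      (IntermediateField.mem_adjoin_simple_self F y)
  refine ⟨y, minpoly A y, hPb, minpoly.aeval A y, ?_, fun q hq ↦
    minpoly.isIntegrallyClosed_dvd hyint hq, fun d ↦ ?_⟩
  · have h1 : (minpoly F y).Separable := (minpoly.irreducible
      (Algebra.IsAlgebraic.isAlgebraic (R := F) y).isIntegral).separable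
    have h2 := h1.aeval_derivative_ne_zero (minpoly.aeval F y)
    rwa [minpoly.isIntegrallyClosed_eq_field_fractions' F hyint, derivative_map,
      aeval_map_algebraMap] at h2
  · have hd : d ∈ IntermediateField.adjoin F {y} := hy₁ ▸ IntermediateField.mem_top
    rw [← IntermediateField.mem_toSubalgebra, IntermediateField.adjoin_simple_toSubalgebra_of_isAlgebraic
      (Algebra.IsAlgebraic.isAlgebraic (R := F) y), Algebra.adjoin_singleton_eq_range_aeval] at hd
    obtain ⟨q, rfl⟩ := hd
    obtain ⟨c, hc, hq⟩ := IsLocalization.integerNormalization_spec (nonZeroDivisors A) q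
    have hc0 : algebraMap A D c ≠ 0 := by
      rw [Ne, FaithfulSMul.algebraMap_eq_zero_iff]
      exact nonZeroDivisors.ne_zero hc
    refine ⟨IsLocalization.integerNormalization (nonZeroDivisors A) q, C c, by simpa using hc0, ?_⟩
    have h3 := congrArg (aeval y) hq
    rw [aeval_map_algebraMap] at h3
    rw [h3, aeval_C, eq_div_iff hc0]
    simp [Algebra.smul_def, mul_comm, IsScalarTower.algebraMap_apply A F D]

/-- A finitely generated field extension in characteristic zero is generated over a polynomial
ring by one integral element satisfying a separable equation; all generators may be scaled. -/
theorem exists_presentation {C D : Type*} [Field C] [Field D] [Algebra C D] [CharZero D]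
    (P : D → Prop) (hP : ∀ d, ∃ c : C, c ≠ 0 ∧ P (c • d)) (S : Finset D)
    (hS : IntermediateField.adjoin C (S : Set D) = ⊤) :
    ∃ (t : Set D) (y : D) (f : (MvPolynomial t C)[X]), (∀ d ∈ t, P d) ∧ P y ∧
      eval₂ (MvPolynomial.aeval (R := C) (Subtype.val : t → D)).toRingHom y f = 0 ∧
      eval₂ (MvPolynomial.aeval (R := C) (Subtype.val : t → D)).toRingHom y (derivative f) ≠ 0 ∧
      (∀ q : (MvPolynomial t C)[X],
        eval₂ (MvPolynomial.aeval (R := C) (Subtype.val : t → D)).toRingHom y q = 0 → f ∣ q) ∧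
      ∀ d : D, ∃ q r : (MvPolynomial t C)[X],
        eval₂ (MvPolynomial.aeval (R := C) (Subtype.val : t → D)).toRingHom y r ≠ 0 ∧
        d = eval₂ (MvPolynomial.aeval (R := C) (Subtype.val : t → D)).toRingHom y q /
          eval₂ (MvPolynomial.aeval (R := C) (Subtype.val : t → D)).toRingHom y r := by
  classical
  choose c hc hPc using hP
  let S' : Finset D := S.image fun d ↦ c d • d
  have hS' : IntermediateField.adjoin C (S' : Set D) = ⊤ := by
    rw [eq_top_iff, ← hS, IntermediateField.adjoin_le_iff]
    intro d hd
    have h1 : c d • d ∈ IntermediateField.adjoin C (S' : Set D) :=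
      IntermediateField.subset_adjoin C _ (Finset.mem_coe.2 (Finset.mem_image_of_mem _ hd))
    have h2 := (IntermediateField.adjoin C (S' : Set D)).smul_mem h1 (x := (c d)⁻¹)
    rwa [inv_smul_smul₀ (hc d)] at h2
  have : Algebra.IsAlgebraic (Algebra.adjoin C (S' : Set D)) D := ⟨fun d ↦ by
    rw [← IntermediateField.isAlgebraic_adjoin_iff, hS']
    exact isAlgebraic_algebraMap (⟨d, IntermediateField.mem_top⟩ : (⊤ : IntermediateField C D))⟩
  obtain ⟨t, ht, htb⟩ := exists_isTranscendenceBasis_subset (R := C) (S' : Set D)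
  letI : Algebra (MvPolynomial t C) D :=
    (MvPolynomial.aeval (R := C) (Subtype.val : t → D)).toRingHom.toAlgebra
  have hfs : FaithfulSMul (MvPolynomial t C) D :=
    (faithfulSMul_iff_algebraMap_injective _ _).2 htb.1
  have : Algebra.IsAlgebraic (MvPolynomial t C) D := by
    have := htb.isAlgebraic
    refine Algebra.IsAlgebraic.of_ringHom_of_comp_eq (S := Algebra.adjoin C (Set.range
      (Subtype.val : t → D))) (B := D) htb.1.aevalEquiv.toRingEquiv (RingHom.id D)
      htb.1.aevalEquiv.surjective Function.injective_id ?_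
    exact RingHom.ext fun p ↦ htb.1.algebraMap_aevalEquiv p
  have hCc : ∀ x, algebraMap (MvPolynomial t C) D (MvPolynomial.C x) = algebraMap C D x :=
    MvPolynomial.aeval_C _
  have hgen : ∀ F : Subfield D, (∀ a, algebraMap (MvPolynomial t C) D a ∈ F) → (S : Set D) ⊆ F →
      F = ⊤ := by
    intro F hF hSF
    let F' : IntermediateField C D := { F with
      algebraMap_mem' := fun x ↦ by
        have := hF (MvPolynomial.C x)
        rwa [hCc] at this }
    have h1 : F' = ⊤ := by
      rw [eq_top_iff, ← hS, IntermediateField.adjoin_le_iff]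
      exact hSF
    rw [eq_top_iff]
    intro d _
    have : d ∈ F' := h1 ▸ IntermediateField.mem_top
    exact this
  obtain ⟨y, f, hy, hf, hf', hdvd, hfrac⟩ := exists_integral_primitive (A := MvPolynomial t C) S
    hgen P (fun d ↦ ⟨MvPolynomial.C (c d), by simpa using hc d, by
      rw [Algebra.smul_def, hCc, ← Algebra.smul_def]
      exact hPc d⟩)
  refine ⟨t, y, f, fun d hd ↦ ?_, hy, hf, hf', hdvd, hfrac⟩
  obtain ⟨s, -, rfl⟩ := Finset.mem_image.1 (ht hd)
  exact hPc s

theorem valuation_eval_sub_le {K : Type*} [Field K] {Γ : Type*} [LinearOrderedCommGroupWithZero Γ]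
    {v : Valuation K Γ} {f : K[X]} {a b : K} (h : ∀ i, v (f.coeff i) ≤ 1) (ha : v a ≤ 1)
    (hb : v b ≤ 1) : v (f.eval b - f.eval a) ≤ v (b - a) := by
  have hl : f ∈ Polynomial.lifts (v.valuationSubring.subtype) := by
    rw [Polynomial.lifts_iff_coeff_lifts]
    intro i
    exact ⟨⟨f.coeff i, h i⟩, rfl⟩
  obtain ⟨g, rfl⟩ := (Polynomial.mem_lifts _).1 hl
  obtain ⟨c, hc⟩ := g.sub_dvd_eval_sub (⟨b, hb⟩ : v.valuationSubring) ⟨a, ha⟩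
  have h1 := congrArg v.valuationSubring.subtype hc
  rw [map_sub, _root_.map_mul, ← Polynomial.eval₂_hom, ← Polynomial.eval₂_hom, map_sub] at h1
  rw [Polynomial.eval_map, Polynomial.eval_map]
  change eval₂ _ b g - eval₂ _ a g = (b - a) * c at h1
  rw [h1, _root_.map_mul]
  exact mul_le_of_le_one_right' c.2

section

variable {C M : Type*} [Field C] [Field M] [Algebra C M]
    {Γ' : Type*} [LinearOrderedCommGroupWithZero Γ'] {w : Valuation M Γ'} {a : Γ'}

theorem exists_bound_aeval (ha : a ≤ 1)
    (harch : ∀ c : C, ∃ k : ℕ, a ^ k * w (algebraMap C M c) ≤ 1) {ι : Type*}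
    (P : MvPolynomial ι C) :
    ∃ k : ℕ, ∀ ρ : ι → M, (∀ i, w (ρ i) ≤ 1) → a ^ k * w (MvPolynomial.aeval ρ P) ≤ 1 := by
  induction P using MvPolynomial.induction_on with
  | C c =>
    obtain ⟨k, hk⟩ := harch c
    exact ⟨k, fun ρ _ ↦ by rwa [MvPolynomial.aeval_C]⟩
  | add p q hp hq =>
    obtain ⟨k, hk⟩ := hp
    obtain ⟨l, hl⟩ := hq
    refine ⟨k + l, fun ρ hρ ↦ ?_⟩
    rw [map_add]
    obtain h | h := le_total (w (MvPolynomial.aeval ρ p)) (w (MvPolynomial.aeval ρ q))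
    · calc a ^ (k + l) * w (MvPolynomial.aeval ρ p + MvPolynomial.aeval ρ q)
          ≤ a ^ k * (a ^ l * w (MvPolynomial.aeval ρ q)) := by
            rw [pow_add, mul_assoc]
            gcongr
            exact (Valuation.map_add _ _ _).trans (max_le h le_rfl)
        _ ≤ 1 := mul_le_one' (pow_le_one' ha _) (hl ρ hρ)
    · calc a ^ (k + l) * w (MvPolynomial.aeval ρ p + MvPolynomial.aeval ρ q)
          ≤ a ^ l * (a ^ k * w (MvPolynomial.aeval ρ p)) := by
            rw [add_comm k l, pow_add, mul_assoc]
            gcongr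
            exact (Valuation.map_add _ _ _).trans (max_le le_rfl h)
        _ ≤ 1 := mul_le_one' (pow_le_one' ha _) (hk ρ hρ)
  | mul_X p i hp =>
    obtain ⟨k, hk⟩ := hp
    refine ⟨k, fun ρ hρ ↦ ?_⟩
    rw [_root_.map_mul, _root_.map_mul, MvPolynomial.aeval_X, ← mul_assoc]
    exact mul_le_one' (hk ρ hρ) (hρ i)

theorem exists_bound_coeff (ha : a ≤ 1)
    (harch : ∀ c : C, ∃ k : ℕ, a ^ k * w (algebraMap C M c) ≤ 1) {ι : Type*}
    (Q : Finset (MvPolynomial ι C)[X]) :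
    ∃ k : ℕ, ∀ ρ : ι → M, (∀ i, w (ρ i) ≤ 1) → ∀ q ∈ Q, ∀ i,
      a ^ k * w ((q.map (MvPolynomial.aeval (R := C) ρ).toRingHom).coeff i) ≤ 1 := by
  classical
  choose k hk using exists_bound_aeval (ι := ι) ha harch
  refine ⟨Q.sup fun q ↦ q.support.sup fun i ↦ k (q.coeff i), fun ρ hρ q hq i ↦ ?_⟩
  rw [Polynomial.coeff_map]
  by_cases hi : i ∈ q.support
  · refine le_trans ?_ (hk (q.coeff i) ρ hρ)
    have h1 := (Finset.le_sup (f := fun i ↦ k (q.coeff i)) hi).trans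
      (Finset.le_sup (f := fun q ↦ q.support.sup fun i ↦ k (q.coeff i)) hq)
    exact mul_le_mul_left (pow_le_pow_right_of_le_one' ha h1) _
  · simp [Polynomial.notMem_support_iff.1 hi]

end

section

variable {C D M : Type*} [Field C] [Field D] [Field M] [Algebra C D] [Algebra C M]
    {Γ Γ' : Type*} [LinearOrderedCommGroupWithZero Γ]
    [LinearOrderedCommGroupWithZero Γ'] {v : Valuation D Γ} {w : Valuation M Γ'} {π : C}

theorem aeval_eval₂_rename {R : Type*} [Field R] [Algebra C R] {t : Set D} (ρ : D → R) (y : D)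
    (q : (MvPolynomial t C)[X]) :
    MvPolynomial.aeval ρ (eval₂ (MvPolynomial.rename (R := C) (Subtype.val : t → D)).toRingHom
      (MvPolynomial.X y) q) =
      eval₂ (MvPolynomial.aeval (R := C) fun i : t ↦ ρ i).toRingHom (ρ y) q := by
  have h1 := Polynomial.hom_eval₂ q
    (MvPolynomial.rename (R := C) (Subtype.val : t → D)).toRingHom
    (MvPolynomial.aeval (R := C) ρ).toRingHom (MvPolynomial.X y)
  refine h1.trans ?_
  congr 1
  · ext x
    · simp
    · simp
  · simp

theorem HasApprox.exists_root (happ : HasApprox C v w π) (H : HenselProp₀ w)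
    (hv0 : 0 < v (algebraMap C D π)) (hv1 : v (algebraMap C D π) < 1)
    (hw0 : 0 < w (algebraMap C M π)) (hw1 : w (algebraMap C M π) < 1)
    (harch : ∀ c : C, ∃ k : ℕ, w (algebraMap C M π) ^ k * w (algebraMap C M c) ≤ 1)
    (hdisc : ∀ d : D, d ≠ 0 → ∃ m : ℤ, v d = v (algebraMap C D π) ^ m)
    {t : Set D} (ht : ∀ d ∈ t, v d ≤ 1) {y : D} (hy : v y ≤ 1) {f : (MvPolynomial t C)[X]}
    (hf : eval₂ (MvPolynomial.aeval (R := C) (Subtype.val : t → D)).toRingHom y f = 0)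
    (hf' : eval₂ (MvPolynomial.aeval (R := C) (Subtype.val : t → D)).toRingHom y
      (derivative f) ≠ 0) (𝒬 : Finset (MvPolynomial t C)[X]) :
    ∃ (σ : t → M) (b : M), eval₂ (MvPolynomial.aeval (R := C) σ).toRingHom b f = 0 ∧
      ∀ q ∈ 𝒬, eval₂ (MvPolynomial.aeval (R := C) (Subtype.val : t → D)).toRingHom y q ≠ 0 →
      ∃ m : ℤ, v (eval₂ (MvPolynomial.aeval (R := C) (Subtype.val : t → D)).toRingHom y q) =
        v (algebraMap C D π) ^ m ∧
        w (eval₂ (MvPolynomial.aeval (R := C) σ).toRingHom b q) = w (algebraMap C M π) ^ m := by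
  classical
  set a := w (algebraMap C M π) with ha
  let ev : (MvPolynomial t C)[X] → D :=
    eval₂ (MvPolynomial.aeval (R := C) (Subtype.val : t → D)).toRingHom y
  let 𝒬' := insert (derivative f) (insert f 𝒬)
  obtain ⟨k, hk⟩ := exists_bound_coeff hw1.le harch 𝒬'
  choose! m hm using hdisc
  let B : ℕ := 𝒬'.sup fun q ↦ (m (ev q)).natAbs
  have hB : ∀ q ∈ 𝒬', -(B : ℤ) ≤ m (ev q) ∧ m (ev q) ≤ B := by
    intro q hq
    have := Finset.le_sup (f := fun q ↦ (m (ev q)).natAbs) hq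
    change (m (ev q)).natAbs ≤ B at this
    lia
  let P : (MvPolynomial t C)[X] → MvPolynomial D C :=
    eval₂ (MvPolynomial.rename (R := C) (Subtype.val : t → D)).toRingHom (MvPolynomial.X y)
  have hP : ∀ q, MvPolynomial.aeval (id : D → D) (P q) = ev q := aeval_eval₂_rename id y
  have hP' : ∀ (ρ : D → M) (q : (MvPolynomial t C)[X]), MvPolynomial.aeval ρ (P q) =
      eval₂ (MvPolynomial.aeval (R := C) fun i : t ↦ ρ i).toRingHom (ρ y) q :=
    fun ρ ↦ aeval_eval₂_rename ρ y
  obtain ⟨ρ, hρ1, hρQ, hρE⟩ := happ (k + 4 * B + 1) (𝒬'.image ev)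
    (insert (P f) (𝒬'.image fun q ↦ MvPolynomial.X (ev q) - P q)) (by
      intro q hq
      rw [Finset.mem_insert, Finset.mem_image] at hq
      obtain rfl | ⟨q, -, rfl⟩ := hq
      · rw [hP]
        exact hf
      · rw [map_sub, hP, MvPolynomial.aeval_X]
        exact sub_self _)
  let σ : t → M := fun i ↦ ρ i
  let s : MvPolynomial t C →+* M := (MvPolynomial.aeval (R := C) σ).toRingHom
  have hσ : ∀ i, w (σ i) ≤ 1 := fun i ↦ hρ1 _ (ht _ i.2)
  have hval : ∀ q ∈ 𝒬', ev q ≠ 0 → w (eval₂ s (ρ y) q) = a ^ m (ev q) := by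
    intro q hq h0
    obtain ⟨j, hj, hj'⟩ := hρE _ (Finset.mem_image_of_mem ev hq) h0
    have hjm : j = m (ev q) := by
      apply zpow_right_injective₀ hv0 hv1.ne
      exact hj.symm.trans (hm _ h0)
    rw [hjm] at hj'
    rw [← hj']
    apply Valuation.map_eq_of_sub_lt
    have h1 := hρQ _ (Finset.mem_insert_of_mem (Finset.mem_image_of_mem _ hq))
    rw [map_sub, hP', MvPolynomial.aeval_X, Valuation.map_sub_swap] at h1
    rw [hj']
    refine h1.trans_lt ?_
    rw [← zpow_natCast, zpow_lt_zpow_iff_right_of_lt_one₀ hw0 hw1]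
    have := hB q hq
    push_cast
    lia
  have hdm : derivative f ∈ 𝒬' := Finset.mem_insert_self _ _
  have hfm : f ∈ 𝒬' := Finset.mem_insert_of_mem (Finset.mem_insert_self _ _)
  have hscale : ∀ (l : ℕ) (q : (MvPolynomial t C)[X]), q ∈ 𝒬' → ∀ i,
      w ((Polynomial.C (algebraMap C M π ^ (k + l)) * q.map s).coeff i) ≤ 1 := by
    intro l q hq i
    rw [Polynomial.coeff_C_mul, _root_.map_mul, map_pow, pow_add, mul_comm (_ ^ k), mul_assoc]
    exact mul_le_one' (pow_le_one' hw1.le _) (hk σ hσ q hq i)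
  have hyM : w (ρ y) ≤ 1 := hρ1 _ hy
  have hder : w ((derivative (Polynomial.C (algebraMap C M π ^ (k + 2 * B)) * f.map s)).eval (ρ y)) =
      a ^ ((k + 2 * B : ℕ) + m (ev (derivative f)) : ℤ) := by
    rw [Polynomial.derivative_C_mul, Polynomial.derivative_map, Polynomial.eval_mul,
      Polynomial.eval_C, Polynomial.eval_map, _root_.map_mul, hval _ hdm hf', map_pow,
      zpow_add₀ hw0.ne', zpow_natCast]
  obtain ⟨b, hb0, hb⟩ := H.newton (Polynomial.C (algebraMap C M π ^ (k + 2 * B)) * f.map s) (ρ y)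
    (hscale _ f hfm) hyM (by
      rw [hder, Polynomial.eval_mul, Polynomial.eval_C, Polynomial.eval_map, _root_.map_mul,
        map_pow]
      have h1 := hρQ _ (Finset.mem_insert_self _ _)
      rw [hP'] at h1
      refine (mul_le_mul_right h1 _).trans_lt ?_
      rw [← pow_add, ← zpow_natCast, ← zpow_natCast, ← zpow_mul,
        zpow_lt_zpow_iff_right_of_lt_one₀ hw0 hw1]
      have := hB _ hdm
      push_cast
      lia)
  have hb' : w (b - ρ y) < a ^ (k + B) := by
    refine hb.trans_le ?_
    rw [hder, ← zpow_natCast, zpow_le_zpow_iff_right_of_lt_one₀ hw0 hw1]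
    have := hB _ hdm
    push_cast
    lia
  have hb1 : w b ≤ 1 := by
    rw [← sub_add_cancel b (ρ y)]
    exact Valuation.map_add_le _ (hb'.le.trans (pow_le_one' hw1.le _)) hyM
  refine ⟨σ, b, ?_, fun q hq h0 ↦ ⟨m (ev q), hm _ h0, ?_⟩⟩
  · rw [Polynomial.eval_mul, Polynomial.eval_C, Polynomial.eval_map] at hb0
    refine (mul_eq_zero.1 hb0).resolve_left (pow_ne_zero _ fun h ↦ ?_)
    rw [ha, h, map_zero] at hw0
    exact lt_irrefl _ hw0
  · have hq' : q ∈ 𝒬' := Finset.mem_insert_of_mem (Finset.mem_insert_of_mem hq)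
    have h1 := hval q hq' h0
    change w (eval₂ s b q) = _
    rw [← h1]
    apply Valuation.map_eq_of_sub_lt
    have h2 := (valuation_eval_sub_le (hscale 0 q hq') hyM hb1).trans_lt hb'
    rw [Polynomial.eval_mul, Polynomial.eval_mul, Polynomial.eval_C, Polynomial.eval_C,
      Polynomial.eval_map,
      Polynomial.eval_map, ← mul_sub, _root_.map_mul, map_pow, add_zero, pow_add] at h2
    refine (lt_of_mul_lt_mul_left' h2).trans_le ?_
    rw [h1, ← zpow_natCast, zpow_le_zpow_iff_right_of_lt_one₀ hw0 hw1]
    exact (hB q hq').2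

end

section

variable {C D M : Type*} [Field C] [Field D] [Field M] [Algebra C D] [Algebra C M]
    {Γ Γ' : Type*} [LinearOrderedCommGroupWithZero Γ]
    [LinearOrderedCommGroupWithZero Γ'] {v : Valuation D Γ} {w : Valuation M Γ'} {π : C}

theorem signSpec_of_hasApprox [CharZero D] (happ : HasApprox C v w π) (H : HenselProp₀ w)
    (hv0 : 0 < v (algebraMap C D π)) (hv1 : v (algebraMap C D π) < 1)
    (hw0 : 0 < w (algebraMap C M π)) (hw1 : w (algebraMap C M π) < 1)
    (harch : ∀ c : C, ∃ k : ℕ, w (algebraMap C M π) ^ k * w (algebraMap C M c) ≤ 1)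
    (hdisc : ∀ d : D, d ≠ 0 → ∃ m : ℤ, v d = v (algebraMap C D π) ^ m)
    (S : Finset D) (hS : IntermediateField.adjoin C (S : Set D) = ⊤) : SignSpec C v w S := by
  classical
  have hscale : ∀ d : D, ∃ c : C, c ≠ 0 ∧ v (c • d) ≤ 1 := by
    intro d
    by_cases hd : d = 0
    · exact ⟨1, one_ne_zero, by simp [hd]⟩
    obtain ⟨m, hm⟩ := hdisc d hd
    refine ⟨π ^ m.natAbs, pow_ne_zero _ fun h ↦ by simp [h] at hv0, ?_⟩
    rw [Algebra.smul_def, _root_.map_mul, map_pow, map_pow, hm, ← zpow_natCast,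
      ← zpow_add₀ hv0.ne', ← not_lt, one_lt_zpow_iff_right_of_lt_one₀ hv0 hv1]
    lia
  obtain ⟨t, y, f, ht, hy, hf, hf', hdvd, hfrac⟩ :=
    exists_presentation (fun d ↦ v d ≤ 1) hscale S hS
  choose q r hr hqr using hfrac
  obtain ⟨σ, b, hb, hσ⟩ := happ.exists_root H hv0 hv1 hw0 hw1 harch hdisc ht hy hf hf'
    (S.image q ∪ S.image r)
  set τ : MvPolynomial t C →+* D :=
    (MvPolynomial.aeval (R := C) (Subtype.val : t → D)).toRingHom with hτ
  set s : MvPolynomial t C →+* M := (MvPolynomial.aeval (R := C) σ).toRingHom with hs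
  let φ : (MvPolynomial t C)[X] →ₐ[C] D × M :=
    { RingHom.prod (eval₂RingHom τ y) (eval₂RingHom s b) with
      commutes' := fun c ↦ by
        refine Prod.ext ?_ ?_
        · change eval₂ τ y (Polynomial.C (MvPolynomial.C c)) = _
          rw [eval₂_C]
          exact MvPolynomial.aeval_C _ _
        · change eval₂ s b (Polynomial.C (MvPolynomial.C c)) = _
          rw [eval₂_C]
          exact MvPolynomial.aeval_C _ _ }
  have hG₁ : IsGraph φ.range := by
    rintro _ ⟨p, rfl⟩ h0
    obtain ⟨p, rfl⟩ := hdvd p h0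
    change eval₂ s b (f * p) = 0
    rw [eval₂_mul, hb, zero_mul]
  obtain ⟨G, hG₁G, hG, hinv, -⟩ := hG₁.exists_localization
  refine ⟨G, hG, fun d hd ↦ ?_⟩
  have hmem : ∀ p, (eval₂ τ y p, eval₂ s b p) ∈ G := fun p ↦ hG₁G ⟨p, rfl⟩
  obtain ⟨m₂, hm₂, hm₂'⟩ := hσ (r d)
    (Finset.mem_union_right _ (Finset.mem_image_of_mem r hd)) (hr d)
  have hr0 : eval₂ s b (r d) ≠ 0 := by
    intro h0
    rw [h0, map_zero] at hm₂'
    exact zpow_ne_zero m₂ hw0.ne' hm₂'.symm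
  refine ⟨eval₂ s b (q d) / eval₂ s b (r d), ?_, ?_, ?_⟩
  · have h1 := G.mul_mem (hmem (q d)) (hinv _ (hmem (r d)) hr0)
    convert h1 using 1
    refine Prod.ext ?_ ?_
    · change d = eval₂ τ y (q d) * (eval₂ τ y (r d))⁻¹
      rw [← div_eq_mul_inv]
      exact hqr d
    · exact div_eq_mul_inv _ _
  all_goals by_cases hq : eval₂ τ y (q d) = 0
  · intro _
    rw [hqr d, hq, zero_div]
  · obtain ⟨m₁, hm₁, hm₁'⟩ := hσ (q d)
      (Finset.mem_union_left _ (Finset.mem_image_of_mem q hd)) hq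
    intro h0
    rw [div_eq_zero_iff, or_iff_left hr0] at h0
    rw [h0, map_zero] at hm₁'
    exact absurd hm₁'.symm (zpow_ne_zero m₁ hw0.ne')
  · have h1 : eval₂ s b (q d) = 0 := hG _ (hmem (q d)) hq
    have h2 : d = 0 := by rw [hqr d, hq, zero_div]
    rw [h1, h2]
    simp
  · obtain ⟨m₁, hm₁, hm₁'⟩ := hσ (q d)
      (Finset.mem_union_left _ (Finset.mem_image_of_mem q hd)) hq
    have h1 : v d = v (algebraMap C D π) ^ (m₁ - m₂) := by
      rw [zpow_sub₀ hv0.ne', ← hm₁, ← hm₂, ← _root_.map_div₀, ← hqr d]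
    rw [h1, _root_.map_div₀, hm₁', hm₂', ← zpow_sub₀ hw0.ne', ← not_lt, ← not_lt,
      one_lt_zpow_iff_right_of_lt_one₀ hv0 hv1, one_lt_zpow_iff_right_of_lt_one₀ hw0 hw1]

end

section

variable {K : Type*} [Field K] {Γ : Type*} [LinearOrderedCommGroupWithZero Γ]

/-- `d` is integral with residue `r`. -/
def IsRes (v : Valuation K Γ) (d : K) (r : ResF v) : Prop :=
  ∃ h : v d ≤ 1, resMap v ⟨d, h⟩ = r

variable {v : Valuation K Γ} {d e : K} {r s : ResF v}

theorem exists_isRes (h : v d ≤ 1) : ∃ r, IsRes v d r := ⟨_, h, rfl⟩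

theorem IsRes.unique (h : IsRes v d r) (h' : IsRes v d s) : r = s := by
  obtain ⟨_, rfl⟩ := h
  obtain ⟨_, rfl⟩ := h'
  rfl

theorem IsRes.add (h : IsRes v d r) (h' : IsRes v e s) : IsRes v (d + e) (r + s) := by
  obtain ⟨h, rfl⟩ := h
  obtain ⟨h', rfl⟩ := h'
  exact ⟨Valuation.map_add_le _ h h', map_add (resMap v) ⟨d, h⟩ ⟨e, h'⟩⟩

theorem IsRes.mul (h : IsRes v d r) (h' : IsRes v e s) : IsRes v (d * e) (r * s) := by
  obtain ⟨h, rfl⟩ := h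
  obtain ⟨h', rfl⟩ := h'
  exact ⟨by rw [_root_.map_mul]; exact mul_le_one' h h',
    _root_.map_mul (resMap v) ⟨d, h⟩ ⟨e, h'⟩⟩

theorem IsRes.neg (h : IsRes v d r) : IsRes v (-d) (-r) := by
  obtain ⟨h, rfl⟩ := h
  exact ⟨by rwa [Valuation.map_neg], map_neg (resMap v) ⟨d, h⟩⟩

theorem isRes_zero : IsRes v 0 0 := ⟨by simp, map_zero (resMap v)⟩

theorem isRes_one : IsRes v 1 1 := ⟨by simp, map_one (resMap v)⟩

theorem IsRes.ne_zero_iff (h : IsRes v d r) : r ≠ 0 ↔ v d = 1 := by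
  obtain ⟨h, rfl⟩ := h
  rw [Ne, IsLocalRing.residue_eq_zero_iff, Valuation.mem_maximalIdeal_iff, not_lt]
  exact ⟨fun h' ↦ le_antisymm h h', fun h' ↦ h'.ge⟩

theorem isRes_of_lt (h : v d < 1) : IsRes v d 0 := by
  obtain ⟨r, hr⟩ := exists_isRes h.le
  have : r = 0 := by
    by_contra h0
    exact h.ne (hr.ne_zero_iff.1 h0)
  rwa [this] at hr

theorem IsRes.inv (h : IsRes v d r) (h0 : r ≠ 0) : IsRes v d⁻¹ r⁻¹ := by
  have h1 := h.ne_zero_iff.1 h0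
  obtain ⟨s, hs⟩ := exists_isRes (v := v) (d := d⁻¹) (by simp [h1])
  have hd : d ≠ 0 := by
    rintro rfl
    simp at h1
  have h2 := h.mul hs
  rw [mul_inv_cancel₀ hd] at h2
  rwa [inv_eq_of_mul_eq_one_right (h2.unique isRes_one)]

/-- The residue field of a subfield. -/
noncomputable def resField (v : Valuation K Γ) (M : Subfield K) : Subfield (ResF v) where
  carrier := {r | ∃ d ∈ M, IsRes v d r}
  mul_mem' := fun ⟨d, hd, hr⟩ ⟨e, he, hs⟩ ↦ ⟨_, M.mul_mem hd he, hr.mul hs⟩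
  add_mem' := fun ⟨d, hd, hr⟩ ⟨e, he, hs⟩ ↦ ⟨_, M.add_mem hd he, hr.add hs⟩
  one_mem' := ⟨1, M.one_mem, isRes_one⟩
  zero_mem' := ⟨0, M.zero_mem, isRes_zero⟩
  neg_mem' := fun ⟨d, hd, hr⟩ ↦ ⟨_, M.neg_mem hd, hr.neg⟩
  inv_mem' := by
    rintro r ⟨d, hd, hr⟩
    by_cases h0 : r = 0
    · rw [h0, inv_zero]
      exact ⟨0, M.zero_mem, isRes_zero⟩
    · exact ⟨_, M.inv_mem hd, hr.inv h0⟩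

/-- The relative algebraic closure of the residue field of `M`. -/
noncomputable abbrev resClosure (v : Valuation K Γ) (M : Subfield K) :
    IntermediateField (resField v M) (ResF v) :=
  algebraicClosure (resField v M) (ResF v)

theorem mem_resClosure_of_isRes {M : Subfield K} (hd : d ∈ M) (h : IsRes v d r) :
    r ∈ resClosure v M :=
  (resClosure v M).algebraMap_mem ⟨r, d, hd, h⟩

theorem isRes_zpow_mul_of_lt {π : K} (hπ0 : 0 < v π) (hπ1 : v π < 1) {i j : ℤ} (hij : i < j)
    (h : IsRes v (π ^ i * d) r) : IsRes v (π ^ j * d) 0 := by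
  refine isRes_of_lt ?_
  have hπ : π ≠ 0 := fun h ↦ by simp [h] at hπ0
  have h1 : π ^ j * d = π ^ (j - i) * (π ^ i * d) := by
    rw [← mul_assoc, ← zpow_add₀ hπ, sub_add_cancel]
  rw [h1, _root_.map_mul, map_zpow₀]
  refine (mul_le_of_le_one_right' h.choose).trans_lt ?_
  rw [← zpow_zero (v π), zpow_lt_zpow_iff_right_of_lt_one₀ hπ0 hπ1]
  lia

section

variable {M : Subfield K} {π : K} {x : K}

theorem exists_isRes_normalized (hπ0 : 0 < v π)
    (hdisc : ∀ g : M[X], aeval x g ≠ 0 → ∃ m : ℤ, v (aeval x g) = v π ^ m)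
    (g : M[X]) (hg : aeval x g ≠ 0) :
    ∃ (j : ℤ) (r : ResF v), r ≠ 0 ∧ IsRes v (π ^ j * aeval x g) r := by
  obtain ⟨m, hm⟩ := hdisc g hg
  have h1 : v (π ^ (-m) * aeval x g) = 1 := by
    rw [_root_.map_mul, map_zpow₀, hm, ← zpow_add₀ hπ0.ne', neg_add_cancel, zpow_zero]
  obtain ⟨r, hr⟩ := exists_isRes h1.le
  exact ⟨-m, r, hr.ne_zero_iff.2 h1, hr⟩

theorem exists_isRes_aeval (hπM : π ∈ M) (hπ0 : 0 < v π) (hπ1 : v π < 1)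
    (hdisc : ∀ g : M[X], aeval x g ≠ 0 → ∃ m : ℤ, v (aeval x g) = v π ^ m)
    {f : M[X]} {t : ResF v} (hft : IsRes v (aeval x f) t)
    (ht : Transcendental (resClosure v M) t)
    (hmin : ∀ g : M[X], g.natDegree < f.natDegree → ∀ r, IsRes v (aeval x g) r →
      r ∈ resClosure v M) (g : M[X]) (hg : g ≠ 0) :
    ∃ (j : ℤ) (P : (resClosure v M)[X]), P ≠ 0 ∧ IsRes v (π ^ j * aeval x g) (aeval t P) := by
  have hf0 : f.natDegree ≠ 0 := by
    intro h0
    obtain ⟨a, rfl⟩ := Polynomial.natDegree_eq_zero.1 h0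
    rw [aeval_C] at hft
    exact ht (isAlgebraic_algebraMap (⟨t, mem_resClosure_of_isRes a.2 hft⟩ : resClosure v M))
  have hsmall : ∀ g : M[X], g ≠ 0 → g.natDegree < f.natDegree →
      ∃ (j : ℤ) (c : resClosure v M), c ≠ 0 ∧ IsRes v (π ^ j * aeval x g) c := by
    intro g hg hgf
    have hgx : aeval x g ≠ 0 := by
      intro h0
      have h1 := congrArg (aeval x) (EuclideanDomain.mod_add_div f g)
      rw [map_add, _root_.map_mul, h0, zero_mul, add_zero] at h1
      rw [← h1] at hft
      have h2 := hmin (f % g) ((Polynomial.natDegree_le_natDegree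
        (EuclideanDomain.mod_lt f hg).le).trans_lt hgf) t hft
      exact ht (isAlgebraic_algebraMap (⟨t, h2⟩ : resClosure v M))
    obtain ⟨j, r, hr0, hr⟩ := exists_isRes_normalized hπ0 hdisc g hgx
    have h1 := hmin (Polynomial.C ((⟨π, hπM⟩ : M) ^ j) * g)
      ((Polynomial.natDegree_C_mul_le _ _).trans_lt hgf) r
      (by
        rw [_root_.map_mul, aeval_C, map_zpow₀]
        exact hr)
    exact ⟨j, ⟨r, h1⟩, by simpa [Subtype.ext_iff] using hr0, hr⟩
  induction hN : g.natDegree using Nat.strong_induction_on generalizing g with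
  | _ N ih =>
  obtain hlt | hle := lt_or_ge g.natDegree f.natDegree
  · obtain ⟨j, c, hc, h⟩ := hsmall g hg hlt
    exact ⟨j, Polynomial.C c, by simpa using hc, by simpa using h⟩
  have hf : f ≠ 0 := by
    rintro rfl
    simp at hf0
  have hdecomp := EuclideanDomain.mod_add_div g f
  have hmod : (g % f).degree < f.degree := EuclideanDomain.mod_lt g hf
  have hq : g / f ≠ 0 := by
    intro h0
    rw [h0, mul_zero, add_zero] at hdecomp
    rw [hdecomp] at hmod
    exact absurd (Polynomial.natDegree_lt_natDegree hg hmod) (not_lt.2 hle)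
  have hqlt : (g / f).natDegree < g.natDegree := Polynomial.natDegree_lt_natDegree hq
    (Polynomial.degree_div_lt hg (Polynomial.natDegree_pos_iff_degree_pos.1 (by lia)))
  obtain ⟨j, P, hP, hqP⟩ := ih _ (hN ▸ hqlt) (g / f) hq rfl
  have hfq : IsRes v (π ^ j * aeval x (f * (g / f))) (aeval t (X * P)) := by
    rw [_root_.map_mul, _root_.map_mul, aeval_X, mul_left_comm]
    exact hft.mul hqP
  have hXP : X * P ≠ 0 := mul_ne_zero X_ne_zero hP
  have hg' : aeval x g = aeval x (g % f) + aeval x (f * (g / f)) := by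
    rw [← map_add, hdecomp]
  by_cases hr : g % f = 0
  · refine ⟨j, X * P, hXP, ?_⟩
    rw [hg', hr, map_zero, zero_add]
    exact hfq
  obtain ⟨i, c, hc, hrc⟩ := hsmall (g % f) hr (Polynomial.natDegree_lt_natDegree hr hmod)
  obtain hij | rfl | hij := lt_trichotomy i j
  · refine ⟨j, X * P, hXP, ?_⟩
    rw [hg', mul_add, ← zero_add (aeval t (X * P))]
    exact (isRes_zpow_mul_of_lt hπ0 hπ1 hij hrc).add hfq
  · refine ⟨i, Polynomial.C c + X * P, fun h ↦ hc ?_, ?_⟩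
    · simpa using congrArg (fun q ↦ q.coeff 0) h
    · rw [hg', mul_add, map_add, aeval_C]
      exact hrc.add hfq
  · refine ⟨i, Polynomial.C c, by simpa using hc, ?_⟩
    rw [hg', mul_add, aeval_C, ← add_zero (algebraMap _ (ResF v) c)]
    exact hrc.add (isRes_zpow_mul_of_lt hπ0 hπ1 hij hfq)

/-- A form of the ruled residue theorem. -/
theorem ruled_residue {D : Subfield K} (hπM : π ∈ M) (hπ0 : 0 < v π) (hπ1 : v π < 1)
    (hdisc : ∀ g : M[X], aeval x g ≠ 0 → ∃ m : ℤ, v (aeval x g) = v π ^ m)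
    (hD : ∀ d ∈ D, ∃ g h : M[X], aeval x h ≠ 0 ∧ d = aeval x g / aeval x h) :
    (∀ r ∈ resField v D, r ∈ resClosure v M) ∨
    ∃ t : ResF v, Transcendental (resClosure v M) t ∧ ∀ r ∈ resField v D,
      ∃ P Q : (resClosure v M)[X], aeval t Q ≠ 0 ∧ r = aeval t P / aeval t Q := by
  classical
  have hπ : π ≠ 0 := fun h ↦ by simp [h] at hπ0
  by_cases hall : ∀ (g : M[X]) (r : ResF v), IsRes v (aeval x g) r → r ∈ resClosure v M
  · refine Or.inl ?_
    rintro r ⟨d, hd, hr⟩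
    obtain ⟨g, h, hh, rfl⟩ := hD d hd
    obtain ⟨j, s, hs0, hs⟩ := exists_isRes_normalized hπ0 hdisc h hh
    have h1 := hr.mul hs
    have h2 : aeval x g / aeval x h * (π ^ j * aeval x h) =
        aeval x (Polynomial.C ((⟨π, hπM⟩ : M) ^ j) * g) := by
      rw [_root_.map_mul, aeval_C, map_zpow₀]
      change _ = π ^ j * _
      field_simp
    have h3 : π ^ j * aeval x h = aeval x (Polynomial.C ((⟨π, hπM⟩ : M) ^ j) * h) := by
      rw [_root_.map_mul, aeval_C, map_zpow₀]
      rfl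
    rw [h2] at h1
    rw [h3] at hs
    have h4 := (resClosure v M).div_mem (hall _ _ h1) (hall _ _ hs)
    rwa [mul_div_cancel_right₀ _ hs0] at h4
  · push Not at hall
    have hex : ∃ n, ∃ (g : M[X]) (r : ResF v), g.natDegree = n ∧ IsRes v (aeval x g) r ∧
        r ∉ resClosure v M := by
      obtain ⟨g, r, h⟩ := hall
      exact ⟨_, g, r, rfl, h⟩
    obtain ⟨f, t, hfn, hft, ht⟩ := Nat.find_spec hex
    have hmin : ∀ g : M[X], g.natDegree < f.natDegree → ∀ r, IsRes v (aeval x g) r →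
        r ∈ resClosure v M := by
      intro g hg r hr
      by_contra hr'
      exact Nat.find_min hex (hfn ▸ hg) ⟨g, r, rfl, hr, hr'⟩
    have htr : Transcendental (resClosure v M) t :=
      Transcendental.algebraicClosure fun h ↦ ht (mem_algebraicClosure_iff.2 h)
    refine Or.inr ⟨t, htr, ?_⟩
    rintro r ⟨d, hd, hr⟩
    obtain ⟨g, h, hh, rfl⟩ := hD d hd
    have hh0 : h ≠ 0 := by
      rintro rfl
      simp at hh
    obtain ⟨j, Q, hQ, hhQ⟩ := exists_isRes_aeval hπM hπ0 hπ1 hdisc hft htr hmin h hh0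
    have hQt : aeval t Q ≠ 0 := fun h0 ↦ htr ⟨Q, hQ, h0⟩
    by_cases hg : g = 0
    · refine ⟨0, Q, hQt, ?_⟩
      rw [hg, map_zero, zero_div] at hr
      rw [hr.unique isRes_zero, map_zero, zero_div]
    obtain ⟨i, P, hP, hgP⟩ := exists_isRes_aeval hπM hπ0 hπ1 hdisc hft htr hmin g hg
    have hPt : aeval t P ≠ 0 := fun h0 ↦ htr ⟨P, hP, h0⟩
    have h1 := hr.mul hhQ
    have h2 : aeval x g / aeval x h * (π ^ j * aeval x h) = π ^ j * aeval x g := by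
      field_simp
    rw [h2] at h1
    obtain hij | rfl | hij := lt_trichotomy i j
    · refine ⟨0, Q, hQt, ?_⟩
      have h3 := h1.unique (isRes_zpow_mul_of_lt hπ0 hπ1 hij hgP)
      rw [map_zero, zero_div]
      exact (mul_eq_zero.1 h3).resolve_right hQt
    · refine ⟨P, Q, hQt, ?_⟩
      rw [eq_div_iff hQt]
      exact h1.unique hgP
    · exact absurd (hgP.unique (isRes_zpow_mul_of_lt hπ0 hπ1 hij h1)) hPt

end

end

section

variable {k E : Type*} [Field k] [Field E] [Algebra k E]

theorem adjoin_range_mk_eq_top {ι : Type*} (x : ι → E) :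
    IntermediateField.adjoin k (Set.range fun i ↦
      (⟨x i, IntermediateField.subset_adjoin k _ ⟨i, rfl⟩⟩ :
        IntermediateField.adjoin k (Set.range x))) = ⊤ := by
  apply IntermediateField.map_injective (IntermediateField.val _)
  rw [IntermediateField.adjoin_map, ← AlgHom.fieldRange_eq_map, IntermediateField.fieldRange_val,
    ← Set.range_comp]
  rfl

theorem trdeg_adjoin_range_le {n : ℕ} (x : Fin n → E) :
    Algebra.trdeg k (IntermediateField.adjoin k (Set.range x)) ≤ n := by
  let M := IntermediateField.adjoin k (Set.range x)
  let s : Set M := Set.range fun i ↦ (⟨x i, IntermediateField.subset_adjoin k _ ⟨i, rfl⟩⟩ : M)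
  have hs : IntermediateField.adjoin k s = ⊤ := adjoin_range_mk_eq_top x
  have : Algebra.IsAlgebraic (Algebra.adjoin k s) M := by
    rw [← IntermediateField.isAlgebraic_adjoin_iff_top, hs, Algebra.isAlgebraic_iff_isIntegral]
    exact Algebra.isIntegral_of_surjective IntermediateField.topEquiv.surjective
  refine (Algebra.IsAlgebraic.trdeg_le_cardinalMk k s).trans ?_
  have h1 := Cardinal.mk_range_le_lift (f := fun i ↦
    (⟨x i, IntermediateField.subset_adjoin k _ ⟨i, rfl⟩⟩ : M))
  simpa using h1

theorem AlgebraicIndependent.cardinalMk_le_trdeg_of_isAlgebraic {E : Type w} [Field E] [Algebra k E]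
    (M : IntermediateField k E) {ι : Type w} {r : ι → E} (hr : AlgebraicIndependent k r)
    (hrM : ∀ i, IsAlgebraic M (r i)) : Cardinal.mk ι ≤ Algebra.trdeg k M := by
  have hrA : ∀ i, r i ∈ algebraicClosure M E := fun i ↦ mem_algebraicClosure_iff.2 (hrM i)
  have h1 : AlgebraicIndependent k (fun i ↦ (⟨r i, hrA i⟩ : algebraicClosure M E)) :=
    (AlgHom.algebraicIndependent_iff ((algebraicClosure M E).restrictScalars k).val
      Subtype.val_injective).1 hr
  have : FaithfulSMul M (algebraicClosure M E) :=
    (faithfulSMul_iff_algebraMap_injective _ _).2 (algebraMap M (algebraicClosure M E)).injective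
  have h2 := trdeg_add_eq k M (A := algebraicClosure M E)
  rw [_root_.trdeg_eq_zero (R := M) (A := algebraicClosure M E), add_zero] at h2
  exact h1.cardinalMk_le_trdeg.trans h2.ge

end

section

variable {C : Type v} {K : Type w} [Field C] [Field K] [Algebra C K]
    {Γ₀ Γ : Type*} [LinearOrderedCommGroupWithZero Γ₀] [LinearOrderedCommGroupWithZero Γ]
    {u : Valuation C Γ₀} {v : Valuation K Γ}

theorem isRes_algebraMap [Algebra (ResF u) (ResF v)]
    (hgv : ResCompat u v (algebraMap (ResF u) (ResF v)))
    (hv : (v.comap (algebraMap C K)).IsEquiv u) (c : u.valuationSubring) :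
    IsRes v (algebraMap C K c) (algebraMap (ResF u) (ResF v) (resMap u c)) :=
  ⟨(hv.le_one_iff_le_one (x := (c : C))).2 c.2,
    (hgv c ((hv.le_one_iff_le_one (x := (c : C))).2 c.2)).symm⟩

/-- Lifts of algebraically independent residues are algebraically independent. -/
theorem algebraicIndependent_of_isRes [Algebra (ResF u) (ResF v)]
    (hgv : ResCompat u v (algebraMap (ResF u) (ResF v)))
    (hv : (v.comap (algebraMap C K)).IsEquiv u) {ι : Type*} {m : ι → K} {r : ι → ResF v}
    (hmr : ∀ i, IsRes v (m i) (r i)) (hr : AlgebraicIndependent (ResF u) r) :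
    AlgebraicIndependent C m := by
  rw [algebraicIndependent_iff]
  intro P hP
  by_contra hP0
  obtain ⟨d, hd, hmax⟩ := Finset.exists_max_image P.support (fun d ↦ u (P.coeff d))
    (by rwa [MvPolynomial.support_nonempty])
  have hc : P.coeff d ≠ 0 := MvPolynomial.mem_support_iff.1 hd
  have h1 : MvPolynomial.C (P.coeff d)⁻¹ * P ∈
      Set.range (MvPolynomial.map (σ := ι) u.valuationSubring.toSubring.subtype) := by
    rw [MvPolynomial.mem_range_map_iff_coeffs_subset]
    intro a ha
    obtain ⟨e, he, rfl⟩ := MvPolynomial.mem_coeffs_iff.1 ha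
    rw [MvPolynomial.coeff_C_mul]
    refine ⟨⟨_, ?_⟩, rfl⟩
    change u ((P.coeff d)⁻¹ * P.coeff e) ≤ 1
    rw [_root_.map_mul, map_inv₀, inv_mul_eq_div]
    refine div_le_one_of_le₀ ?_ zero_le
    by_cases he0 : P.coeff e = 0
    · rw [he0, map_zero]
      exact zero_le
    · exact hmax e (MvPolynomial.mem_support_iff.2 he0)
  obtain ⟨q, hq⟩ := h1
  have h2 := coe_eval₂_integerMap u v hv (fun i ↦ (⟨m i, (hmr i).choose⟩ : v.valuationSubring)) q
  rw [hq, _root_.map_mul] at h2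
  have h2' : MvPolynomial.eval₂ (integerMap u v hv)
      (fun i ↦ (⟨m i, (hmr i).choose⟩ : v.valuationSubring)) q = 0 := by
    refine Subtype.ext (h2.trans ?_)
    change _ * MvPolynomial.aeval m P = 0
    rw [hP, mul_zero]
  have h3 : MvPolynomial.aeval r (MvPolynomial.map (resMap u) q) = 0 := by
    have h4 := congrArg (resMap v) h2'
    rw [map_zero, MvPolynomial.hom_eval₂] at h4
    rw [MvPolynomial.aeval_def, MvPolynomial.eval₂_map, ← h4]
    congr 1
    · ext c
      exact hgv c ((hv.le_one_iff_le_one (x := (c : C))).2 c.2)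
    · funext i
      exact (hmr i).choose_spec.symm
  have h5 := (algebraicIndependent_iff.1 hr) _ h3
  have h6 := congrArg (MvPolynomial.coeff d) h5
  rw [MvPolynomial.coeff_map, MvPolynomial.coeff_zero] at h6
  have h7 : MvPolynomial.coeff d q = 1 := by
    apply Subtype.ext
    have h8 := congrArg (MvPolynomial.coeff d) hq
    rw [MvPolynomial.coeff_map, MvPolynomial.coeff_C_mul, inv_mul_cancel₀ hc] at h8
    exact h8
  rw [h7, map_one] at h6
  exact one_ne_zero h6

/-- The transcendence degree of the residue field is at most that of the field. -/
theorem card_le_of_mem_resClosure [Algebra (ResF u) (ResF v)]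
    (hgv : ResCompat u v (algebraMap (ResF u) (ResF v)))
    (hv : (v.comap (algebraMap C K)).IsEquiv u) {n : ℕ} (x : Fin n → K)
    {ι : Type w} {r : ι → ResF v} (hr : AlgebraicIndependent (ResF u) r)
    (hrM : ∀ i, r i ∈ resClosure v (IntermediateField.adjoin C (Set.range x)).toSubfield) :
    Cardinal.mk ι ≤ n := by
  classical
  set M := IntermediateField.adjoin C (Set.range x) with hM
  let E₀ : IntermediateField (ResF u) (ResF v) :=
    { resField v M.toSubfield with
      algebraMap_mem' := by
        intro c
        obtain ⟨c, rfl⟩ := IsLocalRing.residue_surjective c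
        exact ⟨_, M.algebraMap_mem _, isRes_algebraMap hgv hv c⟩ }
  have htM : Algebra.trdeg C M ≤ n := trdeg_adjoin_range_le x
  have htE : Algebra.trdeg (ResF u) E₀ ≤ n := by
    have : FaithfulSMul (ResF u) E₀ :=
      (faithfulSMul_iff_algebraMap_injective _ _).2 (algebraMap (ResF u) E₀).injective
    obtain ⟨B, hB⟩ := exists_isTranscendenceBasis (ResF u) E₀
    rw [← hB.cardinalMk_eq_trdeg]
    have hB' : ∀ b : B, ∃ m ∈ M, IsRes v m (b : E₀) := fun b ↦ b.1.2
    choose m hm hmb using hB'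
    have h1 := algebraicIndependent_of_isRes hgv hv hmb
      ((AlgHom.algebraicIndependent_iff E₀.val Subtype.val_injective).2 hB.1)
    have h2 : AlgebraicIndependent C (fun b ↦ (⟨m b, hm b⟩ : M)) :=
      (AlgHom.algebraicIndependent_iff M.val Subtype.val_injective).1 h1
    exact h2.cardinalMk_le_trdeg.trans htM
  exact (AlgebraicIndependent.cardinalMk_le_trdeg_of_isAlgebraic E₀ hr
    fun i ↦ mem_algebraicClosure_iff.1 (hrM i)).trans htE

end

/-- Every finite system of equations and an inequation in `n` variables over `k` which is solvable
in `E` is solvable in `E'`. -/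
def SolTransfer (n : ℕ) (k E E' : Type*) [Field k] [Field E] [Field E'] [Algebra k E]
    [Algebra k E'] : Prop :=
  ∀ (F : Finset (MvPolynomial (Fin n) k)) (h : MvPolynomial (Fin n) k) (w : Fin n → E),
    (∀ f ∈ F, MvPolynomial.aeval w f = 0) → MvPolynomial.aeval w h ≠ 0 →
    ∃ w' : Fin n → E', (∀ f ∈ F, MvPolynomial.aeval w' f = 0) ∧ MvPolynomial.aeval w' h ≠ 0

section

variable {k E E' : Type*} [Field k] [Field E] [Field E'] [Algebra k E] [Algebra k E']

theorem SolTransfer.infinite {n : ℕ} (hn : n ≠ 0) (h : SolTransfer n k E E') [Infinite E] :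
    Infinite E' := by
  by_contra hf
  rw [not_infinite_iff_finite] at hf
  have := Fintype.ofFinite E'
  have hq := Fintype.one_lt_card (α := E')
  obtain ⟨a, ha⟩ : ∃ a : E, a ^ Fintype.card E' - a ≠ 0 := by
    by_contra! hall
    have h1 : (X ^ Fintype.card E' - X : E[X]) = 0 := by
      apply Polynomial.funext
      intro a
      simpa using hall a
    exact FiniteField.X_pow_card_sub_X_ne_zero E hq h1
  obtain ⟨w', -, hw'⟩ := h ∅ (MvPolynomial.X ⟨0, by lia⟩ ^ Fintype.card E' -
    MvPolynomial.X ⟨0, by lia⟩) (fun _ ↦ a) (by simp) (by simpa using ha)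
  simp [FiniteField.pow_card] at hw'

theorem mem_adjoin_range_iff_exists_ne_zero {ι : Type*} {w : ι → E} {t : E}
    (ht : t ∈ IntermediateField.adjoin k (Set.range w)) : ∃ a b : MvPolynomial ι k,
      MvPolynomial.aeval w b ≠ 0 ∧ t = MvPolynomial.aeval w a / MvPolynomial.aeval w b := by
  obtain ⟨a, b, rfl⟩ := IntermediateField.mem_adjoin_range_iff k w t |>.1 ht
  by_cases hb : MvPolynomial.aeval w b = 0
  · exact ⟨0, 1, by simp, by simp [hb]⟩
  · exact ⟨a, b, hb, rfl⟩

theorem exists_div_mem {G : Subalgebra k (E × E')} (hinv : ∀ x ∈ G, x.2 ≠ 0 → x⁻¹ ∈ G)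
    {x y : E × E'} (hx : x ∈ G) (hy : y ∈ G) (hy0 : y.2 ≠ 0) : ∃ t', (x.1 / y.1, t') ∈ G := by
  refine ⟨x.2 * y.2⁻¹, ?_⟩
  rw [div_eq_mul_inv]
  exact G.mul_mem hx (hinv y hy hy0)

theorem SolTransfer.exists_graph {n : ℕ} (h : SolTransfer n k E E') (w : Fin n → E) (T : Finset E)
    (hT : ∀ t ∈ T, t ∈ IntermediateField.adjoin k (Set.range w)) :
    ∃ G : Subalgebra k (E × E'), IsGraph G ∧
      (∀ x ∈ G, x.1 ∈ IntermediateField.adjoin k (Set.range w)) ∧ ∀ t ∈ T, ∃ t', (t, t') ∈ G := by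
  classical
  have hT' : ∀ t : T, ∃ a b : MvPolynomial (Fin n) k,
      MvPolynomial.aeval w b ≠ 0 ∧ t.1 = MvPolynomial.aeval w a / MvPolynomial.aeval w b :=
    fun t ↦ mem_adjoin_range_iff_exists_ne_zero (hT t t.2)
  choose a b hb hab using hT'
  obtain ⟨F, hF⟩ := IsNoetherian.noetherian
    (RingHom.ker (MvPolynomial.aeval (R := k) w).toRingHom)
  have hFw : ∀ f ∈ F, MvPolynomial.aeval w f = 0 := fun f hf ↦ by
    have h1 : f ∈ RingHom.ker (MvPolynomial.aeval (R := k) w).toRingHom := by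
      rw [← hF]
      exact Ideal.subset_span hf
    exact h1
  obtain ⟨w', hw', hbw'⟩ := h F (∏ t : T, b t) w hFw (by
    rw [map_prod]
    exact Finset.prod_ne_zero_iff.2 fun t _ ↦ hb t)
  have hker : ∀ f : MvPolynomial (Fin n) k, MvPolynomial.aeval w f = 0 →
      MvPolynomial.aeval w' f = 0 := by
    intro f hf
    have h1 : f ∈ RingHom.ker (MvPolynomial.aeval (R := k) w).toRingHom := hf
    rw [← hF] at h1
    have h2 : Submodule.span _ (F : Set (MvPolynomial (Fin n) k)) ≤
      RingHom.ker (MvPolynomial.aeval (R := k) w').toRingHom := Ideal.span_le.2 hw'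
    exact h2 h1
  have hG₀ : IsGraph ((MvPolynomial.aeval (R := k) w).prod (MvPolynomial.aeval w')).range := by
    rintro x ⟨f, rfl⟩ hf
    exact hker f hf
  obtain ⟨G, hG₀G, hG, hinv, hloc⟩ := hG₀.exists_localization
  refine ⟨G, hG, ?_, ?_⟩
  · intro x hx
    obtain ⟨_, ⟨f, rfl⟩, _, ⟨g, rfl⟩, -, hfg⟩ := hloc x hx
    rw [hfg]
    refine div_mem ?_ ?_
    · exact (IntermediateField.mem_adjoin_range_iff k w _).2 ⟨f, 1, by simp⟩
    · exact (IntermediateField.mem_adjoin_range_iff k w _).2 ⟨g, 1, by simp⟩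
  · intro t ht
    rw [show t = _ from hab ⟨t, ht⟩]
    exact exists_div_mem hinv (hG₀G ⟨a ⟨t, ht⟩, rfl⟩) (hG₀G ⟨b ⟨t, ht⟩, rfl⟩)
      (by
        rw [map_prod, Finset.prod_ne_zero_iff] at hbw'
        exact hbw' ⟨t, ht⟩ (Finset.mem_univ _))

end

section

variable {k E : Type*} [Field k] [Field E] [Algebra k E]

theorem exists_fin_adjoin_eq_top_of_hasSepTransBasis {n : ℕ} (h : HasSepTransBasis k E)
    (hfg : (⊤ : IntermediateField k E).FG) (hn : Algebra.trdeg k E ≤ n) :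
    ∃ w : Fin (n + 1) → E, IntermediateField.adjoin k (Set.range w) = ⊤ := by
  obtain ⟨s, hs, hsep⟩ := h
  have hsn : Cardinal.mk s ≤ n := hs.cardinalMk_le_trdeg.trans hn
  have hfin : Module.Finite (IntermediateField.adjoin k s) E := by
    obtain ⟨W, hW⟩ := hfg
    have h1 : IntermediateField.adjoin (IntermediateField.adjoin k s) (W : Set E) = ⊤ := by
      apply IntermediateField.restrictScalars_injective k
      rw [IntermediateField.adjoin_adjoin_left, IntermediateField.restrictScalars_top, eq_top_iff,
        ← hW]
      exact IntermediateField.adjoin.mono k _ _ Set.subset_union_right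
    have h2 := IntermediateField.finiteDimensional_adjoin (K := IntermediateField.adjoin k s)
      (S := (W : Set E)) fun x _ ↦ Algebra.IsIntegral.isIntegral x
    rw [h1] at h2
    exact Module.Finite.equiv (IntermediateField.topEquiv (F := IntermediateField.adjoin k s)
      (E := E)).toLinearEquiv
  obtain ⟨α, hα⟩ := Field.exists_primitive_element (IntermediateField.adjoin k s) E
  have h2 : IntermediateField.adjoin k (s ∪ {α}) = ⊤ := by
    rw [← IntermediateField.adjoin_adjoin_left, hα, IntermediateField.restrictScalars_top]
  have h3 : Cardinal.mk (s ∪ {α} : Set E) ≤ (n + 1 : ℕ) := by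
    refine (Cardinal.mk_union_le _ _).trans ?_
    rw [Cardinal.mk_singleton]
    push_cast
    gcongr
  have h4 : Cardinal.lift.{0} (Cardinal.mk (s ∪ {α} : Set E)) ≤
      Cardinal.lift (Cardinal.mk (Fin (n + 1))) := by
    simpa using h3
  obtain ⟨e⟩ := Cardinal.lift_mk_le'.1 h4
  have : Nonempty (s ∪ {α} : Set E) := ⟨α, by simp⟩
  refine ⟨fun i ↦ (Function.invFun e i : (s ∪ {α} : Set E)).1, ?_⟩
  rw [← h2]
  congr 1
  have h5 := (Set.range_comp Subtype.val (Function.invFun e)).trans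
    (congrArg _ (Function.invFun_surjective e.injective).range_eq)
  rw [Set.image_univ, Subtype.range_coe] at h5
  exact h5

end

section

variable {C : Type v} {K : Type w} {κ' : Type*} [Field C] [Field K] [Field κ'] [Algebra C K]
    {Γ₀ Γ : Type*} [LinearOrderedCommGroupWithZero Γ₀] [LinearOrderedCommGroupWithZero Γ]
    {u : Valuation C Γ₀} {v : Valuation K Γ} [Algebra (ResF u) (ResF v)] [Algebra (ResF u) κ']

theorem algebraMap_mem_resClosure (hgv : ResCompat u v (algebraMap (ResF u) (ResF v)))
    (hv : (v.comap (algebraMap C K)).IsEquiv u) (M : IntermediateField C K) (c : ResF u) :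
    algebraMap (ResF u) (ResF v) c ∈ resClosure v M.toSubfield := by
  obtain ⟨c, rfl⟩ := IsLocalRing.residue_surjective c
  exact mem_resClosure_of_isRes (M.algebraMap_mem c) (isRes_algebraMap hgv hv c)

theorem exists_graph_of_mem_resClosure (hgv : ResCompat u v (algebraMap (ResF u) (ResF v)))
    (hv : (v.comap (algebraMap C K)).IsEquiv u) (hsep : IsSepExt (ResF u) (ResF v)) {n : ℕ}
    (h : SolTransfer (n + 1) (ResF u) (ResF v) κ') (x : Fin n → K) (T : Finset (ResF v))
    (hT : ∀ t ∈ T, t ∈ resClosure v (IntermediateField.adjoin C (Set.range x)).toSubfield) :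
    ∃ G : Subalgebra (ResF u) (ResF v × κ'), IsGraph G ∧
      (∀ y ∈ G, y.1 ∈ resClosure v (IntermediateField.adjoin C (Set.range x)).toSubfield) ∧
      ∀ t ∈ T, ∃ t', (t, t') ∈ G := by
  let E := IntermediateField.adjoin (ResF u) (T : Set (ResF v))
  let R : IntermediateField (ResF u) (ResF v) :=
    { (resClosure v (IntermediateField.adjoin C (Set.range x)).toSubfield).toSubfield with
      algebraMap_mem' := algebraMap_mem_resClosure hgv hv _ }
  have hER : E ≤ R := IntermediateField.adjoin_le_iff.2 hT
  have hn : Algebra.trdeg (ResF u) E ≤ n := by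
    have : FaithfulSMul (ResF u) E :=
      (faithfulSMul_iff_algebraMap_injective _ _).2 (algebraMap (ResF u) E).injective
    obtain ⟨B, hB⟩ := exists_isTranscendenceBasis (ResF u) E
    rw [← hB.cardinalMk_eq_trdeg]
    exact card_le_of_mem_resClosure hgv hv x
      ((AlgHom.algebraicIndependent_iff E.val Subtype.val_injective).2 hB.1) fun b ↦ hER b.1.2
  obtain ⟨w, hw⟩ := exists_fin_adjoin_eq_top_of_hasSepTransBasis (hsep T)
    (IntermediateField.fg_top_iff.2 (IntermediateField.essFiniteType_iff.2
      (IntermediateField.fg_adjoin_finset T))) hn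
  have hw' : IntermediateField.adjoin (ResF u) (Set.range fun i ↦ (w i : ResF v)) = E := by
    have h1 := congrArg (IntermediateField.map E.val) hw
    rw [IntermediateField.adjoin_map, ← AlgHom.fieldRange_eq_map, IntermediateField.fieldRange_val,
      ← Set.range_comp] at h1
    exact h1
  obtain ⟨G, hG, hGw, hGT⟩ := h.exists_graph (fun i ↦ (w i : ResF v)) T
    fun t ht ↦ hw' ▸ IntermediateField.subset_adjoin _ _ ht
  exact ⟨G, hG, fun y hy ↦ hER (hw' ▸ hGw y hy), hGT⟩

end

section

variable {k S E E' : Type*} [Field k] [Field S] [Field E] [Field E'] [Algebra k E] [Algebra k E']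
    [Algebra S E]

theorem exists_graph_of_transcendental [Infinite E']
    (hS : ∀ W : Finset S, ∃ G : Subalgebra k (E × E'), IsGraph G ∧
      (∀ y ∈ G, y.1 ∈ (algebraMap S E).range) ∧ ∀ c ∈ W, ∃ c', (algebraMap S E c, c') ∈ G)
    {t : E} (ht : Transcendental S t) (T : Finset E)
    (hT : ∀ r ∈ T, ∃ P Q : S[X], aeval t Q ≠ 0 ∧ r = aeval t P / aeval t Q) :
    ∃ G : Subalgebra k (E × E'), IsGraph G ∧ ∀ r ∈ T, ∃ r', (r, r') ∈ G := by
  classical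
  choose! P Q hQ hPQ using hT
  obtain ⟨G, hG, hGS, hGW⟩ := hS (T.biUnion fun r ↦
    (P r).coeffs ∪ (Q r).coeffs ∪ {(Q r).leadingCoeff⁻¹})
  have hlift : ∀ P : S[X], (∀ c ∈ P.coeffs, ∃ c', (algebraMap S E c, c') ∈ G) →
      ∃ p : G[X], p.map (gFst G : G →+* E) = P.map (algebraMap S E) := by
    intro P hP
    rw [← Polynomial.mem_lifts, Polynomial.lifts_iff_coeff_lifts]
    intro i
    by_cases hi : P.coeff i = 0
    · exact ⟨0, by rw [map_zero, coeff_map, hi, map_zero]⟩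
    · obtain ⟨c', hc'⟩ := hP (P.coeff i) (Polynomial.coeff_mem_coeffs hi)
      exact ⟨⟨_, hc'⟩, by rw [coeff_map]; rfl⟩
  have hp : ∀ r ∈ T, ∃ p : G[X], p.map (gFst G : G →+* E) = (P r).map (algebraMap S E) :=
    fun r hr ↦ hlift _ fun c hc ↦ hGW c (Finset.mem_biUnion.2 ⟨r, hr, by simp [hc]⟩)
  have hq : ∀ r ∈ T, ∃ q : G[X], q.map (gFst G : G →+* E) = (Q r).map (algebraMap S E) :=
    fun r hr ↦ hlift _ fun c hc ↦ hGW c (Finset.mem_biUnion.2 ⟨r, hr, by simp [hc]⟩)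
  choose! p hp using hp
  choose! q hq using hq
  have hq0 : ∀ r ∈ T, (q r).map (gSnd G : G →+* E') ≠ 0 := by
    intro r hr h0
    obtain ⟨d', hd'⟩ := hGW (Q r).leadingCoeff⁻¹ (Finset.mem_biUnion.2 ⟨r, hr, by simp⟩)
    have h1 := G.mul_mem ((q r).coeff (Q r).natDegree).2 hd'
    have h2 : (((q r).coeff (Q r).natDegree : E × E') *
        (algebraMap S E (Q r).leadingCoeff⁻¹, d')).1 = (1 : E × E').1 := by
      have h3 := congrArg (fun f ↦ f.coeff (Q r).natDegree) (hq r hr)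
      rw [coeff_map, coeff_map] at h3
      change (gFst G : G →+* E) _ * _ = _
      rw [h3, ← _root_.map_mul]
      have h4 : (Q r).leadingCoeff ≠ 0 := by
        rw [Polynomial.leadingCoeff_ne_zero]
        rintro h4
        exact hQ r hr (by rw [h4, map_zero])
      change algebraMap S E ((Q r).leadingCoeff * _) = _
      rw [mul_inv_cancel₀ h4, map_one]
      rfl
    have h5 := hG.eq h1 G.one_mem h2
    have h6 := congrArg (fun f ↦ f.coeff (Q r).natDegree) h0
    rw [coeff_map, coeff_zero] at h6
    change (gSnd G : G →+* E') _ * _ = 1 at h5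
    rw [h6, zero_mul] at h5
    exact zero_ne_one h5
  obtain ⟨t', ht'⟩ : ∃ t' : E', (∏ r ∈ T, (q r).map (gSnd G : G →+* E')).eval t' ≠ 0 := by
    by_contra! hall
    exact Finset.prod_ne_zero_iff.2 hq0 (Polynomial.funext fun x ↦ by rw [hall, eval_zero])
  rw [eval_prod, Finset.prod_ne_zero_iff] at ht'
  obtain ⟨G₁, hG₁, hev, -⟩ := hG.exists_adjoin t t' (by
    intro f hf
    have h1 : f.map (gFst G : G →+* E) ∈ Polynomial.lifts (algebraMap S E) := by
      rw [Polynomial.lifts_iff_coeff_lifts]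
      intro i
      rw [coeff_map]
      exact hGS _ (f.coeff i).2
    obtain ⟨g, hg⟩ := (Polynomial.mem_lifts _).1 h1
    rw [← hg, eval_map_algebraMap] at hf
    have hg0 : g = 0 := by
      by_contra hg0
      exact ht ⟨g, hg0, hf⟩
    rw [hg0, Polynomial.map_zero] at hg
    have hf0 : f = 0 := Polynomial.map_injective (gFst G : G →+* E) hG.injective (by
      rw [← hg, Polynomial.map_zero])
    rw [hf0, Polynomial.map_zero, eval_zero])
  obtain ⟨G₂, hG₁₂, hG₂, hinv, -⟩ := hG₁.exists_localization
  refine ⟨G₂, hG₂, fun r hr ↦ ?_⟩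
  have h1 := exists_div_mem hinv (hG₁₂ (hev (p r))) (hG₁₂ (hev (q r))) (ht' r hr)
  rw [hp r hr, hq r hr, eval_map_algebraMap, eval_map_algebraMap, ← hPQ r hr] at h1
  exact h1

end

section

variable {C : Type v} {K : Type w} {κ' : Type*} [Field C] [Field K] [Field κ'] [Algebra C K]
    {Γ₀ Γ : Type*} [LinearOrderedCommGroupWithZero Γ₀] [LinearOrderedCommGroupWithZero Γ]
    {u : Valuation C Γ₀} {v : Valuation K Γ} [Algebra (ResF u) (ResF v)] [Algebra (ResF u) κ']

theorem exists_aeval_div_of_mem_adjoin {n : ℕ} (x : Fin (n + 1) → K) {d : K}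
    (hd : d ∈ IntermediateField.adjoin C (Set.range x)) :
    ∃ g h : (IntermediateField.adjoin C (Set.range fun i : Fin n ↦ x i.castSucc)).toSubfield[X],
      aeval (x (Fin.last n)) h ≠ 0 ∧ d = aeval (x (Fin.last n)) g / aeval (x (Fin.last n)) h := by
  set M := (IntermediateField.adjoin C (Set.range fun i : Fin n ↦ x i.castSucc)).toSubfield
  let R : IntermediateField C K :=
    { (IntermediateField.adjoin M {x (Fin.last n)}).toSubfield with
      algebraMap_mem' := fun c ↦ (IntermediateField.adjoin M {x (Fin.last n)}).algebraMap_mem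
        ⟨algebraMap C K c, IntermediateField.algebraMap_mem _ c⟩ }
  have hR : IntermediateField.adjoin C (Set.range x) ≤ R := by
    rw [IntermediateField.adjoin_le_iff]
    rintro _ ⟨i, rfl⟩
    induction i using Fin.lastCases with
    | last => exact IntermediateField.mem_adjoin_simple_self M (x (Fin.last n))
    | cast i =>
      exact (IntermediateField.adjoin M {x (Fin.last n)}).algebraMap_mem
        ⟨x i.castSucc, IntermediateField.subset_adjoin C _ ⟨i, rfl⟩⟩
  obtain ⟨g, h, hgh⟩ := (IntermediateField.mem_adjoin_simple_iff M d).1 (hR hd)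
  by_cases h0 : aeval (x (Fin.last n)) h = 0
  · exact ⟨0, 1, by simp, by rw [hgh, h0, map_zero, div_zero, zero_div]⟩
  · exact ⟨g, h, h0, hgh⟩

theorem exists_graph_of_mem_resField (hgv : ResCompat u v (algebraMap (ResF u) (ResF v)))
    (hv : (v.comap (algebraMap C K)).IsEquiv u) (hsep : IsSepExt (ResF u) (ResF v)) {π : C}
    (hπ0 : 0 < v (algebraMap C K π)) (hπ1 : v (algebraMap C K π) < 1) {n : ℕ}
    (h : SolTransfer n (ResF u) (ResF v) κ') (x : Fin n → K)
    (hdisc : ∀ d ∈ IntermediateField.adjoin C (Set.range x), d ≠ 0 →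
      ∃ m : ℤ, v d = v (algebraMap C K π) ^ m) (T : Finset (ResF v))
    (hT : ∀ t ∈ T, t ∈ resField v (IntermediateField.adjoin C (Set.range x)).toSubfield) :
    ∃ G : Subalgebra (ResF u) (ResF v × κ'), IsGraph G ∧ ∀ t ∈ T, ∃ t', (t, t') ∈ G := by
  classical
  cases n with
  | zero =>
    refine ⟨⊥, ?_, ?_⟩
    · intro y hy h0
      obtain ⟨c, rfl⟩ := Algebra.mem_bot.1 hy
      have h1 : algebraMap (ResF u) (ResF v) c = 0 := h0
      rw [map_eq_zero] at h1
      rw [h1, map_zero]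
      rfl
    · intro t ht
      obtain ⟨d, hd, hdt⟩ := hT t ht
      have hd' : d ∈ IntermediateField.adjoin C (Set.range x) := hd
      rw [Set.range_eq_empty, IntermediateField.adjoin_empty] at hd'
      obtain ⟨c, rfl⟩ := IntermediateField.mem_bot.1 hd'
      have hc : u c ≤ 1 := (hv.le_one_iff_le_one (x := c)).1 hdt.choose
      refine ⟨algebraMap (ResF u) κ' (resMap u ⟨c, hc⟩), ?_⟩
      rw [hdt.unique (isRes_algebraMap hgv hv ⟨c, hc⟩)]
      exact Subalgebra.algebraMap_mem _ _
  | succ n =>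
    set M := IntermediateField.adjoin C (Set.range fun i : Fin n ↦ x i.castSucc) with hM
    have hMx : M ≤ IntermediateField.adjoin C (Set.range x) := by
      refine IntermediateField.adjoin.mono _ _ _ ?_
      rintro _ ⟨i, rfl⟩
      exact ⟨_, rfl⟩
    obtain hA | ⟨t, ht, hB⟩ := ruled_residue (v := v) (M := M.toSubfield) (π := algebraMap C K π)
      (M.algebraMap_mem π) hπ0 hπ1 (x := x (Fin.last n)) (by
        intro g hg
        refine hdisc _ ?_ hg
        rw [aeval_eq_sum_range]
        refine sum_mem fun i _ ↦ ?_
        exact mul_mem (hMx (g.coeff i).2) (pow_mem (IntermediateField.subset_adjoin C _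
          (Set.mem_range_self (Fin.last n))) _))
      (D := (IntermediateField.adjoin C (Set.range x)).toSubfield)
      (fun d hd ↦ exists_aeval_div_of_mem_adjoin x hd)
    · obtain ⟨G, hG, -, hGT⟩ := exists_graph_of_mem_resClosure hgv hv hsep h _ T
        fun t htT ↦ hA t (hT t htT)
      exact ⟨G, hG, hGT⟩
    · have : Infinite (ResF v) := by
        refine Infinite.of_injective (fun i : ℕ ↦ t ^ i) fun i j hij ↦ ?_
        by_contra hne
        have h1 : (X ^ i - X ^ j : (resClosure v M.toSubfield)[X]) ≠ 0 := by
          rw [sub_ne_zero]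
          intro h2
          exact hne (by simpa using congrArg natDegree h2)
        exact ht ⟨_, h1, by simpa [sub_eq_zero] using hij⟩
      have := h.infinite n.succ_ne_zero
      refine exists_graph_of_transcendental (S := resClosure v M.toSubfield) ?_ ht T
        fun r hr ↦ hB r (hT r hr)
      intro W
      obtain ⟨G, hG, hGR, hGW⟩ := exists_graph_of_mem_resClosure hgv hv hsep h
        (fun i : Fin n ↦ x i.castSucc) (W.image (algebraMap _ _)) (by
          intro t ht
          obtain ⟨c, -, rfl⟩ := Finset.mem_image.1 ht
          exact c.2)
      exact ⟨G, hG, fun y hy ↦ ⟨⟨_, hGR y hy⟩, rfl⟩,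
        fun c hc ↦ hGW _ (Finset.mem_image_of_mem _ hc)⟩

end

section

variable {k A B : Type*} [Field k] [Field A] [Field B] [Algebra k A] [Algebra k B]

theorem HasSepTransBasis.of_algEquiv (e : A ≃ₐ[k] B) (h : HasSepTransBasis k A) :
    HasSepTransBasis k B := by
  obtain ⟨s, hs, hsep⟩ := h
  have h1 : (IntermediateField.adjoin k s).map e.toAlgHom = IntermediateField.adjoin k (e '' s) :=
    IntermediateField.adjoin_map _ _ _
  refine ⟨e '' s, ?_, ?_⟩
  · exact ((AlgHom.algebraicIndependent_iff e.toAlgHom e.injective).2 hs).image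
  · let e₁ := ((IntermediateField.adjoin k s).equivMap e.toAlgHom).trans
      (IntermediateField.equivOfEq h1)
    exact Algebra.IsSeparable.of_equiv_equiv (A₁ := IntermediateField.adjoin k s) (B₁ := A)
      e₁.toRingEquiv e.toRingEquiv (by ext; rfl)

theorem IsSepExt.of_algHom (f : A →ₐ[k] B) (h : IsSepExt k B) : IsSepExt k A := by
  classical
  intro s
  have h1 : (IntermediateField.adjoin k (s : Set A)).map f =
      IntermediateField.adjoin k ((s.image f : Finset B) : Set B) := by
    rw [IntermediateField.adjoin_map, Finset.coe_image]
  exact (h (s.image f)).of_algEquiv (((IntermediateField.adjoin k (s : Set A)).equivMap f).trans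
    (IntermediateField.equivOfEq h1)).symm

theorem IsGraph.comap {E : Type*} [Field E] [Algebra k E] (f : A →ₐ[k] B)
    {G : Subalgebra k (B × E)} (hG : IsGraph G) :
    IsGraph (G.comap (f.prodMap (AlgHom.id k E))) := by
  intro x hx h0
  exact hG _ hx (by
    change f x.1 = 0
    rw [h0, map_zero])

end

section

variable {C K M : Type*} [Field C] [Field K] [Field M] [Algebra C K] [Algebra C M]
    {Γ₀ Γ Γ' : Type*} [LinearOrderedCommGroupWithZero Γ₀] [LinearOrderedCommGroupWithZero Γ]
    [LinearOrderedCommGroupWithZero Γ'] {u : Valuation C Γ₀} {v : Valuation K Γ}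
    {w : Valuation M Γ'}

theorem SignSpec.exists_same_signs {S : Set K} (h : SignSpec C v w S) {ι : Type*} (x : ι → K)
    (hx : ∀ i, x i ∈ S) (F : Set (MvPolynomial ι C)) (hF : ∀ f ∈ F, MvPolynomial.aeval x f ∈ S) :
    ∃ y : ι → M, ∀ f ∈ F, (MvPolynomial.aeval x f = 0 ↔ MvPolynomial.aeval y f = 0) ∧
      (v (MvPolynomial.aeval x f) ≤ 1 ↔ w (MvPolynomial.aeval y f) ≤ 1) := by
  obtain ⟨G, hG, hS⟩ := h
  choose s' hsG hs0 hsO using hS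
  refine ⟨fun i ↦ s' (x i) (hx i), fun f hf ↦ ?_⟩
  have h1 : ∀ f : MvPolynomial ι C, (MvPolynomial.aeval x f,
      MvPolynomial.aeval (fun i ↦ s' (x i) (hx i)) f) ∈ G := by
    intro f
    induction f using MvPolynomial.induction_on with
    | C c =>
      rw [MvPolynomial.aeval_C, MvPolynomial.aeval_C]
      exact G.algebraMap_mem c
    | add p q hp hq =>
      rw [map_add, map_add]
      exact G.add_mem hp hq
    | mul_X p i hp =>
      rw [_root_.map_mul, _root_.map_mul, MvPolynomial.aeval_X, MvPolynomial.aeval_X]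
      exact G.mul_mem hp (hsG _ _)
  have h2 : MvPolynomial.aeval (fun i ↦ s' (x i) (hx i)) f = s' _ (hF f hf) :=
    hG.eq (h1 f) (hsG _ (hF f hf)) rfl
  refine ⟨⟨fun h0 ↦ hG _ (h1 f) h0, fun h0 ↦ hs0 _ (hF f hf) (h2 ▸ h0)⟩, ?_⟩
  rw [h2]
  exact hsO _ (hF f hf)

/-- The map of residue fields induced by an extension of valued fields. -/
noncomputable def residueMap (hv : (v.comap (algebraMap C K)).IsEquiv u) : ResF u →+* ResF v :=
  haveI : IsLocalHom (integerMap u v hv) := by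
    refine ⟨fun a ha ↦ ?_⟩
    by_contra h
    have h1 : u (a : C) < 1 := by
      rwa [← mem_nonunits_iff, ← IsLocalRing.mem_maximalIdeal, Valuation.mem_maximalIdeal_iff] at h
    have h2 : v (algebraMap C K a) < 1 := (hv.lt_one_iff_lt_one (x := (a : C))).2 h1
    have h3 : integerMap u v hv a ∈ IsLocalRing.maximalIdeal v.valuationSubring := by
      rw [Valuation.mem_maximalIdeal_iff]
      exact h2
    exact (IsLocalRing.mem_maximalIdeal _).1 h3 ha
  IsLocalRing.ResidueField.map (integerMap u v hv)

theorem residueMap_resMap (hv : (v.comap (algebraMap C K)).IsEquiv u) (c : u.valuationSubring) :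
    residueMap hv (resMap u c) = resMap v (integerMap u v hv c) := rfl

end

section

variable {C : Type v} {K : Type w} {M : Type*} [Field C] [Field K] [Field M] [Algebra C K]
    [Algebra C M] {Γ₀ Γ Γ' : Type*} [LinearOrderedCommGroupWithZero Γ₀]
    [LinearOrderedCommGroupWithZero Γ] [LinearOrderedCommGroupWithZero Γ']
    {u : Valuation C Γ₀} {v : Valuation K Γ} {w : Valuation M Γ'}

theorem IsUniformizer.of_comap {E : Type*} [Field E] [Algebra E K] {π : E}
    (h : IsUniformizer v (algebraMap E K π)) : IsUniformizer (v.comap (algebraMap E K)) π :=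
  ⟨h.1, h.2.1, fun x hx ↦ h.2.2 _ hx⟩

theorem residueMap_algebraMap [Algebra (ResF u) (ResF v)]
    (hgv : ResCompat u v (algebraMap (ResF u) (ResF v))) (D : IntermediateField C K)
    (hD : ((v.comap (algebraMap D K)).comap (algebraMap C D)).IsEquiv u) (c : ResF u) :
    residueMap (u := v.comap (algebraMap D K)) (v := v) Valuation.IsEquiv.refl
      (residueMap hD c) = algebraMap (ResF u) (ResF v) c := by
  obtain ⟨c, rfl⟩ := IsLocalRing.residue_surjective c
  rw [residueMap_resMap, residueMap_resMap, hgv c ((hD.le_one_iff_le_one (x := (c : C))).2 c.2)]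
  rfl

variable [CharZero K] [Algebra (ResF u) (ResF v)] [Algebra (ResF u) (ResF w)]

theorem signSpec_of_discrete (hgv : ResCompat u v (algebraMap (ResF u) (ResF v)))
    (hgw : ResCompat u w (algebraMap (ResF u) (ResF w)))
    (hv : (v.comap (algebraMap C K)).IsEquiv u) (hw : (w.comap (algebraMap C M)).IsEquiv u)
    {π : C} (hu : IsUniformizer u π) (hπv : IsUniformizer v (algebraMap C K π))
    (hπw : IsUniformizer w (algebraMap C M π)) (harch : ∀ c : C, ∃ k : ℕ, u (π ^ k * c) ≤ 1)
    (hsep : IsSepExt (ResF u) (ResF v)) {n : ℕ} (h : SolTransfer n (ResF u) (ResF v) (ResF w))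
    (H : HenselProp₀ w) (x : Fin n → K)
    (hdisc : ∀ d ∈ IntermediateField.adjoin C (Set.range x), d ≠ 0 →
      ∃ m : ℤ, v d = v (algebraMap C K π) ^ m)
    (F : Finset (MvPolynomial (Fin n) C)) :
    ∃ y : Fin n → M, ∀ f ∈ F, (MvPolynomial.aeval x f = 0 ↔ MvPolynomial.aeval y f = 0) ∧
      (v (MvPolynomial.aeval x f) ≤ 1 ↔ w (MvPolynomial.aeval y f) ≤ 1) := by
  classical
  set D := IntermediateField.adjoin C (Set.range x) with hDdef
  let vD := v.comap (algebraMap D K)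
  have hvD : (vD.comap (algebraMap C D)).IsEquiv u := hv
  letI : Algebra (ResF u) (ResF vD) := (residueMap hvD).toAlgebra
  let f : ResF vD →ₐ[ResF u] ResF v :=
    { residueMap (u := vD) (v := v) Valuation.IsEquiv.refl with
      commutes' := residueMap_algebraMap hgv D hvD }
  have hgD : ResCompat u vD (algebraMap (ResF u) (ResF vD)) := fun c hc ↦ residueMap_resMap hvD c
  have hdiscD : ∀ d : D, d ≠ 0 → ∃ m : ℤ, vD d = vD (algebraMap C D π) ^ m := fun d hd ↦
    hdisc d d.2 (by simpa using hd)
  have hπD : IsUniformizer vD (algebraMap C D π) := IsUniformizer.of_comap hπv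
  have hf : ∀ t : ResF vD, f t ∈ resField v D.toSubfield := by
    intro t
    obtain ⟨d, rfl⟩ := IsLocalRing.residue_surjective t
    exact ⟨(d : D), (d : D).2, d.2, rfl⟩
  have happ : HasApprox C vD w π := by
    refine hasApprox_of_formallySmooth hvD hw hu hπD hπw harch hdiscD hgD hgw
      (IsSepExt.of_algHom f hsep).formallySmooth fun T ↦ ?_
    obtain ⟨G, hG, hGT⟩ := exists_graph_of_mem_resField hgv hv hsep hπv.1 hπv.2.1 h x hdisc
      (T.image f) (by
        intro t ht
        obtain ⟨t, -, rfl⟩ := Finset.mem_image.1 ht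
        exact hf t)
    refine ⟨_, IsGraph.comap f hG, fun t ht ↦ ?_⟩
    exact hGT _ (Finset.mem_image_of_mem f ht)
  let xD : Fin n → D := fun i ↦ ⟨x i, IntermediateField.subset_adjoin C _ ⟨i, rfl⟩⟩
  let S : Finset D := Finset.univ.image xD ∪ F.image fun f ↦ MvPolynomial.aeval xD f
  have hS : IntermediateField.adjoin C (S : Set D) = ⊤ := by
    refine top_le_iff.1 ((adjoin_range_mk_eq_top x).ge.trans (IntermediateField.adjoin.mono _ _ _ ?_))
    rintro _ ⟨i, rfl⟩
    simp [S, xD]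
  have harch' : ∀ c : C, ∃ k : ℕ, w (algebraMap C M π) ^ k * w (algebraMap C M c) ≤ 1 := by
    intro c
    obtain ⟨k, hk⟩ := harch c
    refine ⟨k, ?_⟩
    have := (hw.le_one_iff_le_one (x := π ^ k * c)).2 hk
    simpa using this
  haveI : CharZero D := ((algebraMap D K).charZero_iff (algebraMap D K).injective).2 inferInstance
  have hspec := signSpec_of_hasApprox happ H hπD.1 hπD.2.1 hπw.1 hπw.2.1 harch' hdiscD S hS
  obtain ⟨y, hy⟩ := hspec.exists_same_signs xD (fun i ↦ by simp [S]) (F : Set _)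
    (fun f hf ↦ by
      refine Finset.mem_union_right _ (Finset.mem_image_of_mem _ hf))
  refine ⟨y, fun f hf ↦ ?_⟩
  have hx : MvPolynomial.aeval x f = (MvPolynomial.aeval xD f : D) := by
    change MvPolynomial.aeval (fun i ↦ D.val (xD i)) f = D.val (MvPolynomial.aeval xD f)
    rw [← MvPolynomial.comp_aeval_apply]
  rw [hx]
  refine ⟨?_, (hy f hf).2⟩
  rw [← (hy f hf).1]
  simp

theorem exists_same_signs (hgv : ResCompat u v (algebraMap (ResF u) (ResF v)))
    (hgw : ResCompat u w (algebraMap (ResF u) (ResF w)))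
    (hv : (v.comap (algebraMap C K)).IsEquiv u) (hw : (w.comap (algebraMap C M)).IsEquiv u)
    {π : C} (hu : IsUniformizer u π) (hπv : IsUniformizer v (algebraMap C K π))
    (hπw : IsUniformizer w (algebraMap C M π)) (harch : ∀ c : C, ∃ k : ℕ, u (π ^ k * c) ≤ 1)
    (hsep : IsSepExt (ResF u) (ResF v)) {n : ℕ} (h : SolTransfer n (ResF u) (ResF v) (ResF w))
    (Hv : HenselProp₀ v) (Hw : HenselProp₀ w) (x : Fin n → K)
    (F : Finset (MvPolynomial (Fin n) C)) :
    ∃ y : Fin n → M, ∀ f ∈ F, (MvPolynomial.aeval x f = 0 ↔ MvPolynomial.aeval y f = 0) ∧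
      (v (MvPolynomial.aeval x f) ≤ 1 ↔ w (MvPolynomial.aeval y f) ≤ 1) := by
  classical
  obtain ⟨E, hE, hsign⟩ := exists_discrete_subfield v Hv π hπv (fun c ↦ by
    obtain ⟨k, hk⟩ := harch c
    refine ⟨k, ?_⟩
    have := (hv.le_one_iff_le_one (x := π ^ k * c)).2 hk
    rw [mul_comm]
    simpa using this)
  obtain ⟨x', hx'⟩ := (hsign (Set.range x ∪ (fun f ↦ MvPolynomial.aeval x f) '' (F : Set _))
    ((Set.finite_range x).union (F.finite_toSet.image _))).exists_same_signs x
    (fun i ↦ Or.inl ⟨i, rfl⟩) (F : Set _) (fun f hf ↦ Or.inr ⟨f, hf, rfl⟩)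
  obtain ⟨y, hy⟩ := signSpec_of_discrete hgv hgw hv hw hu hπv hπw harch hsep h Hw
    (fun i ↦ (x' i : K)) (fun d hd ↦ hE d (by
      refine (IntermediateField.adjoin_le_iff.2 ?_) hd
      rintro _ ⟨i, rfl⟩
      exact (x' i).2)) F
  refine ⟨y, fun f hf ↦ ?_⟩
  have hx : MvPolynomial.aeval (fun i ↦ (x' i : K)) f = (MvPolynomial.aeval x' f : E) := by
    change MvPolynomial.aeval (fun i ↦ E.val (x' i)) f = E.val (MvPolynomial.aeval x' f)
    rw [← MvPolynomial.comp_aeval_apply]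
  have h1 := hx' f hf
  have h2 := hy f hf
  rw [hx] at h2
  refine ⟨h1.1.trans (Iff.trans ?_ h2.1), h1.2.trans h2.2⟩
  simp

end

section

variable {C : Type u} [Field C]

theorem exists_aeval_eq_realize_val {k : ℕ} (t : (Lval[[C]]).Term (Empty ⊕ Fin k)) :
    ∃ f : MvPolynomial (Fin k) C, ∀ (M : Type u) [Field M] [Algebra C M] (O : Set M)
      (e : Empty → M) (x : Fin k → M), letI := valConStructure O (algebraMap C M)
      t.realize (Sum.elim e x) = MvPolynomial.aeval x f := by
  induction t with
  | var a =>
    rcases a with a | i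
    · exact a.elim
    · exact ⟨MvPolynomial.X i, fun M _ _ O e x ↦ by simp⟩
  | @func l g ts ih =>
    choose f hf using ih
    rcases g with (g | g) | g
    · cases g with
      | add =>
        refine ⟨f 0 + f 1, fun M _ _ O e x ↦ ?_⟩
        rw [map_add, ← hf 0 M O e x, ← hf 1 M O e x]
        rfl
      | mul =>
        refine ⟨f 0 * f 1, fun M _ _ O e x ↦ ?_⟩
        rw [_root_.map_mul, ← hf 0 M O e x, ← hf 1 M O e x]
        rfl
      | neg =>
        refine ⟨-f 0, fun M _ _ O e x ↦ ?_⟩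
        rw [map_neg, ← hf 0 M O e x]
        rfl
      | zero =>
        refine ⟨0, fun M _ _ O e x ↦ ?_⟩
        rw [map_zero]
        rfl
      | one =>
        refine ⟨1, fun M _ _ O e x ↦ ?_⟩
        rw [map_one]
        rfl
    · exact g.elim
    · match l, g with
      | 0, c =>
        refine ⟨MvPolynomial.C c, fun M _ _ O e x ↦ ?_⟩
        exact (MvPolynomial.aeval_C x (show C from c)).symm

theorem exists_realize_eq_aeval_ring {k : ℕ} (f : MvPolynomial (Fin k) C) :
    ∃ t : (Language.ring[[C]]).Term (Empty ⊕ Fin k), ∀ (M : Type u) [Field M] [Algebra C M]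
      (e : Empty → M) (x : Fin k → M), letI := ringConStructure (algebraMap C M)
      t.realize (Sum.elim e x) = MvPolynomial.aeval x f := by
  induction f using MvPolynomial.induction_on with
  | C c =>
    refine ⟨Term.func (l := 0) (Sum.inr c) Fin.elim0, fun M _ _ e x ↦ ?_⟩
    rw [MvPolynomial.aeval_C]
    rfl
  | add p q hp hq =>
    obtain ⟨t, ht⟩ := hp
    obtain ⟨s, hs⟩ := hq
    refine ⟨Term.func (l := 2) (Sum.inl ringFunc.add) ![t, s], fun M _ _ e x ↦ ?_⟩
    rw [map_add, ← ht M e x, ← hs M e x]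
    rfl
  | mul_X p i hp =>
    obtain ⟨t, ht⟩ := hp
    refine ⟨Term.func (l := 2) (Sum.inl ringFunc.mul) ![t, Term.var (Sum.inr i)],
      fun M _ _ e x ↦ ?_⟩
    rw [_root_.map_mul, ← ht M e x, MvPolynomial.aeval_X]
    rfl

/-- `x` and `y` give the same signs to the polynomials in `F`. -/
def SameSigns {K L : Type*} [Field K] [Field L] [Algebra C K] [Algebra C L] (O : Set K)
    (O' : Set L) {k : ℕ} (F : Finset (MvPolynomial (Fin k) C)) (x : Fin k → K) (y : Fin k → L) :
    Prop :=
  ∀ f ∈ F, (MvPolynomial.aeval x f = 0 ↔ MvPolynomial.aeval y f = 0) ∧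
      (MvPolynomial.aeval x f ∈ O ↔ MvPolynomial.aeval y f ∈ O')

theorem exists_signs_of_isQF {k : ℕ} {φ : (Lval[[C]]).BoundedFormula Empty k} (hφ : φ.IsQF) :
    ∃ F : Finset (MvPolynomial (Fin k) C), ∀ (K L : Type u) [Field K] [Field L] [Algebra C K]
      [Algebra C L] (O : Set K) (O' : Set L) (e : Empty → K) (e' : Empty → L) (x : Fin k → K)
      (y : Fin k → L), SameSigns O O' F x y →
      (@BoundedFormula.Realize _ K (valConStructure O (algebraMap C K)) _ _ φ e x ↔
        @BoundedFormula.Realize _ L (valConStructure O' (algebraMap C L)) _ _ φ e' y) := by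
  classical
  induction hφ with
  | falsum => exact ⟨∅, fun K L _ _ _ _ O O' e e' x y h ↦ Iff.rfl⟩
  | of_isAtomic h =>
    cases h with
    | equal t s =>
      obtain ⟨f, hf⟩ := exists_aeval_eq_realize_val t
      obtain ⟨g, hg⟩ := exists_aeval_eq_realize_val s
      refine ⟨{f - g}, fun K L _ _ _ _ O O' e e' x y h ↦ ?_⟩
      have h1 := (h (f - g) (Finset.mem_singleton_self _)).1
      rw [map_sub, map_sub, sub_eq_zero, sub_eq_zero, ← hf K O e x, ← hf L O' e' y,
        ← hg K O e x, ← hg L O' e' y] at h1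
      exact h1
    | @rel l R ts =>
      rcases R with (R | R) | R
      · exact R.elim
      · cases R
        obtain ⟨f, hf⟩ := exists_aeval_eq_realize_val (ts 0)
        refine ⟨{f}, fun K L _ _ _ _ O O' e e' x y h ↦ ?_⟩
        have h1 := (h f (Finset.mem_singleton_self _)).2
        rw [← hf K O e x, ← hf L O' e' y] at h1
        exact h1
      · exact R.elim
  | imp _ _ ih₁ ih₂ =>
    obtain ⟨F, hF⟩ := ih₁
    obtain ⟨G, hG⟩ := ih₂
    refine ⟨F ∪ G, fun K L _ _ _ _ O O' e e' x y h ↦ ?_⟩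
    letI := valConStructure O (algebraMap C K)
    letI := valConStructure O' (algebraMap C L)
    rw [BoundedFormula.realize_imp, BoundedFormula.realize_imp]
    exact imp_congr (hF K L O O' e e' x y fun f hf ↦ h f (Finset.mem_union_left _ hf))
      (hG K L O O' e e' x y fun f hf ↦ h f (Finset.mem_union_right _ hf))

variable {K L : Type u} [Field K] [Field L] [Algebra C K] [Algebra C L] {O : Set K} {O' : Set L}

theorem IsExistsN.exists_signs {n m k : ℕ} {φ : (Lval[[C]]).BoundedFormula Empty k}
    (hφ : IsExistsN m φ) (hn : k + m ≤ n) (e : Empty → K) (e' : Empty → L) (x : Fin k → K)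
    (h : @BoundedFormula.Realize _ K (valConStructure O (algebraMap C K)) _ _ φ e x) :
    ∃ (F : Finset (MvPolynomial (Fin n) C)) (x' : Fin n → K), ∀ y : Fin n → L,
      SameSigns O O' F x' y →
      @BoundedFormula.Realize _ L (valConStructure O' (algebraMap C L)) _ _ φ e'
        (fun i ↦ y (Fin.castLE (Nat.le_of_add_right_le hn) i)) := by
  classical
  induction hφ with
  | @qf m k φ hφ =>
    obtain ⟨F, hF⟩ := exists_signs_of_isQF hφ
    have hk : k ≤ n := Nat.le_of_add_right_le hn
    refine ⟨F.image (MvPolynomial.rename (Fin.castLE hk)),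
      fun i ↦ if hi : (i : ℕ) < k then x ⟨i, hi⟩ else 0, fun y hy ↦ ?_⟩
    refine (hF K L O O' e e' x _ fun f hf ↦ ?_).1 h
    have h1 := hy _ (Finset.mem_image_of_mem _ hf)
    rw [MvPolynomial.aeval_rename, MvPolynomial.aeval_rename] at h1
    have h2 : (fun i : Fin n ↦ if hi : (i : ℕ) < k then x ⟨i, hi⟩ else 0) ∘ Fin.castLE hk = x := by
      ext i
      simp
    rwa [h2] at h1
  | @ex m k φ _ ih =>
    letI := valConStructure O (algebraMap C K)
    letI := valConStructure O' (algebraMap C L)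
    rw [BoundedFormula.realize_ex] at h
    obtain ⟨a, ha⟩ := h
    obtain ⟨F, x', hF⟩ := ih (by omega) (Fin.snoc x a) ha
    refine ⟨F, x', fun y hy ↦ ?_⟩
    rw [BoundedFormula.realize_ex]
    refine ⟨y ⟨k, by omega⟩, ?_⟩
    convert hF y hy using 1
    ext i
    induction i using Fin.lastCases with
    | last => rw [Fin.snoc_last]; rfl
    | cast i => rw [Fin.snoc_castSucc]; rfl

theorem thValSub_of_sameSigns {n : ℕ} (h : ∀ (x : Fin n → K) (F : Finset (MvPolynomial (Fin n) C)),
    ∃ y : Fin n → L, SameSigns O O' F x y) :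
    ThValSub (fun {_} φ => IsExistsN n φ) K O (algebraMap C K) L O' (algebraMap C L) := by
  suffices H : ∀ {k : ℕ} (φ : (Lval[[C]]).BoundedFormula Empty k), k = 0 →
      IsPosBC (fun {_} φ => IsExistsN n φ) φ → ∀ (e : Empty → K) (e' : Empty → L) (x : Fin k → K)
      (y : Fin k → L),
      @BoundedFormula.Realize _ K (valConStructure O (algebraMap C K)) _ _ φ e x →
      @BoundedFormula.Realize _ L (valConStructure O' (algebraMap C L)) _ _ φ e' y from
    fun φ hφ ↦ H φ rfl hφ _ _ _ _
  intro k φ hk hφ e e'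
  letI := valConStructure O (algebraMap C K)
  letI := valConStructure O' (algebraMap C L)
  intro x y hx
  induction hφ with
  | base hφ =>
    subst hk
    obtain ⟨F, x', hF⟩ := IsExistsN.exists_signs (O' := O') hφ (zero_add n).le e e' x hx
    obtain ⟨y', hy'⟩ := h x' F
    convert hF y' hy' using 1
  | inf _ _ ih₁ ih₂ =>
    rw [BoundedFormula.realize_inf] at hx ⊢
    exact ⟨ih₁ hx.1, ih₂ hx.2⟩
  | sup _ _ ih₁ ih₂ =>
    rw [BoundedFormula.realize_sup] at hx ⊢
    exact hx.imp ih₁ ih₂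

theorem isExistsN_exs {L : Language} {α : Type*} {k : ℕ} : ∀ {m : ℕ} {φ : L.BoundedFormula α k},
    IsExistsN m φ → IsExistsN (m + k) φ.exs := by
  induction k with
  | zero => exact fun h ↦ h
  | succ k ih =>
    intro m φ h
    have h1 := ih h.ex
    rwa [Nat.add_right_comm] at h1

theorem exists_isQF_forall_eq_zero {n : ℕ} (F : Finset (MvPolynomial (Fin n) C)) :
    ∃ φ : (Language.ring[[C]]).BoundedFormula Empty n, φ.IsQF ∧ ∀ (M : Type u) [Field M]
      [Algebra C M] (e : Empty → M) (x : Fin n → M),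
      @BoundedFormula.Realize _ M (ringConStructure (algebraMap C M)) _ _ φ e x ↔
        ∀ f ∈ F, MvPolynomial.aeval x f = 0 := by
  classical
  induction F using Finset.induction_on with
  | empty =>
    exact ⟨⊤, BoundedFormula.IsQF.top, fun M _ _ e x ↦ by simp⟩
  | insert f F _ ih =>
    obtain ⟨φ, hφ, h⟩ := ih
    obtain ⟨t, ht⟩ := exists_realize_eq_aeval_ring f
    obtain ⟨z, hz⟩ := exists_realize_eq_aeval_ring (0 : MvPolynomial (Fin n) C)
    refine ⟨Term.bdEqual t z ⊓ φ, (BoundedFormula.IsAtomic.equal _ _).isQF.inf hφ,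
      fun M _ _ e x ↦ ?_⟩
    letI := ringConStructure (algebraMap C M)
    rw [BoundedFormula.realize_inf, h M e x, BoundedFormula.realize_bdEqual, ht M e x, hz M e x,
      map_zero, Finset.forall_mem_insert]

theorem solTransfer_of_thRingSub {n : ℕ} (h : ThRingSub (fun {_} φ => IsExistsN n φ) K
    (algebraMap C K) L (algebraMap C L)) : SolTransfer n C K L := by
  intro F g x hx hg
  obtain ⟨φ, hφ, hF⟩ := exists_isQF_forall_eq_zero F
  obtain ⟨ψ, hψ, hg'⟩ := exists_isQF_forall_eq_zero {g}
  have h1 : IsExistsN (0 + n) (φ ⊓ ∼ψ).exs := isExistsN_exs (.qf (hφ.inf hψ.not))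
  rw [zero_add] at h1
  have key : ∀ (M : Type u) [Field M] [Algebra C M], RealizeRing M (algebraMap C M) (φ ⊓ ∼ψ).exs ↔
      ∃ y : Fin n → M, (∀ f ∈ F, MvPolynomial.aeval y f = 0) ∧ MvPolynomial.aeval y g ≠ 0 := by
    intro M _ _
    letI := ringConStructure (algebraMap C M)
    change (φ ⊓ ∼ψ).exs.Realize (M := M) default ↔ _
    rw [BoundedFormula.realize_exs]
    refine exists_congr fun y ↦ ?_
    rw [BoundedFormula.realize_inf, BoundedFormula.realize_not, hF M, hg' M]
    simp
  exact (key L).1 (h _ (.base h1) ((key K).2 ⟨x, hx, hg⟩))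

end

theorem exists_pow_mul_le_one {C : Type*} [Field C] {u : Valuation C Zm0} {π : C}
    (h : IsUniformizer u π) (c : C) : ∃ k : ℕ, u (π ^ k * c) ≤ 1 := by
  by_cases hc : c = 0
  · exact ⟨0, by simp [hc]⟩
  have hc' : u c ≠ 0 := (Valuation.ne_zero_iff _).2 hc
  obtain ⟨k, hk⟩ := exists_pow_lt₀ h.2.1 (Units.mk0 (u c)⁻¹ (inv_ne_zero hc'))
  refine ⟨k, ?_⟩
  rw [Valuation.map_mul, Valuation.map_pow]
  calc u π ^ k * u c ≤ (u c)⁻¹ * u c := mul_le_mul_left hk.le _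
    _ = 1 := inv_mul_cancel₀ hc'

end Paper
namespace Paper

/-- Theorem `thm:En`(2) of the paper; mixed characteristic, unramified.
Let `(C, u)` be a `ℤ`-valued field of mixed characteristic whose uniformizer is
`p = char(Cu)`, and `(K, v)`, `(L, w)` henselian extensions in which `p` is still a
uniformizer, with `Kv/Cu` and `Lw/Cu` separable.  If
`Th_{∃_n}(Kv, Cu) ⊆ Th_{∃_n}(Lw, Cu)`, then `Th_{∃_n}(K, v, C) ⊆ Th_{∃_n}(L, w, C)`. -/
theorem statement2 (n : ℕ) (p : ℕ) (hp : p.Prime)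
    -- `(C, u)` is `ℤ`-valued of mixed characteristic `(0, p)` with uniformizer `p`
    (C : Type u) [Field C] (u : Valuation C Zm0) (hZ : Function.Surjective u)
    (hchar0 : ringChar C = 0) (hcharp : ringChar (ResF u) = p)
    (hπu : IsUniformizer u (p : C))
    -- the henselian extension `(K, v)` with uniformizer `p`
    (K : Type u) [Field K] [Algebra C K]
    (ΓK : Type u) [LinearOrderedCommGroupWithZero ΓK] (v : Valuation K ΓK)
    (hKC : (v.comap (algebraMap C K)).IsEquiv u)
    (hKhens : IsHenselian v) (hπv : IsUniformizer v (p : K))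
    -- the henselian extension `(L, w)` with uniformizer `p`
    (L : Type u) [Field L] [Algebra C L]
    (ΓL : Type u) [LinearOrderedCommGroupWithZero ΓL] (w : Valuation L ΓL)
    (hLC : (w.comap (algebraMap C L)).IsEquiv u)
    (hLhens : IsHenselian w) (hπw : IsUniformizer w (p : L))
    -- the residue extensions `Kv/Cu` and `Lw/Cu`, both separable
    (gK : ResF u →+* ResF v) (hgK : ResCompat u v gK) (hsepK : IsSepExtHom gK)
    (gL : ResF u →+* ResF w) (hgL : ResCompat u w gL) (hsepL : IsSepExtHom gL)
    -- `Th_{∃_n}(Kv, Cu) ⊆ Th_{∃_n}(Lw, Cu)`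
    (hres : ThRingSub (fun {k} φ => IsExistsN n φ) (ResF v) gK (ResF w) gL) :
    -- `Th_{∃_n}(K, v, C) ⊆ Th_{∃_n}(L, w, C)`
    ThValSub (fun {k} φ => IsExistsN n φ) K (Oset v) (algebraMap C K)
      L (Oset w) (algebraMap C L) := by
  letI := gK.toAlgebra
  letI := gL.toAlgebra
  haveI : CharZero C := by
    have := ringChar.charP C
    rw [hchar0] at this
    exact CharP.charP_to_charZero C
  haveI : CharZero K := charZero_of_injective_algebraMap (algebraMap C K).injective
  refine thValSub_of_sameSigns fun x F ↦ ?_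
  exact exists_same_signs hgK hgL hKC hLC hπu (by rwa [map_natCast]) (by rwa [map_natCast])
    (exists_pow_mul_le_one hπu) hsepK (solTransfer_of_thRingSub hres) hKhens.henselProp₀
    hLhens.henselProp₀ x F

end Paper
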